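/- Let (G_n) be a sequence of weighted graphs with |G_n| = n and β_max = sup_{i,j,n} β_ij(n) < ∞, converging to a graphon W, and let c > 0 be a constant. If W is irreducible, then C₁/n → ρ(cW) in probability and C₂ = o_p(n), where C₁ and C₂ are the numbers of vertices in the largest and second largest components of G_n(c/n). -/

import Mathlib

open MeasureTheory Filter Topology

noncomputable section

namespace Percolation

/-- The symmetrized lift of a two-variable real function to `Sym2`. If `f` is symmetric,
`sym2Val f s(a, b) = f a b`. -/
def sym2Val {α : Type*} (f : α → α → ℝ) : Sym2 α → ℝ :=
  Sym2.lift ⟨fun a b => (f a b + f b a) / 2, fun a b => by simp [add_comm]⟩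

/-- The product over the edges of `F` of a symmetric function of the endpoints. -/
def edgeProd {k : ℕ} (F : SimpleGraph (Fin k)) (f : Fin k → Fin k → ℝ) : ℝ := by
  classical exact ∏ e ∈ F.edgeFinset, sym2Val f e

/-- The homomorphism density `t(F, G)` of a finite simple graph `F` in the weighted graph
on `[n]` with edge weights `β`. -/
def homDensityG {n k : ℕ} (β : Fin n → Fin n → ℝ) (F : SimpleGraph (Fin k)) : ℝ :=
  (∑ v : Fin k → Fin n, edgeProd F fun i j => β (v i) (v j)) / (n : ℝ) ^ k

/-- The unit interval `[0,1] ⊆ ℝ`. -/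
def I01 : Set ℝ := Set.Icc 0 1

/-- The homomorphism density `t(F, W)` of a finite simple graph `F` in a graphon `W`. -/
def homDensityW {k : ℕ} (W : ℝ → ℝ → ℝ) (F : SimpleGraph (Fin k)) : ℝ :=
  ∫ x : Fin k → ℝ in Set.univ.pi fun _ => I01, edgeProd F fun i j => W (x i) (x j)

/-- `G_n → W`: convergence of the homomorphism densities for every finite simple graph. -/
def ConvergesTo (β : ∀ n : ℕ, Fin n → Fin n → ℝ) (W : ℝ → ℝ → ℝ) : Prop :=
  ∀ (k : ℕ) (F : SimpleGraph (Fin k)),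
    Tendsto (fun n => homDensityG (β n) F) atTop (nhds (homDensityW W F))

/-- `W` is a graphon: a bounded symmetric measurable function with nonnegative values. -/
def IsGraphon (W : ℝ → ℝ → ℝ) : Prop :=
  Measurable (Function.uncurry W) ∧ (∀ x y, 0 ≤ W x y) ∧ (∀ x y, W x y = W y x) ∧
    ∃ M : ℝ, ∀ x y, W x y ≤ M

/-- The Bernoulli measure on `Bool` with success probability `p`. -/
def bern (p : ℝ) : Measure Bool :=
  ENNReal.ofReal p • Measure.dirac true + ENNReal.ofReal (1 - p) • Measure.dirac false

/-- The law of the random graph in which each pair `{v, w}` is an edge independently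
with probability `min (p * β v w) 1`; a point of the sample space records for each
unordered pair whether it is an edge. -/
def percMeasure {V : Type*} [Fintype V] [DecidableEq V] (β : V → V → ℝ) (p : ℝ) :
    Measure (Sym2 V → Bool) :=
  Measure.pi fun e => bern (min (p * sym2Val β e) 1)

/-- The simple graph determined by a point of the sample space. -/
def graphOf {V : Type*} (ω : Sym2 V → Bool) : SimpleGraph V :=
  SimpleGraph.fromRel fun i j => ω s(i, j)

/-- The number of vertices of the component of `v` in `G`. -/
def compSize {V : Type*} (G : SimpleGraph V) (v : V) : ℕ := {w | G.Reachable v w}.ncard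

/-- The number of vertices of the largest component of `G`. -/
def C1 {V : Type*} [Fintype V] (G : SimpleGraph V) : ℕ :=
  Finset.univ.sup fun v => compSize G v

/-- The number of vertices of the second largest component of `G` (zero if `G` is
connected): the largest value of `min (|C_v|, |C_w|)` over vertices `v`, `w` lying in
distinct components. -/
def C2 {V : Type*} (G : SimpleGraph V) : ℕ :=
  sSup {m | ∃ v w : V, ¬G.Reachable v w ∧ m = min (compSize G v) (compSize G w)}

/-- The operator `T_W` with kernel `W` applied to `f`. -/
def applyT (W : ℝ → ℝ → ℝ) (f : ℝ → ℝ) (x : ℝ) : ℝ := ∫ y in I01, W x y * f y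

/-- The `L²[0,1]` norm of a function. -/
def l2norm (f : ℝ → ℝ) : ℝ := Real.sqrt (∫ x in I01, f x ^ 2)

/-- The `L²`-operator norm `‖T_W‖` of the integral operator with kernel `W`. -/
def opNorm (W : ℝ → ℝ → ℝ) : ℝ :=
  sSup {r | ∃ f : ℝ → ℝ, Measurable f ∧
    MeasureTheory.IntegrableOn (fun x => f x ^ 2) I01 ∧
    l2norm f ≤ 1 ∧ r = l2norm (applyT W f)}

/-- The survival probability `ρ(W)` of the multitype Poisson branching process with
kernel `W`: the supremum of `∫ f` over measurable `f : [0,1] → [0,1]` satisfying the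
functional equation `f(x) = 1 - exp(-∫ W(x,y) f(y) dy)` almost everywhere. -/
def survival (W : ℝ → ℝ → ℝ) : ℝ :=
  sSup {r | ∃ f : ℝ → ℝ, Measurable f ∧ (∀ x, f x ∈ Set.Icc (0 : ℝ) 1) ∧
    (∀ᵐ x ∂volume.restrict I01, f x = 1 - Real.exp (-∫ y in I01, W x y * f y)) ∧
    r = ∫ x in I01, f x}

/-- A graphon `W` is irreducible if there is no measurable `A ⊆ [0,1]` with
`0 < μ(A) < 1` such that `W = 0` a.e. on `A × ([0,1] \ A)`. -/
def Irreducible (W : ℝ → ℝ → ℝ) : Prop :=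
  ¬∃ A : Set ℝ, MeasurableSet A ∧ A ⊆ I01 ∧ 0 < volume A ∧ volume A < 1 ∧
    ∀ᵐ p : ℝ × ℝ, p.1 ∈ A → p.2 ∈ I01 \ A → W p.1 p.2 = 0

end Percolation

namespace Percolation
set_option linter.all false

section Bern
variable {ι : Type*} [Fintype ι] [DecidableEq ι]

def wt (p : ι → ℝ) (ω : ι → Bool) : ℝ := ∏ e, if ω e then p e else 1 - p e

def wtE (p : ι → ℝ) (e : ι) (ω : ι → Bool) : ℝ :=
  ∏ j ∈ Finset.univ.erase e, if ω j then p j else 1 - p j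

def Ex (p : ι → ℝ) (f : (ι → Bool) → ℝ) : ℝ := ∑ ω, wt p ω * f ω

def up (e : ι) (b : Bool) (ω : ι → Bool) : ι → Bool := Function.update ω e b

lemma wt_eq (p : ι → ℝ) (e : ι) (ω : ι → Bool) :
    wt p ω = (if ω e then p e else 1 - p e) * wtE p e ω := by
  unfold wt wtE
  rw [Finset.mul_prod_erase _ (fun j => if ω j then p j else 1 - p j) (Finset.mem_univ e)]

lemma wtE_up (p : ι → ℝ) (e : ι) (b : Bool) (ω : ι → Bool) :
    wtE p e (up e b ω) = wtE p e ω := by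
  unfold wtE up
  refine Finset.prod_congr rfl fun j hj => ?_
  rw [Function.update_of_ne (Finset.ne_of_mem_erase hj)]

lemma up_self (e : ι) (b : Bool) (ω : ι → Bool) : up e b ω e = b := by simp [up]

lemma up_ne {e j : ι} (h : j ≠ e) (b : Bool) (ω : ι → Bool) : up e b ω j = ω j := by simp [up, h]

lemma up_up (e : ι) (b b' : Bool) (ω : ι → Bool) : up e b (up e b' ω) = up e b ω := by simp [up]

lemma up_of_eq {e : ι} {b : Bool} {ω : ι → Bool} (h : ω e = b) : up e b ω = ω := by
  subst h; simp [up]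

lemma sum_up (e : ι) (h : (ι → Bool) → ℝ) :
    ∑ ω, (h (up e true ω) + h (up e false ω)) = 2 * ∑ ω, h ω := by
  have hinv : Function.Involutive (fun ω : ι → Bool => up e (!ω e) ω) := by
    intro ω
    simp only [up_self, up_up, Bool.not_not]
    exact up_of_eq rfl
  have h1 : ∑ ω, h (up e (!ω e) ω) = ∑ ω, h ω := Equiv.sum_comp hinv.toPerm h
  have h2 : ∀ ω, h (up e true ω) + h (up e false ω) = h ω + h (up e (!ω e) ω) := by
    intro ω
    cases hω : ω e
    · rw [up_of_eq hω]; simp [add_comm]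
    · rw [up_of_eq hω]; simp
  simp only [h2, Finset.sum_add_distrib, h1]; ring

lemma Ex_of_indep (p : ι → ℝ) (e : ι) (f : (ι → Bool) → ℝ)
    (hf : ∀ ω, f (up e true ω) = f (up e false ω)) :
    Ex p f = (1 / 2) * ∑ ω, wtE p e ω * f ω := by
  have h1 := sum_up e (fun ω => wt p ω * f ω)
  have h2 := sum_up e (fun ω => wtE p e ω * f ω)
  have h3 : ∀ ω, wt p (up e true ω) * f (up e true ω) + wt p (up e false ω) * f (up e false ω)
      = (1 / 2) * (wtE p e (up e true ω) * f (up e true ω)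
        + wtE p e (up e false ω) * f (up e false ω)) := by
    intro ω
    rw [wt_eq p e, wt_eq p e]
    simp only [up_self, wtE_up, hf]
    simp; ring
  simp only [h3, ← Finset.mul_sum] at h1
  unfold Ex; linarith

lemma Ex_split (p : ι → ℝ) (e : ι) (f : (ι → Bool) → ℝ) :
    Ex p f = p e * Ex p (fun ω => f (up e true ω)) + (1 - p e) * Ex p (fun ω => f (up e false ω)) := by
  rw [Ex_of_indep p e (fun ω => f (up e true ω)) (by intro ω; simp [up_up]),
    Ex_of_indep p e (fun ω => f (up e false ω)) (by intro ω; simp [up_up])]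
  have h1 := sum_up e (fun ω => wt p ω * f ω)
  have h3 : ∀ ω, wt p (up e true ω) * f (up e true ω) + wt p (up e false ω) * f (up e false ω)
      = p e * (wtE p e ω * f (up e true ω)) + (1 - p e) * (wtE p e ω * f (up e false ω)) := by
    intro ω
    rw [wt_eq p e, wt_eq p e]
    simp only [up_self, wtE_up]
    simp; ring
  simp only [h3, Finset.sum_add_distrib, ← Finset.mul_sum] at h1
  unfold Ex; linarith

lemma Ex_add (p : ι → ℝ) (f g : (ι → Bool) → ℝ) :
    Ex p (fun ω => f ω + g ω) = Ex p f + Ex p g := by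
  simp [Ex, mul_add, Finset.sum_add_distrib]

lemma Ex_sub (p : ι → ℝ) (f g : (ι → Bool) → ℝ) :
    Ex p (fun ω => f ω - g ω) = Ex p f - Ex p g := by
  simp [Ex, mul_sub, Finset.sum_sub_distrib]

lemma Ex_mul (p : ι → ℝ) (a : ℝ) (f : (ι → Bool) → ℝ) :
    Ex p (fun ω => a * f ω) = a * Ex p f := by
  simp only [Ex, Finset.mul_sum]
  exact Finset.sum_congr rfl fun _ _ => by ring

lemma Ex_sum {κ : Type*} (p : ι → ℝ) (s : Finset κ) (f : κ → (ι → Bool) → ℝ) :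
    Ex p (fun ω => ∑ i ∈ s, f i ω) = ∑ i ∈ s, Ex p (f i) := by
  simp only [Ex, Finset.mul_sum]
  exact Finset.sum_comm

lemma sum_wt (p : ι → ℝ) : ∑ ω, wt p ω = 1 := by
  have := Finset.prod_univ_sum (fun _ : ι => (Finset.univ : Finset Bool))
    (fun e b => if b then p e else 1 - p e)
  simp only [Fintype.piFinset_univ, Fintype.sum_bool] at this
  unfold wt
  rw [← this]
  simp

lemma Ex_const (p : ι → ℝ) (a : ℝ) : Ex p (fun _ => a) = a := by
  simp [Ex, ← Finset.sum_mul, sum_wt]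

/-- admissible probabilities -/
def Adm (p : ι → ℝ) : Prop := ∀ e, 0 ≤ p e ∧ p e ≤ 1

lemma wt_nonneg {p : ι → ℝ} (hp : Adm p) (ω : ι → Bool) : 0 ≤ wt p ω := by
  unfold wt
  refine Finset.prod_nonneg fun e _ => ?_
  have := hp e
  split_ifs <;> linarith

lemma Ex_mono {p : ι → ℝ} (hp : Adm p) {f g : (ι → Bool) → ℝ} (h : ∀ ω, f ω ≤ g ω) :
    Ex p f ≤ Ex p g :=
  Finset.sum_le_sum fun ω _ => mul_le_mul_of_nonneg_left (h ω) (wt_nonneg hp ω)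

lemma Ex_nonneg {p : ι → ℝ} (hp : Adm p) {f : (ι → Bool) → ℝ} (h : ∀ ω, 0 ≤ f ω) :
    0 ≤ Ex p f := by
  have := Ex_mono hp h
  rwa [Ex_const] at this

lemma Ex_sq_le {p : ι → ℝ} (hp : Adm p) (f : (ι → Bool) → ℝ) :
    (Ex p f) ^ 2 ≤ Ex p (fun ω => f ω ^ 2) := by
  have h : 0 ≤ Ex p (fun ω => (f ω ^ 2 + (-(2 * Ex p f)) * f ω) + (Ex p f) ^ 2) :=
    Ex_nonneg hp fun ω => by nlinarith [sq_nonneg (f ω - Ex p f)]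
  rw [Ex_add, Ex_add, Ex_mul, Ex_const] at h
  nlinarith

lemma var_eq (p : ι → ℝ) (f : (ι → Bool) → ℝ) :
    Ex p (fun ω => (f ω - Ex p f) ^ 2) = Ex p (fun ω => f ω ^ 2) - (Ex p f) ^ 2 := by
  have : (fun ω => (f ω - Ex p f) ^ 2)
      = fun ω => (f ω ^ 2 + (-(2 * Ex p f)) * f ω) + (Ex p f) ^ 2 := by
    ext ω; ring
  rw [this, Ex_add, Ex_add, Ex_mul, Ex_const]; ring

lemma Ex_abs_le {p : ι → ℝ} (hp : Adm p) (f : (ι → Bool) → ℝ) : |Ex p f| ≤ Ex p (fun ω => |f ω|) := by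
  rw [abs_le]
  constructor
  · have := Ex_mono hp (fun ω => neg_abs_le (f ω))
    have h2 := Ex_mul p (-1) (fun ω => |f ω|)
    simp only [neg_mul, one_mul] at h2
    linarith
  · exact Ex_mono hp fun ω => le_abs_self _

lemma var_aux {p : ι → ℝ} (hp : Adm p) (K : ℝ) (A : Finset ι) :
    ∀ f : (ι → Bool) → ℝ, (∀ ω ω', (∀ e ∈ A, ω e = ω' e) → f ω = f ω') →
    (∀ e ω, |f (up e true ω) - f (up e false ω)| ≤ K) →
    Ex p (fun ω => f ω ^ 2) - (Ex p f) ^ 2 ≤ K ^ 2 * ∑ e ∈ A, p e := by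
  induction A using Finset.induction_on with
  | empty =>
    intro f hf _
    have : f = fun _ => f (fun _ => true) := by ext ω; exact hf _ _ (by simp)
    rw [this]; simp [Ex_const]
  | insert a A ha ih =>
    intro f hf hK
    have pa := hp a
    set g : (ι → Bool) → ℝ := fun ω => p a * f (up a true ω) + (1 - p a) * f (up a false ω) with hg
    have hEg : Ex p f = Ex p g := by
      rw [Ex_split p a f, hg, Ex_add, Ex_mul, Ex_mul]
    have hsq : Ex p (fun ω => f ω ^ 2) ≤ Ex p (fun ω => g ω ^ 2) + p a * K ^ 2 := by
      rw [Ex_split p a, ← Ex_mul, ← Ex_mul, ← Ex_add, ← Ex_const p (p a * K ^ 2), ← Ex_add]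
      refine Ex_mono hp fun ω => ?_
      have h1 := hK a ω
      have h2 : (f (up a true ω) - f (up a false ω)) ^ 2 ≤ K ^ 2 := by
        rw [← sq_abs]; exact pow_le_pow_left₀ (abs_nonneg _) h1 2
      have h3 : p a * (1 - p a) * (f (up a true ω) - f (up a false ω)) ^ 2 ≤ p a * K ^ 2 := by
        have : p a * (1 - p a) ≤ p a := by nlinarith
        calc _ ≤ p a * (f (up a true ω) - f (up a false ω)) ^ 2 :=
              mul_le_mul_of_nonneg_right this (sq_nonneg _)
          _ ≤ _ := mul_le_mul_of_nonneg_left h2 pa.1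
      simp only [hg]
      nlinarith
    have hcomm : ∀ e b b' ω, e ≠ a → up a b (up e b' ω) = up e b' (up a b ω) := by
      intro e b b' ω he
      unfold up; exact Function.update_comm he _ _ _
    have := ih g ?_ ?_
    · rw [Finset.sum_insert ha, hEg]; nlinarith
    · intro ω ω' h
      have : ∀ b, f (up a b ω) = f (up a b ω') := by
        intro b
        refine hf _ _ fun e he => ?_
        by_cases hea : e = a
        · subst hea; simp [up_self]
        · rw [up_ne hea, up_ne hea]
          exact h e (Finset.mem_of_mem_insert_of_ne he hea)
      simp [hg, this]
    · intro e ω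
      by_cases hea : e = a
      · subst hea
        have hK0 : 0 ≤ K := (abs_nonneg _).trans (hK e ω)
        simpa [hg, up_up] using hK0
      · simp only [hg, hcomm e _ _ ω hea]
        have h1 := abs_le.1 (hK e (up a true ω))
        have h2 := abs_le.1 (hK e (up a false ω))
        rw [abs_le]
        constructor <;> nlinarith

lemma var_le {p : ι → ℝ} (hp : Adm p) (K : ℝ) (f : (ι → Bool) → ℝ)
    (hK : ∀ e ω, |f (up e true ω) - f (up e false ω)| ≤ K) :
    Ex p (fun ω => (f ω - Ex p f) ^ 2) ≤ K ^ 2 * ∑ e, p e := by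
  rw [var_eq]
  exact var_aux hp K Finset.univ f (fun ω ω' h => by
    congr 1; ext e; rw [h e (Finset.mem_univ e)]) hK

lemma russo (a : ι → ℝ) (f : (ι → Bool) → ℝ) (t : ℝ) :
    HasDerivAt (fun t : ℝ => Ex (fun e => t * a e) f)
      (∑ e, a e * Ex (fun e => t * a e) (fun ω => f (up e true ω) - f (up e false ω))) t := by
  have h1 : ∀ ω : ι → Bool, HasDerivAt (fun t : ℝ => wt (fun e => t * a e) ω * f ω)
      ((∑ e, wtE (fun e => t * a e) e ω * (if ω e then a e else -a e)) * f ω) t := by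
    intro ω
    have : ∀ e ∈ (Finset.univ : Finset ι), HasDerivAt (fun t : ℝ => if ω e then t * a e else 1 - t * a e)
        (if ω e then a e else -a e) t := by
      intro e _
      split_ifs
      · simpa using (hasDerivAt_id t).mul_const (a e)
      · simpa using ((hasDerivAt_id t).mul_const (a e)).const_sub 1
    have := (HasDerivAt.fun_finsetProd this).mul_const (f ω)
    simpa [wt, wtE] using this
  have h2 := HasDerivAt.fun_sum (u := Finset.univ) (fun ω _ => h1 ω)
  refine h2.congr_deriv ?_
  simp only [Finset.sum_mul]
  rw [Finset.sum_comm]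
  symm
  refine Finset.sum_congr rfl fun e _ => ?_
  rw [Ex_of_indep _ e _ (by intro ω; simp [up_up])]
  have h3 := sum_up e (fun ω => wtE (fun e => t * a e) e ω * (if ω e then a e else -a e) * f ω)
  simp only [wtE_up, up_self, if_true, Bool.false_eq_true, if_false] at h3
  rw [← mul_assoc, Finset.mul_sum]
  have h4 : ∀ ω, wtE (fun e => t * a e) e ω * a e * f (up e true ω) +
      wtE (fun e => t * a e) e ω * (-a e) * f (up e false ω)
      = a e * (wtE (fun e => t * a e) e ω * (f (up e true ω) - f (up e false ω))) := by
    intro ω; ring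
  simp only [h4] at h3
  have h5 : ∑ ω, a e * (1 / 2) * (wtE (fun e => t * a e) e ω * (f (up e true ω) - f (up e false ω)))
     = (1 / 2) * ∑ ω, a e * (wtE (fun e => t * a e) e ω * (f (up e true ω) - f (up e false ω))) := by
    rw [Finset.mul_sum]; exact Finset.sum_congr rfl fun _ _ => by ring
  rw [h5, h3]; ring

lemma Ex_mono_t {a : ι → ℝ} (ha : ∀ e, 0 ≤ a e) {s t : ℝ} (hs : 0 ≤ s) (hst : s ≤ t)
    (ht : ∀ e, t * a e ≤ 1) {f : (ι → Bool) → ℝ}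
    (hf : ∀ e ω, f (up e false ω) ≤ f (up e true ω)) :
    Ex (fun e => s * a e) f ≤ Ex (fun e => t * a e) f := by
  have hm : MonotoneOn (fun t : ℝ => Ex (fun e => t * a e) f) (Set.Icc s t) := by
    refine monotoneOn_of_deriv_nonneg (convex_Icc s t)
      (fun x _ => (russo a f x).continuousAt.continuousWithinAt)
      (fun x _ => (russo a f x).differentiableAt.differentiableWithinAt) ?_
    intro x hx
    rw [interior_Icc] at hx
    rw [(russo a f x).deriv]
    refine Finset.sum_nonneg fun e _ => mul_nonneg (ha e) (Ex_nonneg ?_ fun ω => sub_nonneg.2 (hf e ω))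
    intro e
    exact ⟨mul_nonneg (hs.trans hx.1.le) (ha e),
      (mul_le_mul_of_nonneg_right hx.2.le (ha e)).trans (ht e)⟩
  exact hm ⟨le_rfl, hst⟩ ⟨hst, le_rfl⟩ hst

/-- replacing independent coordinates by their means inside a product -/
lemma Ex_prod_indep (p : ι → ℝ) {κ : Type*} (J : Finset κ) (s : κ → ι)
    (hs : Set.InjOn s J) (L : κ → (ι → Bool) → ℝ) (g : (ι → Bool) → ℝ)
    (hL : ∀ i ∈ J, ∀ j b ω, j ∈ J → L i (up (s j) b ω) = L i ω)
    (hg : ∀ j b ω, j ∈ J → g (up (s j) b ω) = g ω) :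
    Ex p (fun ω => g ω * ∏ i ∈ J, (1 - (if ω (s i) then 1 else 0) * L i ω))
      = Ex p (fun ω => g ω * ∏ i ∈ J, (1 - p (s i) * L i ω)) := by
  classical
  induction J using Finset.induction_on generalizing g with
  | empty => simp
  | insert a A ha ih =>
    have hne : ∀ i ∈ A, s i ≠ s a := by
      intro i hi h
      have := hs (Finset.mem_insert_of_mem hi) (Finset.mem_insert_self a A) h
      exact ha (this ▸ hi)
    have step : Ex p (fun ω => g ω * ∏ i ∈ insert a A, (1 - (if ω (s i) then 1 else 0) * L i ω))
        = Ex p (fun ω => (g ω * (1 - p (s a) * L a ω)) *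
            ∏ i ∈ A, (1 - (if ω (s i) then 1 else 0) * L i ω)) := by
      rw [Ex_split p (s a), Ex_split p (s a) (fun ω => (g ω * (1 - p (s a) * L a ω)) *
            ∏ i ∈ A, (1 - (if ω (s i) then 1 else 0) * L i ω)), ← Ex_mul, ← Ex_mul, ← Ex_mul, ← Ex_mul,
            ← Ex_add, ← Ex_add]
      congr 1
      ext ω
      have hLa : ∀ i ∈ insert a A, ∀ b, L i (up (s a) b ω) = L i ω := fun i hi b =>
        hL i hi a b ω (Finset.mem_insert_self a A)
      have hpr : ∀ b, ∏ i ∈ A, (1 - (if up (s a) b ω (s i) then (1:ℝ) else 0) * L i (up (s a) b ω))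
          = ∏ i ∈ A, (1 - (if ω (s i) then (1:ℝ) else 0) * L i ω) := by
        intro b
        refine Finset.prod_congr rfl fun i hi => ?_
        rw [up_ne (hne i hi), hLa i (Finset.mem_insert_of_mem hi)]
      simp only [Finset.prod_insert ha, hpr, hg a _ ω (Finset.mem_insert_self a A),
        hLa a (Finset.mem_insert_self a A), up_self]
      simp; ring
    rw [step, ih (hs.mono (by simp)) _ (fun i hi j b ω hj => hL i (Finset.mem_insert_of_mem hi) j b ω
      (Finset.mem_insert_of_mem hj))]
    · congr 1; ext ω; rw [Finset.prod_insert ha]; ring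
    · intro j b ω hj
      rw [hg j b ω (Finset.mem_insert_of_mem hj), hL a (Finset.mem_insert_self a A) j b ω
        (Finset.mem_insert_of_mem hj)]

/-- set a family of coordinates to false -/
def kill (J : ι → Prop) [DecidablePred J] (ω : ι → Bool) : ι → Bool := fun e => if J e then false else ω e

lemma Ex_kill (p : ι → ℝ) (J : ι → Prop) [DecidablePred J] (f : (ι → Bool) → ℝ) :
    Ex p (fun ω => f (kill J ω)) = Ex (fun e => if J e then 0 else p e) f := by
  have key : ∀ A : Finset ι, ∀ (q : ι → ℝ) (f : (ι → Bool) → ℝ),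
      Ex q (fun ω => f (kill (· ∈ A) ω)) = Ex (fun e => if e ∈ A then 0 else q e) f := by
    intro A
    induction A using Finset.induction_on with
    | empty =>
      intro q f
      have : ∀ ω : ι → Bool, kill (· ∈ (∅:Finset ι)) ω = ω := fun ω => by ext; simp [kill]
      simp [this]
    | insert a A ha ih =>
      intro q f
      have h1 : ∀ ω, kill (· ∈ insert a A) ω = up a false (kill (· ∈ A) ω) := by
        intro ω; ext e
        by_cases h : e = a
        · subst h; simp [kill, up_self]
        · simp [kill, up_ne h, h]
      simp only [h1]
      rw [ih q (fun ω => f (up a false ω)), Ex_split _ a f]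
      rw [Ex_of_indep _ a _ (by intro ω; simp [up_up])]
      simp only [Finset.mem_insert_self, if_true, zero_mul, zero_add, sub_zero, one_mul]
      rw [Ex_of_indep _ a (fun ω => f (up a false ω)) (by intro ω; simp [up_up])]
      congr 1
      refine Finset.sum_congr rfl fun ω _ => ?_
      congr 1
      unfold wtE
      refine Finset.prod_congr rfl fun j hj => ?_
      have : j ≠ a := Finset.ne_of_mem_erase hj
      simp [this]
  have := key (Finset.univ.filter J) p f
  have h : ∀ ω : ι → Bool, kill (· ∈ Finset.univ.filter J) ω = kill J ω := fun ω => by ext; simp [kill]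
  simp only [h] at this
  rw [this]; congr 1; ext e; simp

end Bern

end Percolation

namespace Percolation
set_option linter.all false

section Comb
variable {V : Type*} [Fintype V] [DecidableEq V]

abbrev Cfg (V : Type*) := Sym2 V → Bool

def Aj (ω : Cfg V) (u v : V) : Prop := u ≠ v ∧ ω s(u, v) = true

def Rch (ω : Cfg V) (u v : V) : Prop := (graphOf ω).Reachable u v

lemma adj_iff (ω : Cfg V) (u v : V) : (graphOf ω).Adj u v ↔ Aj ω u v := by
  simp [graphOf, Aj, SimpleGraph.fromRel_adj, Sym2.eq_swap (a := v)]

lemma Rch.refl (ω : Cfg V) (u : V) : Rch ω u u := SimpleGraph.Reachable.refl _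

lemma Rch.symm {ω : Cfg V} {u v : V} (h : Rch ω u v) : Rch ω v u := SimpleGraph.Reachable.symm h

lemma Rch.trans {ω : Cfg V} {u v w : V} (h : Rch ω u v) (h' : Rch ω v w) : Rch ω u w :=
  SimpleGraph.Reachable.trans h h'

lemma Aj.rch {ω : Cfg V} {u v : V} (h : Aj ω u v) : Rch ω u v :=
  SimpleGraph.Adj.reachable ((adj_iff _ _ _).2 h)

lemma Rch.induct {ω : Cfg V} {u : V} {P : V → Prop} (h0 : P u)
    (hs : ∀ x y, Rch ω u x → P x → Aj ω x y → P y) {v : V} (h : Rch ω u v) : P v := by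
  have h' := (SimpleGraph.reachable_iff_reflTransGen _ _).1 h
  clear h
  induction h' with
  | refl => exact h0
  | tail a b ih =>
    exact hs _ _ ((SimpleGraph.reachable_iff_reflTransGen _ _).2 a) ih ((adj_iff _ _ _).1 b)

lemma Rch.mono {ω ω' : Cfg V} (h : ∀ e, ω e = true → ω' e = true) {u v : V} (hr : Rch ω u v) :
    Rch ω' u v :=
  hr.induct (Rch.refl _ _) fun _ _ _ hP ha => hP.trans (Aj.rch ⟨ha.1, h _ ha.2⟩)

open Classical in
def comp (ω : Cfg V) (v : V) : Finset V := Finset.univ.filter (Rch ω v)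

lemma mem_comp {ω : Cfg V} {v w : V} : w ∈ comp ω v ↔ Rch ω v w := by simp [comp]

def cs (ω : Cfg V) (v : V) : ℕ := (comp ω v).card

lemma compSize_eq (ω : Cfg V) (v : V) : compSize (graphOf ω) v = cs ω v := by
  unfold compSize cs
  rw [← Set.ncard_coe_finset]
  congr 1; ext w; simp only [Set.mem_setOf_eq, Finset.mem_coe, mem_comp]; rfl

lemma comp_eq {ω : Cfg V} {v w : V} (h : Rch ω v w) : comp ω v = comp ω w := by
  ext x; rw [mem_comp, mem_comp]
  exact ⟨fun hx => h.symm.trans hx, fun hx => h.trans hx⟩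

lemma cs_eq {ω : Cfg V} {v w : V} (h : Rch ω v w) : cs ω v = cs ω w := by
  unfold cs; rw [comp_eq h]

lemma cs_pos (ω : Cfg V) (v : V) : 1 ≤ cs ω v :=
  Finset.card_pos.2 ⟨v, mem_comp.2 (Rch.refl _ _)⟩

lemma comp_mono {ω ω' : Cfg V} (h : ∀ e, ω e = true → ω' e = true) (v : V) :
    comp ω v ⊆ comp ω' v := fun x hx => mem_comp.2 ((mem_comp.1 hx).mono h)

lemma cs_mono {ω ω' : Cfg V} (h : ∀ e, ω e = true → ω' e = true) (v : V) : cs ω v ≤ cs ω' v :=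
  Finset.card_le_card (comp_mono h v)

lemma up_ft (e : Sym2 V) (ω : Cfg V) : ∀ e', up e false ω e' = true → up e true ω e' = true := by
  intro e' h
  by_cases he : e' = e
  · subst he; exact up_self _ _ _
  · rw [up_ne he] at h ⊢; exact h

lemma rch_up (u v : V) (ω : Cfg V) {x y : V} (h : Rch (up s(u, v) true ω) x y) :
    Rch (up s(u, v) false ω) x y ∨
    (Rch (up s(u, v) false ω) x u ∧ Rch (up s(u, v) false ω) v y) ∨
    (Rch (up s(u, v) false ω) x v ∧ Rch (up s(u, v) false ω) u y) := by
  refine h.induct (P := fun y => Rch (up s(u, v) false ω) x y ∨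
    (Rch (up s(u, v) false ω) x u ∧ Rch (up s(u, v) false ω) v y) ∨
    (Rch (up s(u, v) false ω) x v ∧ Rch (up s(u, v) false ω) u y)) (Or.inl (Rch.refl _ _)) ?_
  intro y z _ hP ha
  by_cases he : s(y, z) = s(u, v)
  · rw [Sym2.eq_iff] at he
    rcases he with ⟨rfl, rfl⟩ | ⟨rfl, rfl⟩
    · rcases hP with h | ⟨h1, h2⟩ | ⟨h1, h2⟩
      · exact Or.inr (Or.inl ⟨h, Rch.refl _ _⟩)
      · exact Or.inr (Or.inl ⟨h1, Rch.refl _ _⟩)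
      · exact Or.inl h1
    · rcases hP with h | ⟨h1, h2⟩ | ⟨h1, h2⟩
      · exact Or.inr (Or.inr ⟨h, Rch.refl _ _⟩)
      · exact Or.inl h1
      · exact Or.inr (Or.inr ⟨h1, Rch.refl _ _⟩)
  · have ha' : Aj (up s(u, v) false ω) y z := by
      refine ⟨ha.1, ?_⟩
      have := ha.2
      rw [up_ne he] at this ⊢; exact this
    rcases hP with h | ⟨h1, h2⟩ | ⟨h1, h2⟩
    · exact Or.inl (h.trans ha'.rch)
    · exact Or.inr (Or.inl ⟨h1, h2.trans ha'.rch⟩)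
    · exact Or.inr (Or.inr ⟨h1, h2.trans ha'.rch⟩)

/-- indicator of a large component -/
def L (k : ℕ) (ω : Cfg V) (v : V) : ℝ := if k ≤ cs ω v then 1 else 0

lemma L_nonneg (k : ℕ) (ω : Cfg V) (v : V) : 0 ≤ L k ω v := by unfold L; split_ifs <;> norm_num
lemma L_le_one (k : ℕ) (ω : Cfg V) (v : V) : L k ω v ≤ 1 := by unfold L; split_ifs <;> norm_num

lemma L_mono {k : ℕ} {ω ω' : Cfg V} (h : ∀ e, ω e = true → ω' e = true) (v : V) :
    L k ω v ≤ L k ω' v := by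
  unfold L
  have := cs_mono h v
  split_ifs <;> first | omega | norm_num

lemma comp_changed (u v : V) (ω : Cfg V) (x : V)
    (hu : ¬ Rch (up s(u, v) false ω) x u) (hv : ¬ Rch (up s(u, v) false ω) x v) :
    comp (up s(u, v) true ω) x = comp (up s(u, v) false ω) x := by
  refine Finset.Subset.antisymm ?_ (comp_mono (up_ft _ _) x)
  intro y hy
  rw [mem_comp] at hy ⊢
  rcases rch_up u v ω hy with h | h | h
  · exact h
  · exact absurd h.1 hu
  · exact absurd h.1 hv

lemma sumL_diff (k : ℕ) (g : V → ℝ) (a : ℝ) (hg : ∀ v, 0 ≤ g v ∧ g v ≤ a) (e : Sym2 V) (ω : Cfg V) :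
    0 ≤ ∑ v, g v * L k (up e true ω) v - ∑ v, g v * L k (up e false ω) v ∧
    ∑ v, g v * L k (up e true ω) v - ∑ v, g v * L k (up e false ω) v ≤ 2 * k * a := by
  classical
  rw [← Finset.sum_sub_distrib]
  constructor
  · refine Finset.sum_nonneg fun v _ => ?_
    rw [← mul_sub]
    exact mul_nonneg (hg v).1 (sub_nonneg.2 (L_mono (up_ft e ω) v))
  · induction e using Sym2.ind with
    | _ u v =>
    have ha : 0 ≤ a := (hg u).1.trans (hg u).2
    set S : V → Finset V := fun x => if cs (up s(u, v) false ω) x < k then comp (up s(u, v) false ω) x else ∅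
    have hS : ∀ x, ((S x).card : ℝ) ≤ k := by
      intro x
      simp only [S]
      split_ifs with h
      · unfold cs at h; exact_mod_cast h.le
      · simp
    have hb : ∀ x, g x * L k (up s(u, v) true ω) x - g x * L k (up s(u, v) false ω) x
        ≤ (if x ∈ S u then a else 0) + (if x ∈ S v then a else 0) := by
      intro x
      have h0 : (0:ℝ) ≤ (if x ∈ S u then a else 0) + (if x ∈ S v then a else 0) := by
        split_ifs <;> linarith
      rw [← mul_sub]
      by_cases h1 : k ≤ cs (up s(u, v) false ω) x
      · have : L k (up s(u, v) true ω) x - L k (up s(u, v) false ω) x ≤ 0 := by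
          have := L_le_one k (up s(u, v) true ω) x
          simp only [L, h1, if_true] at this ⊢; linarith
        exact (mul_nonpos_of_nonneg_of_nonpos (hg x).1 this).trans h0
      · have hle : g x * (L k (up s(u, v) true ω) x - L k (up s(u, v) false ω) x) ≤ a := by
          have h2 := L_le_one k (up s(u, v) true ω) x
          have h3 := L_nonneg k (up s(u, v) false ω) x
          have h4 := hg x
          nlinarith
        by_cases hu : Rch (up s(u, v) false ω) x u
        · have : x ∈ S u := by
            simp only [S]; rw [if_pos (by rw [← cs_eq hu]; omega), mem_comp]; exact hu.symm
          rw [if_pos this]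
          split_ifs <;> linarith
        by_cases hv : Rch (up s(u, v) false ω) x v
        · have : x ∈ S v := by
            simp only [S]; rw [if_pos (by rw [← cs_eq hv]; omega), mem_comp]; exact hv.symm
          rw [if_pos this]
          split_ifs <;> linarith
        · have : L k (up s(u, v) true ω) x = L k (up s(u, v) false ω) x := by
            unfold L cs; rw [comp_changed u v ω x hu hv]
          rw [this]; simpa using h0
    refine (Finset.sum_le_sum fun x _ => hb x).trans ?_
    rw [Finset.sum_add_distrib, Finset.sum_ite_mem, Finset.sum_ite_mem]
    simp only [Finset.univ_inter, Finset.sum_const, nsmul_eq_mul]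
    have := mul_le_mul_of_nonneg_right (hS u) ha
    have := mul_le_mul_of_nonneg_right (hS v) ha
    linarith

def Bd (k : ℕ) (ω : Cfg V) (u w : V) : Prop := k ≤ cs ω u ∧ k ≤ cs ω w ∧ ¬ Rch ω u w

open Classical in
def bd (k : ℕ) (ω : Cfg V) (u w : V) : ℝ := if Bd k ω u w then 1 else 0

lemma bd_nonneg (k : ℕ) (ω : Cfg V) (u w : V) : 0 ≤ bd k ω u w := by
  unfold bd; split_ifs <;> norm_num
lemma bd_le_one (k : ℕ) (ω : Cfg V) (u w : V) : bd k ω u w ≤ 1 := by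
  unfold bd; split_ifs <;> norm_num

lemma Bd.symm {k : ℕ} {ω : Cfg V} {u w : V} (h : Bd k ω u w) : Bd k ω w u :=
  ⟨h.2.1, h.1, fun hr => h.2.2 hr.symm⟩

def Psi (k : ℕ) (ω : Cfg V) : ℝ := ∑ v, max (1 - (k : ℝ) / cs ω v) 0

lemma Psi_bounds (k : ℕ) (ω : Cfg V) : 0 ≤ Psi k ω ∧ Psi k ω ≤ Fintype.card V := by
  unfold Psi
  constructor
  · exact Finset.sum_nonneg fun v _ => le_max_right _ _
  · calc _ ≤ ∑ _v : V, (1:ℝ) := Finset.sum_le_sum fun v _ => max_le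
          (by have : 0 ≤ (k:ℝ) / cs ω v := by positivity
              linarith) zero_le_one
      _ = _ := by simp

lemma psi_mono (k : ℕ) {a b : ℕ} (ha : 1 ≤ a) (hab : a ≤ b) :
    max (1 - (k : ℝ) / a) 0 ≤ max (1 - (k : ℝ) / b) 0 := by
  refine max_le_max ?_ le_rfl
  have : (k:ℝ) / b ≤ k / a := by
    have : (0:ℝ) < a := by exact_mod_cast ha
    gcongr
  linarith

lemma Psi_mono (k : ℕ) {ω ω' : Cfg V} (h : ∀ e, ω e = true → ω' e = true) :
    Psi k ω ≤ Psi k ω' :=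
  Finset.sum_le_sum fun v _ => psi_mono k (cs_pos _ v) (cs_mono h v)

lemma Psi_diff0 (k : ℕ) (u v : V) (ω : Cfg V) (huv : u ≠ v) (h : Bd k (up s(u, v) false ω) u v) :
    (k : ℝ) ≤ Psi k (up s(u, v) true ω) - Psi k (up s(u, v) false ω) := by
  classical
  obtain ⟨h1, h2, h3⟩ := h
  have huv1 : Rch (up s(u, v) true ω) u v := Aj.rch ⟨huv, up_self _ _ _⟩
  set ω0 := up s(u, v) false ω
  set ω1 := up s(u, v) true ω
  have hsub : ∀ x, comp ω0 x ⊆ comp ω1 x := comp_mono (up_ft _ _)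
  have hdisj : Disjoint (comp ω0 u) (comp ω0 v) := by
    rw [Finset.disjoint_left]
    intro x hx hy
    exact h3 ((mem_comp.1 hx).trans (mem_comp.1 hy).symm)
  have hcard : cs ω0 u + cs ω0 v ≤ cs ω1 u := by
    unfold cs
    rw [← Finset.card_union_of_disjoint hdisj]
    refine Finset.card_le_card (Finset.union_subset (hsub u) ?_)
    rw [comp_eq huv1]; exact hsub v
  set a := cs ω0 u with ha
  set b := cs ω0 v with hb
  have hf : ∀ x, 0 ≤ max (1 - (k : ℝ) / cs ω1 x) 0 - max (1 - (k : ℝ) / cs ω0 x) 0 := fun x =>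
    sub_nonneg.2 (psi_mono k (cs_pos _ x) (cs_mono (up_ft _ _) x))
  unfold Psi
  rw [← Finset.sum_sub_distrib]
  have hpa : (0:ℝ) < a := by exact_mod_cast cs_pos ω0 u
  have hpb : (0:ℝ) < b := by exact_mod_cast cs_pos ω0 v
  have hka : (k:ℝ) ≤ a := by exact_mod_cast h1
  have hkb : (k:ℝ) ≤ b := by exact_mod_cast h2
  have hk0 : (0:ℝ) ≤ k := by positivity
  have key : ∀ x ∈ comp ω0 u ∪ comp ω0 v, 1 - (k:ℝ) / (a + b) - (if x ∈ comp ω0 u then 1 - (k:ℝ) / a else 1 - (k:ℝ) / b)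
      ≤ max (1 - (k : ℝ) / cs ω1 x) 0 - max (1 - (k : ℝ) / cs ω0 x) 0 := by
    intro x hx
    have hc : ∀ y, Rch ω1 u y → (a:ℝ) + b ≤ cs ω1 y := by
      intro y hy; rw [← cs_eq hy]; exact_mod_cast hcard
    have hc1 : ∀ y, Rch ω1 u y → 1 - (k:ℝ) / (a + b) ≤ max (1 - (k : ℝ) / cs ω1 y) 0 := by
      intro y hy
      refine le_trans ?_ (le_max_left _ _)
      have := hc y hy
      have : (k:ℝ) / cs ω1 y ≤ k / (a + b) := by gcongr
      linarith
    by_cases hxu : x ∈ comp ω0 u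
    · rw [if_pos hxu]
      have e1 : cs ω0 x = a := by rw [ha]; exact (cs_eq (mem_comp.1 hxu)).symm
      have := hc1 x (mem_comp.1 (hsub u hxu))
      rw [e1, max_eq_left (a := 1 - (k:ℝ) / a)]
      · linarith
      · rw [sub_nonneg, div_le_one hpa]; exact hka
    · rw [if_neg hxu]
      have hxv : x ∈ comp ω0 v := (Finset.mem_union.1 hx).resolve_left hxu
      have e1 : cs ω0 x = b := by rw [hb]; exact (cs_eq (mem_comp.1 hxv)).symm
      have := hc1 x (huv1.trans (mem_comp.1 (hsub v hxv)))
      rw [e1, max_eq_left (a := 1 - (k:ℝ) / b)]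
      · linarith
      · rw [sub_nonneg, div_le_one hpb]; exact hkb
  calc (k:ℝ) = ∑ x ∈ comp ω0 u ∪ comp ω0 v, (1 - (k:ℝ) / (a + b) - (if x ∈ comp ω0 u then 1 - (k:ℝ) / a else 1 - (k:ℝ) / b)) := by
        rw [Finset.sum_union hdisj]
        have s1 : ∀ x ∈ comp ω0 u, 1 - (k:ℝ) / (a + b) - (if x ∈ comp ω0 u then 1 - (k:ℝ) / a else 1 - (k:ℝ) / b)
            = 1 - (k:ℝ) / (a + b) - (1 - (k:ℝ) / a) := fun x hx => by rw [if_pos hx]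
        have s2 : ∀ x ∈ comp ω0 v, 1 - (k:ℝ) / (a + b) - (if x ∈ comp ω0 u then 1 - (k:ℝ) / a else 1 - (k:ℝ) / b)
            = 1 - (k:ℝ) / (a + b) - (1 - (k:ℝ) / b) :=
          fun x hx => by rw [if_neg (Finset.disjoint_right.1 hdisj hx)]
        rw [Finset.sum_congr rfl s1, Finset.sum_congr rfl s2]
        simp only [Finset.sum_const, nsmul_eq_mul]
        change (k:ℝ) = (a:ℝ) * (1 - (k:ℝ) / (a + b) - (1 - (k:ℝ) / a)) + (b:ℝ) * (1 - (k:ℝ) / (a + b) - (1 - (k:ℝ) / b))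
        field_simp; ring
    _ ≤ ∑ x ∈ comp ω0 u ∪ comp ω0 v, (max (1 - (k : ℝ) / cs ω1 x) 0 - max (1 - (k : ℝ) / cs ω0 x) 0) :=
        Finset.sum_le_sum key
    _ ≤ _ := Finset.sum_le_sum_of_subset_of_nonneg (Finset.subset_univ _) fun x _ _ => hf x

lemma Psi_diff (k : ℕ) (u v : V) (ω : Cfg V) :
    (k : ℝ) * bd k ω u v ≤ Psi k (up s(u, v) true ω) - Psi k (up s(u, v) false ω) := by
  have h0 := sub_nonneg.2 (Psi_mono k (up_ft s(u, v) ω))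
  unfold bd
  split_ifs with h
  · have huv : u ≠ v := fun h' => h.2.2 (h' ▸ Rch.refl _ _)
    have hω : ω s(u, v) = false := by
      by_contra h'
      exact h.2.2 (Aj.rch ⟨huv, by simpa using h'⟩)
    have := Psi_diff0 k u v ω huv (by rw [up_of_eq hω]; exact h)
    simpa using this
  · simpa using h0

/-- delete all edges at a vertex -/
def del (v : V) (ω : Cfg V) : Cfg V := kill (fun e => v ∈ e) ω

lemma del_le (v : V) (ω : Cfg V) : ∀ e, del v ω e = true → ω e = true := by
  intro e; simp only [del, kill]; split_ifs <;> simp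

lemma Aj_del {v x y : V} {ω : Cfg V} (hx : x ≠ v) (hy : y ≠ v) (h : Aj ω x y) : Aj (del v ω) x y := by
  refine ⟨h.1, ?_⟩
  simp only [del, kill, Sym2.mem_iff]
  rw [if_neg (by rintro (rfl | rfl) <;> contradiction)]; exact h.2

lemma Aj_del_ne {v x y : V} {ω : Cfg V} (h : Aj (del v ω) x y) : y ≠ v := by
  rintro rfl
  have := h.2
  simp [del, kill] at this

lemma rch_del {v x : V} {ω : Cfg V} (h : Rch ω v x) (hx : x ≠ v) :
    ∃ w, Aj ω v w ∧ Rch (del v ω) w x := by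
  have : x = v ∨ ∃ w, Aj ω v w ∧ Rch (del v ω) w x := by
    refine h.induct (P := fun x => x = v ∨ ∃ w, Aj ω v w ∧ Rch (del v ω) w x) (Or.inl rfl) ?_
    intro x z _ hP ha
    by_cases hz : z = v
    · exact Or.inl hz
    right
    by_cases hxv : x = v
    · subst hxv; exact ⟨z, ha, Rch.refl _ _⟩
    · obtain ⟨w, h1, h2⟩ := hP.resolve_left hxv
      exact ⟨w, h1, h2.trans (Aj_del hxv hz ha).rch⟩
  exact this.resolve_left hx

lemma not_rch_del {v w : V} {ω : Cfg V} (hw : w ≠ v) : ¬ Rch (del v ω) w v := by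
  intro h
  have : v ≠ v := h.induct (P := fun x => x ≠ v) hw fun x y _ _ ha => Aj_del_ne ha
  exact this rfl

open Classical in
def nb (ω : Cfg V) (v : V) : Finset V := Finset.univ.filter (Aj ω v)

lemma mem_nb {ω : Cfg V} {v w : V} : w ∈ nb ω v ↔ Aj ω v w := by simp [nb]

lemma cs_le (ω : Cfg V) (v : V) : cs ω v ≤ 1 + ∑ w ∈ nb ω v, cs (del v ω) w := by
  have : comp ω v ⊆ {v} ∪ (nb ω v).biUnion (fun w => comp (del v ω) w) := by
    intro x hx
    rw [Finset.mem_union, Finset.mem_singleton, Finset.mem_biUnion]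
    by_cases hxv : x = v
    · exact Or.inl hxv
    · obtain ⟨w, h1, h2⟩ := rch_del (mem_comp.1 hx) hxv
      exact Or.inr ⟨w, mem_nb.2 h1, mem_comp.2 h2⟩
  calc _ ≤ _ := Finset.card_le_card this
    _ ≤ _ := Finset.card_union_le _ _
    _ ≤ _ := by
      rw [Finset.card_singleton]
      exact Nat.add_le_add_left Finset.card_biUnion_le _

lemma cs_ge {k : ℕ} {ω : Cfg V} {v w : V} (ha : Aj ω v w) (h : k ≤ cs (del v ω) w) : k + 1 ≤ cs ω v := by
  have hnot : v ∉ comp (del v ω) w := fun h' => not_rch_del ha.1.symm (mem_comp.1 h')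
  have hsub : insert v (comp (del v ω) w) ⊆ comp ω v := by
    intro x hx
    rw [Finset.mem_insert] at hx
    rcases hx with rfl | hx
    · exact mem_comp.2 (Rch.refl _ _)
    · exact mem_comp.2 (ha.rch.trans ((mem_comp.1 hx).mono (del_le v ω)))
  have := Finset.card_le_card hsub
  rw [Finset.card_insert_of_notMem hnot] at this
  unfold cs at h ⊢; omega

lemma comp_del {u v : V} {ω : Cfg V} (h : ¬ Rch ω v u) : comp (del u ω) v = comp ω v := by
  refine Finset.Subset.antisymm (comp_mono (del_le u ω) v) ?_
  intro x hx
  rw [mem_comp] at hx ⊢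
  refine hx.induct (P := fun x => Rch (del u ω) v x) (Rch.refl _ _) ?_
  intro y z hy hP ha
  refine hP.trans (Aj_del ?_ ?_ ha).rch
  · rintro rfl; exact h hy
  · rintro rfl; exact h (hy.trans ha.rch)

lemma bd_tri (k : ℕ) (ω : Cfg V) (u v w : V) :
    bd k ω v w ≤ bd k ω u w + bd k ω u v + bd k (del u ω) v w := by
  by_cases h : Bd k ω v w
  · have n1 := bd_nonneg k ω u w
    have n2 := bd_nonneg k ω u v
    have n3 := bd_nonneg k (del u ω) v w
    have e : bd k ω v w = 1 := by simp [bd, h]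
    obtain ⟨h1, h2, h3⟩ := h
    by_cases hv : Rch ω v u
    · have : bd k ω u w = 1 := by
        have : Bd k ω u w := ⟨by rwa [← cs_eq hv], h2, fun h' => h3 (hv.trans h')⟩
        simp [bd, this]
      linarith
    by_cases hw : Rch ω w u
    · have : bd k ω u v = 1 := by
        have : Bd k ω u v := ⟨by rwa [← cs_eq hw], h1, fun h' => h3 (h'.symm.trans hw.symm)⟩
        simp [bd, this]
      linarith
    · have : bd k (del u ω) v w = 1 := by
        have : Bd k (del u ω) v w := by
          refine ⟨?_, ?_, fun h' => h3 (h'.mono (del_le u ω))⟩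
          · unfold cs; rw [comp_del hv]; exact h1
          · unfold cs; rw [comp_del hw]; exact h2
        simp [bd, this]
      linarith
  · have e : bd k ω v w = 0 := by simp [bd, h]
    rw [e]
    have n1 := bd_nonneg k ω u w
    have n2 := bd_nonneg k ω u v
    have n3 := bd_nonneg k (del u ω) v w
    linarith

lemma Bd_leaf {k : ℕ} {ω : Cfg V} {u v w : V} (hw : w ≠ u) (hv : Aj ω u v)
    (hN : ∀ x, Aj ω u x → x = v) (h : Bd k (del u ω) v w) : Bd k ω u w := by
  obtain ⟨h1, h2, h3⟩ := h
  refine ⟨?_, h2.trans (cs_mono (del_le u ω) w), ?_⟩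
  · rw [cs_eq hv.rch]; exact h1.trans (cs_mono (del_le u ω) v)
  · intro hr
    obtain ⟨x, hx1, hx2⟩ := rch_del hr hw
    rw [hN x hx1] at hx2
    exact h3 hx2

lemma del_up (v : V) (e : Sym2 V) (b : Bool) (ω : Cfg V) :
    del v (up e b ω) = if v ∈ e then del v ω else up e b (del v ω) := by
  ext e'
  by_cases h : e' = e
  · subst h; split_ifs with h' <;> simp [del, kill, up_self, h']
  · split_ifs with h' <;> simp [del, kill, up_ne h]

end Comb

end Percolation

namespace Percolation
set_option linter.all false

lemma abs_exp_sub_le {a b : ℝ} (ha : 0 ≤ a) (hb : 0 ≤ b) :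
    |Real.exp (-a) - Real.exp (-b)| ≤ |a - b| := by
  wlog h : a ≤ b generalizing a b
  · rw [abs_sub_comm, abs_sub_comm a]; exact this hb ha (le_of_not_ge h)
  have h1 : Real.exp (-b) ≤ Real.exp (-a) := Real.exp_le_exp.2 (by linarith)
  rw [abs_of_nonneg (by linarith), abs_of_nonpos (by linarith)]
  have h2 : Real.exp (-b) = Real.exp (-a) * Real.exp (a - b) := by rw [← Real.exp_add]; ring_nf
  have h3 := Real.add_one_le_exp (a - b)
  have h4 : Real.exp (-a) ≤ 1 := Real.exp_le_one_iff.2 (by linarith)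
  have h5 := Real.exp_pos (-a)
  nlinarith

lemma prod_exp {κ : Type*} (J : Finset κ) (x : κ → ℝ) (hx : ∀ i ∈ J, 0 ≤ x i ∧ x i ≤ 1) :
    (0 ≤ ∏ i ∈ J, (1 - x i)) ∧ (∏ i ∈ J, (1 - x i) ≤ 1) ∧
    |∏ i ∈ J, (1 - x i) - Real.exp (-∑ i ∈ J, x i)| ≤ ∑ i ∈ J, x i ^ 2 := by
  classical
  induction J using Finset.induction_on with
  | empty => simp
  | insert a A ha ih =>
    obtain ⟨i0, i1, i2⟩ := ih fun i hi => hx i (Finset.mem_insert_of_mem hi)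
    obtain ⟨a0, a1⟩ := hx a (Finset.mem_insert_self a A)
    rw [Finset.prod_insert ha, Finset.sum_insert ha, Finset.sum_insert ha]
    refine ⟨mul_nonneg (by linarith) i0, by nlinarith, ?_⟩
    rw [neg_add, Real.exp_add]
    set P := ∏ i ∈ A, (1 - x i)
    set E := Real.exp (-∑ i ∈ A, x i)
    have hE : E ≤ 1 := Real.exp_le_one_iff.2 (by
      rw [neg_nonpos]; exact Finset.sum_nonneg fun i hi => (hx i (Finset.mem_insert_of_mem hi)).1)
    have hE0 : 0 ≤ E := (Real.exp_pos _).le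
    have e1 : 1 - x a ≤ Real.exp (-x a) := by have := Real.add_one_le_exp (-x a); linarith
    have e2 : Real.exp (-x a) ≤ 1 - x a + x a ^ 2 := by
      have := Real.abs_exp_sub_one_sub_id_le (x := -x a) (by rw [abs_neg, abs_of_nonneg a0]; exact a1)
      have := (abs_le.1 this).2
      nlinarith
    have h1 : (1 - x a) * P - Real.exp (-x a) * E = (1 - x a) * (P - E) + (1 - x a - Real.exp (-x a)) * E := by ring
    rw [h1]
    refine (abs_add_le _ _).trans ?_
    rw [abs_mul, abs_mul, abs_of_nonneg (by linarith : 0 ≤ 1 - x a), abs_of_nonneg hE0, add_comm]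
    have h2 : |1 - x a - Real.exp (-x a)| ≤ x a ^ 2 := by
      rw [abs_le]; constructor <;> linarith [sq_nonneg (x a)]
    have h3 : (1 - x a) * |P - E| ≤ |P - E| := by nlinarith [abs_nonneg (P - E)]
    have h4 : |1 - x a - Real.exp (-x a)| * E ≤ x a ^ 2 := by
      nlinarith [abs_nonneg (1 - x a - Real.exp (-x a)), sq_nonneg (x a)]
    linarith

section Local
variable {V : Type*} [Fintype V] [DecidableEq V]

/-- sparse edge probabilities -/
structure Sp (C : ℝ) (p : Sym2 V → ℝ) : Prop where
  nonneg : ∀ e, 0 ≤ p e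
  le : ∀ e, p e ≤ C / Fintype.card V
  diag : ∀ v, p s(v, v) = 0
  hC : 0 ≤ C
  hCn : C ≤ Fintype.card V
  hn : 0 < Fintype.card V

lemma Sp.adm {C : ℝ} {p : Sym2 V → ℝ} (h : Sp C p) : Adm p := fun e =>
  ⟨h.nonneg e, (h.le e).trans (by
    rw [div_le_one (by exact_mod_cast h.hn)]; exact h.hCn)⟩

def rem (v : V) (p : Sym2 V → ℝ) : Sym2 V → ℝ := fun e => if v ∈ e then 0 else p e

lemma rem_le {C : ℝ} {p : Sym2 V → ℝ} (h : Sp C p) (v : V) (e : Sym2 V) : rem v p e ≤ p e := by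
  unfold rem; split_ifs; exacts [h.nonneg e, le_rfl]

lemma Sp.rem {C : ℝ} {p : Sym2 V → ℝ} (h : Sp C p) (v : V) : Sp C (rem v p) := by
  refine ⟨fun e => ?_, fun e => (rem_le h v e).trans (h.le e), fun w => ?_, h.hC, h.hCn, h.hn⟩
  · unfold Percolation.rem; split_ifs; exacts [le_rfl, h.nonneg e]
  · unfold Percolation.rem; split_ifs; exacts [rfl, h.diag w]

lemma Sp.sum_le {C : ℝ} {p : Sym2 V → ℝ} (h : Sp C p) : ∑ e, p e ≤ C * Fintype.card V := by
  have hn : (0:ℝ) < Fintype.card V := by exact_mod_cast h.hn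
  have hc : (Fintype.card (Sym2 V) : ℝ) ≤ (Fintype.card V : ℝ) * Fintype.card V := by
    have := Fintype.card_le_of_surjective (fun q : V × V => s(q.1, q.2))
      (fun e => by induction e using Sym2.ind with | _ a b => exact ⟨(a, b), rfl⟩)
    rw [Fintype.card_prod] at this
    exact_mod_cast this
  calc ∑ e, p e ≤ ∑ _e : Sym2 V, C / Fintype.card V := Finset.sum_le_sum fun e _ => h.le e
    _ = Fintype.card (Sym2 V) * (C / Fintype.card V) := by simp
    _ ≤ ((Fintype.card V : ℝ) * Fintype.card V) * (C / Fintype.card V) :=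
        mul_le_mul_of_nonneg_right hc (div_nonneg h.hC hn.le)
    _ = _ := by field_simp

lemma Sp.row_le {C : ℝ} {p : Sym2 V → ℝ} (h : Sp C p) (v : V) : ∑ w, p s(v, w) ≤ C := by
  have hn : (0:ℝ) < Fintype.card V := by exact_mod_cast h.hn
  calc ∑ w, p s(v, w) ≤ ∑ _w : V, C / Fintype.card V := Finset.sum_le_sum fun e _ => h.le _
    _ = C := by simp; field_simp

def th (k : ℕ) (p : Sym2 V → ℝ) (v : V) : ℝ := Ex p (fun ω => L k ω v)

lemma th_nonneg {C : ℝ} {p : Sym2 V → ℝ} (h : Sp C p) (k : ℕ) (v : V) : 0 ≤ th k p v :=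
  Ex_nonneg h.adm fun _ => L_nonneg _ _ _

lemma th_le_one {C : ℝ} {p : Sym2 V → ℝ} (h : Sp C p) (k : ℕ) (v : V) : th k p v ≤ 1 := by
  have := Ex_mono h.adm (fun ω => L_le_one k ω v)
  rwa [Ex_const] at this

lemma th_rem (k : ℕ) (p : Sym2 V → ℝ) (v w : V) :
    th k (rem v p) w = Ex p (fun ω => L k (del v ω) w) :=
  (Ex_kill p (fun e => v ∈ e) (fun ω => L k ω w)).symm

/-- probability generating step -/
def Fp (p : Sym2 V → ℝ) (f : V → ℝ) (v : V) : ℝ := 1 - Real.exp (-∑ w, p s(v, w) * f w)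

def Qp (k : ℕ) (ω : Cfg V) (v : V) : ℝ :=
  ∏ w ∈ Finset.univ.erase v, (1 - (if ω s(v, w) then 1 else 0) * L k (del v ω) w)

lemma Qp_term (k : ℕ) (ω : Cfg V) (v w : V) :
    0 ≤ 1 - (if ω s(v, w) then (1:ℝ) else 0) * L k (del v ω) w ∧
    1 - (if ω s(v, w) then (1:ℝ) else 0) * L k (del v ω) w ≤ 1 := by
  have h1 := L_nonneg k (del v ω) w
  have h2 := L_le_one k (del v ω) w
  split_ifs <;> constructor <;> linarith

lemma Qp_nonneg (k : ℕ) (ω : Cfg V) (v : V) : 0 ≤ Qp k ω v :=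
  Finset.prod_nonneg fun w _ => (Qp_term k ω v w).1

lemma Qp_le_one (k : ℕ) (ω : Cfg V) (v : V) : Qp k ω v ≤ 1 :=
  Finset.prod_le_one (fun w _ => (Qp_term k ω v w).1) fun w _ => (Qp_term k ω v w).2

lemma Qp_lower (k : ℕ) (ω : Cfg V) (v : V) : 1 - Qp k ω v ≤ L (k + 1) ω v := by
  by_cases h : k + 1 ≤ cs ω v
  · have := Qp_nonneg k ω v
    simp only [L, h, if_true]; linarith
  · have : Qp k ω v = 1 := by
      refine Finset.prod_eq_one fun w hw => ?_
      have hne : w ≠ v := Finset.ne_of_mem_erase hw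
      by_cases hω : ω s(v, w) = true
      · have : ¬ k ≤ cs (del v ω) w := fun h' => h (cs_ge ⟨hne.symm, hω⟩ h')
        simp [L, this]
      · simp [hω]
    rw [this]; simpa using L_nonneg (k+1) ω v

def deg (ω : Cfg V) (v : V) : ℝ := ∑ w, if v ≠ w ∧ ω s(v, w) = true then 1 else 0

lemma deg_eq (ω : Cfg V) (v : V) : deg ω v = (nb ω v).card := by
  classical
  unfold deg nb
  rw [Finset.sum_ite]
  simp only [Finset.sum_const, nsmul_eq_mul, mul_one, mul_zero, add_zero]
  congr 2; ext x; simp [Aj]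

lemma Qp_upper (k K : ℕ) (hK : 2 ≤ K) (ω : Cfg V) (v : V) :
    L K ω v ≤ (1 - Qp k ω v) + k / (K - 1) * deg ω v := by
  have hK1 : (0:ℝ) < (K:ℝ) - 1 := by
    have : (2:ℝ) ≤ K := by exact_mod_cast hK
    linarith
  have hd0 : 0 ≤ deg ω v := by rw [deg_eq]; positivity
  have hr : 0 ≤ (k:ℝ) / (K - 1) * deg ω v := by positivity
  by_cases h : ∃ w, Aj ω v w ∧ k ≤ cs (del v ω) w
  · obtain ⟨w, hw, hk⟩ := h
    have : Qp k ω v = 0 := by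
      refine Finset.prod_eq_zero (i := w) (Finset.mem_erase.2 ⟨hw.1.symm, Finset.mem_univ _⟩) ?_
      simp [hw.2, L, hk]
    rw [this]; linarith [L_le_one K ω v]
  · push Not at h
    have hQ := Qp_le_one k ω v
    by_cases hL : K ≤ cs ω v
    · have h1 : cs ω v ≤ 1 + (nb ω v).card * k := by
        refine (cs_le ω v).trans (Nat.add_le_add_left ?_ 1)
        rw [← smul_eq_mul]
        exact Finset.sum_le_card_nsmul _ _ _ fun w hw => (h w (mem_nb.1 hw)).le
      have h2 : (K:ℝ) ≤ 1 + deg ω v * k := by rw [deg_eq]; exact_mod_cast hL.trans h1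
      have h3 : 1 ≤ (k:ℝ) / (K - 1) * deg ω v := by
        rw [div_mul_eq_mul_div, le_div_iff₀ hK1]; linarith
      linarith [L_le_one K ω v]
    · have : L K ω v = 0 := by simp [L, hL]
      rw [this]; linarith

lemma Ex_coord (p : Sym2 V → ℝ) (e : Sym2 V) : Ex p (fun ω => if ω e = true then 1 else 0) = p e := by
  rw [Ex_split p e]; simp [up_self, Ex_const]

lemma Ex_deg {C : ℝ} {p : Sym2 V → ℝ} (h : Sp C p) (v : V) : Ex p (fun ω => deg ω v) ≤ C := by
  unfold deg
  rw [Ex_sum]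
  refine (Finset.sum_le_sum fun w _ => ?_).trans (h.row_le v)
  rw [← Ex_coord p]
  refine Ex_mono h.adm fun ω => ?_
  split_ifs <;> simp_all

def dl (C : ℝ) (k : ℕ) (n : ℝ) : ℝ := C ^ 2 / n + Real.sqrt (4 * k ^ 2 * C ^ 3 / n)

lemma one_step {C : ℝ} {p : Sym2 V → ℝ} (h : Sp C p) (k : ℕ) (v : V) :
    |Ex p (fun ω => 1 - Qp k ω v) - Fp p (th k (rem v p)) v| ≤ dl C k (Fintype.card V) := by
  have hn : (0:ℝ) < Fintype.card V := by exact_mod_cast h.hn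
  set n : ℝ := (Fintype.card V : ℝ)
  set Λ : Cfg V → ℝ := fun ω => ∑ w, p s(v, w) * L k (del v ω) w with hΛ
  have hpl : ∀ e, p e ≤ 1 := fun e => (h.adm e).2
  have hΛ0 : ∀ ω, 0 ≤ Λ ω := fun ω =>
    Finset.sum_nonneg fun w _ => mul_nonneg (h.nonneg _) (L_nonneg _ _ _)
  have hΛe : ∀ ω, Λ ω = ∑ w ∈ Finset.univ.erase v, p s(v, w) * L k (del v ω) w := by
    intro ω
    simp only [hΛ]
    rw [← Finset.add_sum_erase _ _ (Finset.mem_univ v), h.diag]; simp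
  have hEΛ : Ex p Λ = ∑ w, p s(v, w) * th k (rem v p) w := by
    rw [hΛ, Ex_sum]
    refine Finset.sum_congr rfl fun w _ => ?_
    rw [Ex_mul, th_rem]
  have hdel : ∀ w b ω, del v (up s(v, w) b ω) = del v ω := by
    intro w b ω; rw [del_up, if_pos (by simp)]
  have hQ : Ex p (fun ω => Qp k ω v)
      = Ex p (fun ω => ∏ w ∈ Finset.univ.erase v, (1 - p s(v, w) * L k (del v ω) w)) := by
    have := Ex_prod_indep p (Finset.univ.erase v) (fun w => s(v, w))
      (by
        intro a _ b _ hab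
        rcases Sym2.eq_iff.1 hab with h | h
        · exact h.2
        · exact h.2.trans h.1)
      (fun w ω => L k (del v ω) w) (fun _ => 1)
      (by intro i _ j b ω _; simp only [hdel]) (by simp)
    simpa [Qp] using this
  have h1 : |Ex p (fun ω => Qp k ω v) - Ex p (fun ω => Real.exp (-Λ ω))| ≤ C ^ 2 / n := by
    rw [hQ, ← Ex_sub]
    refine (Ex_abs_le h.adm _).trans ?_
    rw [← Ex_const p (C ^ 2 / n)]
    refine Ex_mono h.adm fun ω => ?_
    rw [hΛe]
    have := (prod_exp (Finset.univ.erase v) (fun w => p s(v, w) * L k (del v ω) w) (fun w _ =>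
      ⟨mul_nonneg (h.nonneg _) (L_nonneg _ _ _),
        mul_le_one₀ (hpl _) (L_nonneg _ _ _) (L_le_one _ _ _)⟩)).2.2
    refine this.trans ?_
    calc ∑ w ∈ Finset.univ.erase v, (p s(v, w) * L k (del v ω) w) ^ 2
        ≤ ∑ w ∈ Finset.univ.erase v, (C / n) ^ 2 := by
          refine Finset.sum_le_sum fun w _ => ?_
          refine pow_le_pow_left₀ (mul_nonneg (h.nonneg _) (L_nonneg _ _ _)) ?_ 2
          calc _ ≤ p s(v, w) * 1 := mul_le_mul_of_nonneg_left (L_le_one _ _ _) (h.nonneg _)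
            _ ≤ _ := by rw [mul_one]; exact h.le _
      _ ≤ ∑ w : V, (C / n) ^ 2 :=
          Finset.sum_le_sum_of_subset_of_nonneg (Finset.subset_univ _) fun _ _ _ => sq_nonneg _
      _ = C ^ 2 / n := by simp [n]; field_simp
  have h2 : |Ex p (fun ω => Real.exp (-Λ ω)) - Real.exp (-Ex p Λ)|
      ≤ Real.sqrt (4 * k ^ 2 * C ^ 3 / n) := by
    have e1 : |Ex p (fun ω => Real.exp (-Λ ω)) - Real.exp (-Ex p Λ)|
        ≤ Ex p (fun ω => |Λ ω - Ex p Λ|) := by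
      rw [← Ex_const p (Real.exp (-Ex p Λ)), ← Ex_sub]
      refine (Ex_abs_le h.adm _).trans (Ex_mono h.adm fun ω => ?_)
      exact abs_exp_sub_le (hΛ0 ω) (Ex_nonneg h.adm hΛ0)
    refine e1.trans (Real.le_sqrt_of_sq_le ?_)
    refine (Ex_sq_le h.adm _).trans ?_
    simp only [sq_abs]
    refine (var_le h.adm (2 * k * (C / n)) Λ ?_).trans ?_
    · intro e ω
      have hK0 : 0 ≤ 2 * k * (C / n) := by
        have := h.hC; positivity
      simp only [hΛ, del_up]
      by_cases he : v ∈ e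
      · simpa [he] using hK0
      · simp only [he, if_false]
        have := sumL_diff k (fun w => p s(v, w)) (C / n) (fun w => ⟨h.nonneg _, h.le _⟩) e (del v ω)
        rw [abs_of_nonneg this.1]; exact this.2
    · calc (2 * k * (C / n)) ^ 2 * ∑ e, p e ≤ (2 * k * (C / n)) ^ 2 * (C * n) :=
            mul_le_mul_of_nonneg_left h.sum_le (sq_nonneg _)
        _ = _ := by field_simp; ring
  rw [Ex_sub, Ex_const]
  unfold Fp dl
  rw [← hEΛ]
  have : 1 - Ex p (fun ω => Qp k ω v) - (1 - Real.exp (-Ex p Λ))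
      = -((Ex p (fun ω => Qp k ω v) - Ex p (fun ω => Real.exp (-Λ ω)))
        + (Ex p (fun ω => Real.exp (-Λ ω)) - Real.exp (-Ex p Λ))) := by ring
  rw [this, abs_neg]
  exact (abs_add_le _ _).trans (add_le_add h1 h2)

def Fi (p : Sym2 V → ℝ) : ℕ → V → ℝ
  | 0 => fun _ => 1
  | r + 1 => Fp p (Fi p r)

lemma Fp_mem {C : ℝ} {p : Sym2 V → ℝ} (h : Sp C p) {f : V → ℝ} (hf : ∀ v, 0 ≤ f v) (v : V) :
    0 ≤ Fp p f v ∧ Fp p f v ≤ 1 := by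
  have h0 : 0 ≤ ∑ w, p s(v, w) * f w := Finset.sum_nonneg fun w _ => mul_nonneg (h.nonneg _) (hf w)
  unfold Fp
  have h1 : Real.exp (-∑ w, p s(v, w) * f w) ≤ 1 := Real.exp_le_one_iff.2 (by linarith)
  have := Real.exp_pos (-∑ w, p s(v, w) * f w)
  constructor <;> linarith

lemma Fi_mem {C : ℝ} {p : Sym2 V → ℝ} (h : Sp C p) (r : ℕ) : ∀ v, 0 ≤ Fi p r v ∧ Fi p r v ≤ 1 := by
  induction r with
  | zero => intro v; simp [Fi]
  | succ r ih => exact fun v => Fp_mem h (fun v => (ih v).1) v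

/-- comparing two exponential steps -/
lemma Fp_le_add {C : ℝ} {p q : Sym2 V → ℝ} (hp : Sp C p) (hq : Sp C q) {f g : V → ℝ} (hf : ∀ v, 0 ≤ f v)
    (hg : ∀ v, 0 ≤ g v) {d : ℝ} (hd : 0 ≤ d) (v : V)
    (hfg : ∑ w, p s(v, w) * f w ≤ ∑ w, q s(v, w) * g w + d) : Fp p f v ≤ Fp q g v + d := by
  unfold Fp
  set a := ∑ w, p s(v, w) * f w
  set b := ∑ w, q s(v, w) * g w
  have ha : 0 ≤ a := Finset.sum_nonneg fun w _ => mul_nonneg (hp.nonneg _) (hf w)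
  have hb : 0 ≤ b := Finset.sum_nonneg fun w _ => mul_nonneg (hq.nonneg _) (hg w)
  rcases le_total a b with h | h
  · have : Real.exp (-b) ≤ Real.exp (-a) := Real.exp_le_exp.2 (by linarith)
    linarith
  · have := (abs_le.1 (abs_exp_sub_le hb ha)).2
    rw [abs_of_nonpos (by linarith : b - a ≤ 0)] at this
    linarith

lemma sum_le_of {C : ℝ} {p : Sym2 V → ℝ} (hp : Sp C p) {f g : V → ℝ} {d : ℝ} (hd : 0 ≤ d) (v : V)
    (hfg : ∀ w, w ≠ v → f w ≤ g w + d) :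
    ∑ w, p s(v, w) * f w ≤ ∑ w, p s(v, w) * g w + C * d := by
  calc _ ≤ ∑ w, (p s(v, w) * g w + p s(v, w) * d) := by
        refine Finset.sum_le_sum fun w _ => ?_
        by_cases hw : w = v
        · subst hw; simp [hp.diag]
        · rw [← mul_add]; exact mul_le_mul_of_nonneg_left (hfg w hw) (hp.nonneg _)
    _ = ∑ w, p s(v, w) * g w + (∑ w, p s(v, w)) * d := by
        rw [Finset.sum_add_distrib, Finset.sum_mul]
    _ ≤ _ := by
        have := mul_le_mul_of_nonneg_right (hp.row_le v) hd
        linarith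

lemma Fi_rem_le {C : ℝ} {p : Sym2 V → ℝ} (h : Sp C p) (v : V) (r : ℕ) :
    ∀ w, Fi (rem v p) r w ≤ Fi p r w := by
  induction r with
  | zero => intro w; simp [Fi]
  | succ r ih =>
    intro w
    have := Fp_le_add (h.rem v) h (fun x => (Fi_mem (h.rem v) r x).1) (fun x => (Fi_mem h r x).1) le_rfl w
      (by
        rw [add_zero]
        exact Finset.sum_le_sum fun x _ => mul_le_mul (rem_le h v _) (ih x)
          (Fi_mem (h.rem v) r x).1 (h.nonneg _))
    rw [add_zero] at this
    exact this

def Dr (C : ℝ) : ℕ → ℝ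
  | 0 => 0
  | r + 1 => C + C * Dr C r

lemma Dr_nonneg {C : ℝ} (hC : 0 ≤ C) (r : ℕ) : 0 ≤ Dr C r := by
  induction r with
  | zero => simp [Dr]
  | succ r ih => unfold Dr; positivity

lemma Fi_rem_ge {C : ℝ} {p : Sym2 V → ℝ} (h : Sp C p) (v : V) (r : ℕ) :
    ∀ w, w ≠ v → Fi p r w ≤ Fi (rem v p) r w + Dr C r / Fintype.card V := by
  have hn : (0:ℝ) < Fintype.card V := by exact_mod_cast h.hn
  induction r with
  | zero => intro w hw; simp [Fi, Dr]
  | succ r ih =>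
    intro w hw
    have hD := Dr_nonneg h.hC r
    have hC := h.hC
    refine Fp_le_add h (h.rem v) (fun x => (Fi_mem h r x).1) (fun x => (Fi_mem (h.rem v) r x).1)
      (div_nonneg (Dr_nonneg h.hC _) hn.le) w ?_
    have e1 : ∀ x, p s(w, x) * Fi p r x ≤ rem v p s(w, x) * Fi (rem v p) r x
        + (p s(w, x) * (Dr C r / Fintype.card V) + if x = v then C / Fintype.card V else 0) := by
      intro x
      by_cases hx : x = v
      · subst hx
        have h1 := Fi_mem h r x
        have h2 := (Fi_mem (h.rem x) r x).1
        have h3 := (h.rem x).nonneg s(w, x)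
        have h4 := h.nonneg s(w, x)
        have h5 := h.le s(w, x)
        have h6 : 0 ≤ p s(w, x) * (Dr C r / Fintype.card V) := by positivity
        rw [if_pos rfl]
        nlinarith [mul_nonneg h3 h2]
      · have : rem v p s(w, x) = p s(w, x) := by
          unfold rem; rw [if_neg]; rw [Sym2.mem_iff]; rintro (h | h)
          · exact hw h.symm
          · exact hx h.symm
        rw [this, if_neg hx, add_zero, ← mul_add]
        exact mul_le_mul_of_nonneg_left (ih x hx) (h.nonneg _)
    refine (Finset.sum_le_sum fun x _ => e1 x).trans ?_
    rw [Finset.sum_add_distrib, Finset.sum_add_distrib, ← Finset.sum_mul, Finset.sum_ite_eq']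
    simp only [Finset.mem_univ, if_true]
    have := mul_le_mul_of_nonneg_right (h.row_le w) (div_nonneg hD hn.le)
    have e2 : Dr C (r + 1) / (Fintype.card V : ℝ) = C / Fintype.card V + C * (Dr C r / Fintype.card V) := by
      simp only [Dr]; ring
    rw [e2]; linarith

lemma dl_nonneg {C : ℝ} (k : ℕ) {n : ℝ} (hn : 0 ≤ n) : 0 ≤ dl C k n := by
  unfold dl; positivity

def eL (C : ℝ) (n : ℝ) : ℕ → ℝ
  | 0 => 0
  | r + 1 => dl C (r + 1) n + C * (eL C n r + Dr C r / n)

lemma eL_nonneg {C n : ℝ} (hC : 0 ≤ C) (hn : 0 ≤ n) (r : ℕ) : 0 ≤ eL C n r := by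
  induction r with
  | zero => simp [eL]
  | succ r ih =>
    unfold eL
    have := Dr_nonneg hC r
    have := dl_nonneg (C := C) (r + 1) hn
    positivity

lemma th_lower (C : ℝ) (r : ℕ) : ∀ {p : Sym2 V → ℝ} (h : Sp C p) (v : V),
    Fi p r v ≤ th (r + 1) p v + eL C (Fintype.card V) r := by
  induction r with
  | zero =>
    intro p h v
    have : th 1 p v = 1 := by
      unfold th
      have : ∀ ω : Cfg V, L 1 ω v = 1 := fun ω => by simp [L, cs_pos]
      simp [this, Ex_const]
    simp [Fi, this, eL]
  | succ r ih =>
    intro p h v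
    have hn : (0:ℝ) < Fintype.card V := by exact_mod_cast h.hn
    have h1 := (abs_le.1 (one_step h (r + 1) v)).1
    have h2 : Ex p (fun ω => 1 - Qp (r + 1) ω v) ≤ th (r + 1 + 1) p v :=
      Ex_mono h.adm fun ω => Qp_lower (r + 1) ω v
    have hd : 0 ≤ eL C (Fintype.card V) r + Dr C r / Fintype.card V :=
      add_nonneg (eL_nonneg h.hC hn.le r) (div_nonneg (Dr_nonneg h.hC r) hn.le)
    have h3 := Fp_le_add h h (fun x => (Fi_mem h r x).1) (fun x => th_nonneg (h.rem v) (r + 1) x)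
      (mul_nonneg h.hC hd) v
      (sum_le_of h hd v fun w hw => by
        have := ih (h.rem v) w
        have := Fi_rem_ge h v r w hw
        linarith)
    simp only [eL]
    change Fp p (Fi p r) v ≤ _
    linarith

def kk (s : ℕ) : ℕ → ℕ
  | 0 => 1
  | r + 1 => s * kk s r + 1

lemma kk_pos (s r : ℕ) : 1 ≤ kk s r := by cases r <;> simp [kk]

def eU (C : ℝ) (s : ℕ) (n : ℝ) : ℕ → ℝ
  | 0 => 0
  | r + 1 => dl C (kk s r) n + C / s + C * eU C s n r

lemma eU_nonneg {C n : ℝ} (s : ℕ) (hC : 0 ≤ C) (hn : 0 ≤ n) (r : ℕ) : 0 ≤ eU C s n r := by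
  induction r with
  | zero => simp [eU]
  | succ r ih =>
    unfold eU
    have := dl_nonneg (C := C) (kk s r) hn
    positivity

lemma th_upper (C : ℝ) (s : ℕ) (hs : 1 ≤ s) (r : ℕ) : ∀ {p : Sym2 V → ℝ} (h : Sp C p) (v : V),
    th (kk s r) p v ≤ Fi p r v + eU C s (Fintype.card V) r := by
  induction r with
  | zero => intro p h v; simpa [Fi, eU] using th_le_one h _ v
  | succ r ih =>
    intro p h v
    have hn : (0:ℝ) < Fintype.card V := by exact_mod_cast h.hn
    have h1 := (abs_le.1 (one_step h (kk s r) v)).2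
    have hk := kk_pos s r
    have h2 : th (kk s (r + 1)) p v ≤ Ex p (fun ω => 1 - Qp (kk s r) ω v) + C / s := by
      have hK : 2 ≤ kk s (r + 1) := by
        simp only [kk]; have := Nat.mul_le_mul hs hk; omega
      have := Ex_mono h.adm (fun ω => Qp_upper (kk s r) (kk s (r + 1)) hK ω v)
      rw [Ex_add, Ex_mul] at this
      refine this.trans (add_le_add le_rfl ?_)
      have hs0 : (0:ℝ) < s := by exact_mod_cast hs
      have hk0 : (0:ℝ) < kk s r := by exact_mod_cast hk
      have e : (kk s r : ℝ) / ((kk s (r + 1) : ℕ) - 1) = 1 / s := by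
        simp only [kk]; push_cast; field_simp; ring
      rw [e]
      have := Ex_deg h v
      calc 1 / (s:ℝ) * Ex p (fun ω => deg ω v) ≤ 1 / s * C :=
            mul_le_mul_of_nonneg_left this (by positivity)
        _ = C / s := by ring
    have hd := eU_nonneg s h.hC hn.le r
    have h3 := Fp_le_add h h (fun x => th_nonneg (h.rem v) (kk s r) x) (fun x => (Fi_mem h r x).1)
      (mul_nonneg h.hC hd) v
      (sum_le_of h hd v fun w hw => by
        have := ih (h.rem v) w
        have := Fi_rem_le h v r w
        linarith)
    simp only [eU]
    change _ ≤ Fp p (Fi p r) v + _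
    linarith

lemma th_anti {C : ℝ} {p : Sym2 V → ℝ} (h : Sp C p) {k K : ℕ} (hk : k ≤ K) (v : V) :
    th K p v ≤ th k p v := Ex_mono h.adm fun ω => by
  unfold L; split_ifs <;> first | omega | norm_num

end Local

lemma dl_tendsto (C : ℝ) (k : ℕ) : Tendsto (dl C k) atTop (𝓝 0) := by
  have h1 : Tendsto (fun n : ℝ => C ^ 2 / n) atTop (𝓝 0) := tendsto_const_nhds.div_atTop tendsto_id
  have h2 : Tendsto (fun n : ℝ => 4 * k ^ 2 * C ^ 3 / n) atTop (𝓝 0) :=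
    tendsto_const_nhds.div_atTop tendsto_id
  have h3 := (Real.continuous_sqrt.tendsto 0).comp h2
  rw [Real.sqrt_zero] at h3
  have := h1.add h3
  rw [add_zero] at this
  exact this

lemma eL_tendsto (C : ℝ) (r : ℕ) : Tendsto (fun n => eL C n r) atTop (𝓝 0) := by
  induction r with
  | zero => simp [eL]
  | succ r ih =>
    have h2 : Tendsto (fun n : ℝ => Dr C r / n) atTop (𝓝 0) := tendsto_const_nhds.div_atTop tendsto_id
    simpa [eL] using (dl_tendsto C (r + 1)).add ((ih.add h2).const_mul C)

def eUl (C : ℝ) (s : ℕ) : ℕ → ℝ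
  | 0 => 0
  | r + 1 => C / s + C * eUl C s r

lemma eU_tendsto (C : ℝ) (s r : ℕ) : Tendsto (fun n => eU C s n r) atTop (𝓝 (eUl C s r)) := by
  induction r with
  | zero => simp [eU, eUl]
  | succ r ih =>
    simpa [eU, eUl] using ((dl_tendsto C (kk s r)).add_const (C / s)).add (ih.const_mul C)

lemma eUl_tendsto (C : ℝ) (r : ℕ) : Tendsto (fun s : ℕ => eUl C s r) atTop (𝓝 0) := by
  induction r with
  | zero => simp [eUl]
  | succ r ih =>
    have h2 : Tendsto (fun s : ℕ => C / (s:ℝ)) atTop (𝓝 0) := tendsto_const_div_atTop_nhds_zero_nat C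
    simpa [eUl] using h2.add (ih.const_mul C)

end Percolation

namespace Percolation
set_option linter.all false

/-- a probability space with a bounded symmetric kernel -/
structure KSp (M : ℝ) where
  Ω : Type
  ms : MeasurableSpace Ω
  μ : @Measure Ω ms
  prob : @IsProbabilityMeasure Ω ms μ
  K : Ω → Ω → ℝ
  meas : Measurable (Function.uncurry K)
  symm : ∀ x y, K x y = K y x
  nonneg : ∀ x y, 0 ≤ K x y
  le : ∀ x y, K x y ≤ M

attribute [instance] KSp.ms KSp.prob

abbrev Obs (M : ℝ) := ∀ X : KSp M, X.Ω → X.Ω → ℝ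

section Ev
variable {Ω I J : Type*}

def ev (K : Ω → Ω → ℝ) (a : I → Ω) (E : Finset (Sym2 I)) : ℝ :=
  ∏ e ∈ E, sym2Val (fun i j => K (a i) (a j)) e

lemma sym2Val_mk (f : I → I → ℝ) (i j : I) : sym2Val f s(i, j) = (f i j + f j i) / 2 := rfl

lemma sym2Val_map (f : J → J → ℝ) (g : I → J) (e : Sym2 I) :
    sym2Val f (Sym2.map g e) = sym2Val (fun i j => f (g i) (g j)) e := by
  induction e using Sym2.ind with | _ a b => rfl

lemma ev_map (K : Ω → Ω → ℝ) (a : J → Ω) (E : Finset (Sym2 I)) (j : I ↪ J) :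
    ev K a (E.map j.sym2Map) = ev K (fun i => a (j i)) E := by
  unfold ev
  rw [Finset.prod_map]
  refine Finset.prod_congr rfl fun e _ => ?_
  exact sym2Val_map _ _ _

lemma sym2Val_bd {M : ℝ} (X : KSp M) (a : I → X.Ω) (e : Sym2 I) :
    0 ≤ sym2Val (fun i j => X.K (a i) (a j)) e ∧ sym2Val (fun i j => X.K (a i) (a j)) e ≤ M := by
  induction e using Sym2.ind with
  | _ i j =>
    rw [sym2Val_mk]
    have h1 := X.nonneg (a i) (a j)
    have h2 := X.nonneg (a j) (a i)
    have h3 := X.le (a i) (a j)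
    have h4 := X.le (a j) (a i)
    constructor <;> linarith

lemma ev_bd {M : ℝ} (X : KSp M) (a : I → X.Ω) (E : Finset (Sym2 I)) :
    0 ≤ ev X.K a E ∧ ev X.K a E ≤ M ^ E.card := by
  unfold ev
  refine ⟨Finset.prod_nonneg fun e _ => (sym2Val_bd X a e).1, ?_⟩
  rw [← Finset.prod_const]
  exact Finset.prod_le_prod (fun e _ => (sym2Val_bd X a e).1) (fun e _ => (sym2Val_bd X a e).2)

lemma ev_meas {M : ℝ} (X : KSp M) (E : Finset (Sym2 I)) :
    Measurable (fun a : I → X.Ω => ev X.K a E) := by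
  unfold ev
  refine Finset.measurable_prod _ fun e _ => ?_
  induction e using Sym2.ind with
  | _ i j =>
    simp only [sym2Val_mk]
    have h : ∀ i j : I, Measurable fun a : I → X.Ω => X.K (a i) (a j) := fun i j =>
      Measurable.comp (g := Function.uncurry X.K) (f := fun a : I → X.Ω => (a i, a j)) X.meas
        ((measurable_pi_apply i).prodMk (measurable_pi_apply j))
    exact ((h i j).add (h j i)).div_const 2

end Ev

def asg {Ω V : Type*} (x y : Ω) (z : V → Ω) : Fin 2 ⊕ V → Ω := Sum.elim ![x, y] z

def rg {M : ℝ} (V : Type) [Fintype V] (E : Finset (Sym2 (Fin 2 ⊕ V))) : Obs M := fun X x y =>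
  ∫ z : V → X.Ω, ev X.K (asg x y z) E ∂(Measure.pi fun _ => X.μ)

def app {M : ℝ} (H : Obs M) : Obs M := fun X x y => ∫ u, X.K x u * H X u y ∂X.μ

def II {M : ℝ} (H : Obs M) (X : KSp M) : ℝ := ∫ q, H X q.1 q.2 ∂(X.μ.prod X.μ)

lemma asg_meas {Ω V : Type*} [MeasurableSpace Ω] :
    Measurable (fun q : (Ω × Ω) × (V → Ω) => asg q.1.1 q.1.2 q.2) := by
  rw [measurable_pi_iff]
  rintro (i | v)
  · fin_cases i
    · exact measurable_fst.comp measurable_fst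
    · exact measurable_snd.comp measurable_fst
  · exact (measurable_pi_apply v).comp measurable_snd

section RG
variable {M : ℝ}

lemma rg_meas (V : Type) [Fintype V] (E : Finset (Sym2 (Fin 2 ⊕ V))) (X : KSp M) :
    Measurable (Function.uncurry (rg V E X)) := by
  have h : Measurable (fun q : (X.Ω × X.Ω) × (V → X.Ω) => ev X.K (asg q.1.1 q.1.2 q.2) E) :=
    (ev_meas X E).comp asg_meas
  exact (h.stronglyMeasurable.integral_prod_right' (ν := Measure.pi fun _ => X.μ)).measurable

lemma rg_bd (V : Type) [Fintype V] (E : Finset (Sym2 (Fin 2 ⊕ V))) (X : KSp M) (x y : X.Ω) :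
    |rg V E X x y| ≤ M ^ E.card := by
  have := norm_integral_le_of_norm_le_const (μ := Measure.pi fun _ : V => X.μ)
    (f := fun z => ev X.K (asg x y z) E) (C := M ^ E.card)
    (Eventually.of_forall fun z => by
      have := ev_bd X (asg x y z) E
      rw [Real.norm_of_nonneg this.1]; exact this.2)
  simpa [rg] using this

/-- edge sets without loops -/
def OK' {V : Type} (E : Finset (Sym2 (Fin 2 ⊕ V))) : Prop := ∀ e ∈ E, ¬ e.IsDiag
/-- moreover without an edge between the roots -/
def OK {V : Type} (E : Finset (Sym2 (Fin 2 ⊕ V))) : Prop :=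
  ∀ e ∈ E, ¬ e.IsDiag ∧ ∃ v : V, Sum.inr v ∈ e

def RG' (M : ℝ) : Set (Obs M) := {H | ∃ (V : Type) (_ : Fintype V) (E : Finset (Sym2 (Fin 2 ⊕ V))),
  OK' E ∧ H = rg V E}
def RG (M : ℝ) : Set (Obs M) := {H | ∃ (V : Type) (_ : Fintype V) (E : Finset (Sym2 (Fin 2 ⊕ V))),
  OK E ∧ H = rg V E}

lemma RG_sub : RG M ⊆ RG' M := by
  rintro H ⟨V, _, E, h, rfl⟩
  exact ⟨V, _, E, fun e he => (h e he).1, rfl⟩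

lemma one_RG : (1 : Obs M) ∈ RG M := by
  refine ⟨Empty, inferInstance, ∅, fun e he => by simp at he, ?_⟩
  funext X x y
  simp [rg, ev]

lemma K_RG' : (fun X x y => X.K x y : Obs M) ∈ RG' M := by
  refine ⟨Empty, inferInstance, {s(Sum.inl 0, Sum.inl 1)}, fun e he => ?_, ?_⟩
  · rw [Finset.mem_singleton] at he; subst he; simp
  · funext X x y
    simp [rg, ev, sym2Val_mk, asg, X.symm y x]

lemma mul_RG {H₁ H₂ : Obs M} (h₁ : H₁ ∈ RG M) (h₂ : H₂ ∈ RG M) : H₁ * H₂ ∈ RG M := by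
  classical
  obtain ⟨V, _, E, hE, rfl⟩ := h₁
  obtain ⟨V', _, E', hE', rfl⟩ := h₂
  let j : Fin 2 ⊕ V ↪ Fin 2 ⊕ (V ⊕ V') := ⟨Sum.map id Sum.inl,
    Sum.map_injective.2 ⟨Function.injective_id, Sum.inl_injective⟩⟩
  let j' : Fin 2 ⊕ V' ↪ Fin 2 ⊕ (V ⊕ V') := ⟨Sum.map id Sum.inr,
    Sum.map_injective.2 ⟨Function.injective_id, Sum.inr_injective⟩⟩
  have hdisj : Disjoint (E.map j.sym2Map) (E'.map j'.sym2Map) := by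
    rw [Finset.disjoint_left]
    intro e he he'
    rw [Finset.mem_map] at he he'
    obtain ⟨a, ha, rfl⟩ := he
    obtain ⟨b, hb, hab⟩ := he'
    obtain ⟨v, hv⟩ := (hE a ha).2
    have h1 : (Sum.inr (Sum.inl v) : Fin 2 ⊕ (V ⊕ V')) ∈ Sym2.map j' b := by
      have : Sym2.map j' b = Sym2.map j a := hab
      rw [this]; exact Sym2.mem_map.2 ⟨_, hv, rfl⟩
    obtain ⟨c, _, hc⟩ := Sym2.mem_map.1 h1
    rcases c with c | c <;> simp [j'] at hc
  refine ⟨V ⊕ V', inferInstance, (E.map j.sym2Map).disjUnion (E'.map j'.sym2Map) hdisj, ?_, ?_⟩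
  · intro e he
    rw [Finset.mem_disjUnion, Finset.mem_map, Finset.mem_map] at he
    rcases he with ⟨a, ha, rfl⟩ | ⟨a, ha, rfl⟩
    · obtain ⟨h1, v, hv⟩ := hE a ha
      exact ⟨fun h => h1 ((Sym2.isDiag_map j.injective).1 h), Sum.inl v, Sym2.mem_map.2 ⟨_, hv, rfl⟩⟩
    · obtain ⟨h1, v, hv⟩ := hE' a ha
      exact ⟨fun h => h1 ((Sym2.isDiag_map j'.injective).1 h), Sum.inr v, Sym2.mem_map.2 ⟨_, hv, rfl⟩⟩
  · funext X x y
    have e1 : ∀ z : V ⊕ V' → X.Ω, ev X.K (asg x y z) ((E.map j.sym2Map).disjUnion (E'.map j'.sym2Map) hdisj)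
        = ev X.K (asg x y (fun v => z (Sum.inl v))) E * ev X.K (asg x y (fun v => z (Sum.inr v))) E' := by
      intro z
      have : ev X.K (asg x y z) ((E.map j.sym2Map).disjUnion (E'.map j'.sym2Map) hdisj)
          = ev X.K (asg x y z) (E.map j.sym2Map) * ev X.K (asg x y z) (E'.map j'.sym2Map) :=
        Finset.prod_disjUnion _
      rw [this, ev_map, ev_map]
      congr 2
      · funext i; rcases i with i | i <;> rfl
      · funext i; rcases i with i | i <;> rfl
    show rg V E X x y * rg V' E' X x y = _
    unfold rg
    simp only [e1]
    rw [← integral_prod_mul]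
    exact ((measurePreserving_sumPiEquivProdPi (fun _ : V ⊕ V' => X.μ)).integral_comp'
      (fun q => ev X.K (asg x y q.1) E * ev X.K (asg x y q.2) E')).symm

lemma app_RG {H : Obs M} (h : H ∈ RG' M) : app H ∈ RG M := by
  classical
  obtain ⟨V, _, E, hE, rfl⟩ := h
  let jf : Fin 2 ⊕ V → Fin 2 ⊕ (Unit ⊕ V) :=
    Sum.elim (fun i => if i = 0 then Sum.inr (Sum.inl ()) else Sum.inl 1) (fun v => Sum.inr (Sum.inr v))
  have hj : Function.Injective jf := by
    rintro (a | a) (b | b) hab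
    · fin_cases a <;> fin_cases b <;> simp [jf] at hab ⊢
    · fin_cases a <;> simp [jf] at hab
    · fin_cases b <;> simp [jf] at hab
    · simp [jf] at hab; rw [hab]
  let j : Fin 2 ⊕ V ↪ Fin 2 ⊕ (Unit ⊕ V) := ⟨jf, hj⟩
  have hne : ∀ a, jf a ≠ Sum.inl 0 := by
    rintro (a | a)
    · fin_cases a <;> simp [jf]
    · simp [jf]
  have hnot : s(Sum.inl 0, Sum.inr (Sum.inl ())) ∉ E.map j.sym2Map := by
    rw [Finset.mem_map]
    rintro ⟨a, _, ha⟩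
    have h1 : (Sum.inl 0 : Fin 2 ⊕ (Unit ⊕ V)) ∈ Sym2.map jf a := by
      have : Sym2.map jf a = _ := ha
      rw [this]; simp
    obtain ⟨c, _, hc⟩ := Sym2.mem_map.1 h1
    exact hne c hc
  refine ⟨Unit ⊕ V, inferInstance, Finset.cons _ _ hnot, ?_, ?_⟩
  · intro e he
    rw [Finset.mem_cons, Finset.mem_map] at he
    rcases he with rfl | ⟨a, ha, rfl⟩
    · exact ⟨by simp, Sum.inl (), by simp⟩
    · have hd : ¬ (Sym2.map jf a).IsDiag := fun h => hE a ha ((Sym2.isDiag_map hj).1 h)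
      refine ⟨hd, ?_⟩
      revert hd
      change ¬ (Sym2.map jf a).IsDiag → ∃ v, Sum.inr v ∈ Sym2.map jf a
      induction a using Sym2.ind with
      | _ a b =>
        intro hd
        simp only [Sym2.map_mk, Sym2.mem_iff] at hd ⊢
        rcases hja : jf a with u | u
        · rcases hjb : jf b with w | w
          · exfalso
            apply hd
            have h1 := hne a
            have h2 := hne b
            rw [hja] at h1
            rw [hjb] at h2
            rw [hja, hjb]
            fin_cases u <;> fin_cases w <;> simp at h1 h2 ⊢
          · exact ⟨w, Or.inr rfl⟩
        · exact ⟨u, Or.inl rfl⟩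
  · funext X x y
    have e1 : ∀ z : Unit ⊕ V → X.Ω, ev X.K (asg x y z) (Finset.cons _ _ hnot)
        = X.K x (z (Sum.inl ())) * ev X.K (asg (z (Sum.inl ())) y (fun v => z (Sum.inr v))) E := by
      intro z
      have : ev X.K (asg x y z) (Finset.cons _ _ hnot)
          = sym2Val (fun i j => X.K (asg x y z i) (asg x y z j)) s(Sum.inl 0, Sum.inr (Sum.inl ()))
            * ev X.K (asg x y z) (E.map j.sym2Map) :=
        Finset.prod_cons _
      rw [this, ev_map]
      congr 1
      · simp [sym2Val_mk, asg, X.symm (z (Sum.inl ())) x]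
      · congr 1
        funext i; rcases i with i | i
        · fin_cases i <;> rfl
        · rfl
    show ∫ u, X.K x u * rg V E X u y ∂X.μ = _
    unfold rg
    simp only [e1]
    have e2 := (measurePreserving_sumPiEquivProdPi (fun _ : Unit ⊕ V => X.μ)).integral_comp'
      (fun q => X.K x (q.1 ()) * ev X.K (asg (q.1 ()) y q.2) E)
    refine Eq.trans ?_ e2.symm
    rw [integral_prod]
    · simp only [integral_const_mul]
      exact ((measurePreserving_funUnique X.μ Unit).integral_comp'
        (fun u => X.K x u * ∫ z, ev X.K (asg u y z) E ∂(Measure.pi fun _ => X.μ))).symm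
    · refine Integrable.of_bound (C := |M| * M ^ E.card) ?_ (Eventually.of_forall fun q => ?_)
      · refine Measurable.aestronglyMeasurable ?_
        have m1 : Measurable fun q : (Unit → X.Ω) × (V → X.Ω) => q.1 () :=
          (measurable_pi_apply ()).comp measurable_fst
        exact (X.meas.comp (measurable_const.prodMk m1)).mul
          ((ev_meas X E).comp (asg_meas.comp ((m1.prodMk measurable_const).prodMk measurable_snd)))
      · have h1 := ev_bd X (asg (q.1 ()) y q.2) E
        have h2 := X.nonneg x (q.1 ())
        have h3 := X.le x (q.1 ())
        rw [norm_mul, Real.norm_of_nonneg h1.1, Real.norm_of_nonneg h2]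
        exact mul_le_mul (h3.trans (le_abs_self _)) h1.2 h1.1 (abs_nonneg _)

lemma II_rg (V : Type) [Fintype V] (E : Finset (Sym2 (Fin 2 ⊕ V))) (X : KSp M) :
    II (rg V E) X = ∫ a : Fin 2 ⊕ V → X.Ω, ev X.K a E ∂(Measure.pi fun _ => X.μ) := by
  have e2 := (measurePreserving_sumPiEquivProdPi (fun _ : Fin 2 ⊕ V => X.μ)).integral_comp'
      (fun q => ev X.K (Sum.elim q.1 q.2) E)
  have e3 : ∀ a : Fin 2 ⊕ V → X.Ω, ev X.K (Sum.elim ((MeasurableEquiv.sumPiEquivProdPi fun _ => X.Ω) a).1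
      ((MeasurableEquiv.sumPiEquivProdPi fun _ => X.Ω) a).2) E = ev X.K a E := by
    intro a; congr 1; funext i; rcases i with i | i <;> rfl
  simp only [e3] at e2
  rw [e2, integral_prod]
  · unfold II
    rw [← (measurePreserving_finTwoArrow X.μ).integral_comp']
    congr 1; funext r
    unfold rg asg
    congr 1; funext z; congr 2
    funext i; fin_cases i <;> rfl
  · refine Integrable.of_bound (C := M ^ E.card) ?_ (Eventually.of_forall fun q => ?_)
    · refine Measurable.aestronglyMeasurable ((ev_meas X E).comp ?_)
      rw [measurable_pi_iff]
      rintro (i | v)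
      · exact (measurable_pi_apply i).comp measurable_fst
      · exact (measurable_pi_apply v).comp measurable_snd
    · have h1 := ev_bd X (Sum.elim q.1 q.2) E
      rw [Real.norm_of_nonneg h1.1]; exact h1.2

end RG

end Percolation

namespace Percolation
set_option linter.all false

section Good
variable {M : ℝ}

def BM (H : Obs M) : Prop := (∀ X, Measurable (Function.uncurry (H X))) ∧ ∃ B, ∀ X x y, |H X x y| ≤ B

lemma BM_span {h : Obs M} (hh : h ∈ Submodule.span ℝ (RG M)) : BM h := by
  induction hh using Submodule.span_induction with
  | mem x hx =>
    obtain ⟨V, _, E, _, rfl⟩ := hx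
    exact ⟨fun X => rg_meas V E X, _, fun X x y => rg_bd V E X x y⟩
  | zero => exact ⟨fun X => measurable_const, 0, fun X x y => by simp⟩
  | add a b _ _ ha hb =>
    obtain ⟨m1, B1, h1⟩ := ha
    obtain ⟨m2, B2, h2⟩ := hb
    exact ⟨fun X => (m1 X).add (m2 X), B1 + B2, fun X x y =>
      (abs_add_le _ _).trans (add_le_add (h1 X x y) (h2 X x y))⟩
  | smul c a _ ha =>
    obtain ⟨m1, B1, h1⟩ := ha
    exact ⟨fun X => (m1 X).const_mul c, |c| * B1, fun X x y => by
      show |c * a X x y| ≤ _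
      rw [abs_mul]; exact mul_le_mul_of_nonneg_left (h1 X x y) (abs_nonneg _)⟩

lemma mul_span {a b : Obs M} (ha : a ∈ Submodule.span ℝ (RG M)) (hb : b ∈ Submodule.span ℝ (RG M)) :
    a * b ∈ Submodule.span ℝ (RG M) := by
  have := Submodule.mul_mem_mul ha hb
  rw [Submodule.span_mul_span] at this
  refine Submodule.span_mono ?_ this
  rintro _ ⟨x, hx, y, hy, rfl⟩
  exact mul_RG hx hy

lemma BM.sec {H : Obs M} (h : BM H) (X : KSp M) (x y : X.Ω) :
    Integrable (fun u => X.K x u * H X u y) X.μ := by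
  obtain ⟨m, B, hB⟩ := h
  refine Integrable.of_bound (C := |M| * B) ?_ (Eventually.of_forall fun u => ?_)
  · refine Measurable.aestronglyMeasurable ?_
    exact (Measurable.comp (g := Function.uncurry X.K) X.meas (measurable_const.prodMk measurable_id)).mul
      (Measurable.comp (g := Function.uncurry (H X)) (m X) (measurable_id.prodMk measurable_const))
  · rw [norm_mul, Real.norm_of_nonneg (X.nonneg _ _)]
    exact mul_le_mul ((X.le _ _).trans (le_abs_self _)) (hB _ _ _) (norm_nonneg _) (abs_nonneg _)

lemma BM.app {H : Obs M} (h : BM H) : BM (app H) := by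
  refine ⟨fun X => ?_, ?_⟩
  · have hm : Measurable (fun q : (X.Ω × X.Ω) × X.Ω => X.K q.1.1 q.2 * H X q.2 q.1.2) :=
      (Measurable.comp (g := Function.uncurry X.K) X.meas
        ((measurable_fst.comp measurable_fst).prodMk measurable_snd)).mul
      (Measurable.comp (g := Function.uncurry (H X)) (h.1 X)
        (measurable_snd.prodMk (measurable_snd.comp measurable_fst)))
    exact (hm.stronglyMeasurable.integral_prod_right' (ν := X.μ)).measurable
  · obtain ⟨m, B, hB⟩ := h
    refine ⟨|M| * B, fun X x y => ?_⟩
    have := norm_integral_le_of_norm_le_const (μ := X.μ) (f := fun u => X.K x u * H X u y) (C := |M| * B)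
      (Eventually.of_forall fun u => by
        rw [norm_mul, Real.norm_of_nonneg (X.nonneg _ _)]
        exact mul_le_mul ((X.le _ _).trans (le_abs_self _)) (hB _ _ _) (norm_nonneg _) (abs_nonneg _))
    simpa [Percolation.app] using this

lemma app_span {a : Obs M} (ha : a ∈ Submodule.span ℝ (RG M)) : app a ∈ Submodule.span ℝ (RG M) := by
  induction ha using Submodule.span_induction with
  | mem x hx => exact Submodule.subset_span (app_RG (RG_sub hx))
  | zero =>
    have : app (0 : Obs M) = 0 := by funext X x y; simp [app]
    rw [this]; exact zero_mem _
  | add a b ha hb iha ihb =>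
    have : app (a + b) = app a + app b := by
      funext X x y
      show ∫ u, X.K x u * (a X u y + b X u y) ∂X.μ = _
      simp only [mul_add]
      exact integral_add ((BM_span ha).sec X x y) ((BM_span hb).sec X x y)
    rw [this]; exact add_mem iha ihb
  | smul c a ha iha =>
    have : app (c • a) = c • app a := by
      funext X x y
      show ∫ u, X.K x u * (c * a X u y) ∂X.μ = c * ∫ u, X.K x u * a X u y ∂X.μ
      rw [← integral_const_mul]; congr 1; funext u; ring
    rw [this]; exact Submodule.smul_mem _ _ iha

def Good (H : Obs M) : Prop := (∀ X, Measurable (Function.uncurry (H X))) ∧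
  ∀ ε > 0, ∃ h ∈ Submodule.span ℝ (RG M), ∀ X x y, |H X x y - h X x y| ≤ ε

lemma Good.bm {H : Obs M} (h : Good H) : BM H := by
  refine ⟨h.1, ?_⟩
  obtain ⟨g, hg, h1⟩ := h.2 1 one_pos
  obtain ⟨B, hB⟩ := (BM_span hg).2
  refine ⟨1 + B, fun X x y => ?_⟩
  have : H X x y = (H X x y - g X x y) + g X x y := by ring
  rw [this]
  exact (abs_add_le _ _).trans (add_le_add (h1 X x y) (hB X x y))

lemma Good.of_span {H : Obs M} (h : H ∈ Submodule.span ℝ (RG M)) : Good H :=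
  ⟨(BM_span h).1, fun ε hε => ⟨H, h, fun X x y => by simpa using hε.le⟩⟩

lemma Good.of_RG {H : Obs M} (h : H ∈ RG M) : Good H := Good.of_span (Submodule.subset_span h)

lemma Good.const (c : ℝ) : Good (fun _ _ _ => c : Obs M) := by
  have : (fun _ _ _ => c : Obs M) = c • (1 : Obs M) := by
    funext X x y; show c = c * 1; ring
  rw [this]
  exact Good.of_span (Submodule.smul_mem _ _ (Submodule.subset_span one_RG))

lemma Good.add {H G : Obs M} (h : Good H) (g : Good G) : Good (fun X x y => H X x y + G X x y) := by
  refine ⟨fun X => (h.1 X).add (g.1 X), fun ε hε => ?_⟩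
  obtain ⟨a, ha, h1⟩ := h.2 (ε / 2) (by positivity)
  obtain ⟨b, hb, h2⟩ := g.2 (ε / 2) (by positivity)
  refine ⟨a + b, add_mem ha hb, fun X x y => ?_⟩
  have : H X x y + G X x y - (a + b) X x y = (H X x y - a X x y) + (G X x y - b X x y) := by
    show H X x y + G X x y - (a X x y + b X x y) = _
    ring
  rw [this]
  refine (abs_add_le _ _).trans ?_
  have := h1 X x y; have := h2 X x y
  linarith

lemma Good.mul {H G : Obs M} (h : Good H) (g : Good G) : Good (fun X x y => H X x y * G X x y) := by
  refine ⟨fun X => (h.1 X).mul (g.1 X), fun ε hε => ?_⟩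
  obtain ⟨B0, hB0⟩ := h.bm.2
  set B := |B0| + 1
  have hB : ∀ X x y, |H X x y| ≤ B := fun X x y => (hB0 X x y).trans (by
    have := le_abs_self B0; simp only [B]; linarith)
  have hBp : 0 < B := by positivity
  obtain ⟨b, hb, h2⟩ := g.2 (ε / (2 * B)) (by positivity)
  obtain ⟨D0, hD0⟩ := (BM_span hb).2
  set D := |D0| + 1
  have hD : ∀ X x y, |b X x y| ≤ D := fun X x y => (hD0 X x y).trans (by
    have := le_abs_self D0; simp only [D]; linarith)
  have hDp : 0 < D := by positivity
  obtain ⟨a, ha, h1⟩ := h.2 (ε / (2 * D)) (by positivity)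
  refine ⟨a * b, mul_span ha hb, fun X x y => ?_⟩
  have : H X x y * G X x y - (a * b) X x y
      = H X x y * (G X x y - b X x y) + (H X x y - a X x y) * b X x y := by
    show H X x y * G X x y - a X x y * b X x y = _
    ring
  rw [this]
  refine (abs_add_le _ _).trans ?_
  rw [abs_mul, abs_mul]
  have e1 : |H X x y| * |G X x y - b X x y| ≤ B * (ε / (2 * B)) :=
    mul_le_mul (hB X x y) (h2 X x y) (abs_nonneg _) hBp.le
  have e2 : |H X x y - a X x y| * |b X x y| ≤ ε / (2 * D) * D :=
    mul_le_mul (h1 X x y) (hD X x y) (abs_nonneg _) (by positivity)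
  have e3 : B * (ε / (2 * B)) = ε / 2 := by field_simp
  have e4 : ε / (2 * D) * D = ε / 2 := by field_simp
  linarith

lemma Good.smul {H : Obs M} (c : ℝ) (h : Good H) : Good (fun X x y => c * H X x y) :=
  (Good.const c).mul h

lemma Good.pow {H : Obs M} (h : Good H) (m : ℕ) : Good (fun X x y => H X x y ^ m) := by
  induction m with
  | zero => simpa using Good.const (M := M) 1
  | succ m ih => simpa [pow_succ] using ih.mul h

lemma Good.sum {H : ℕ → Obs M} (h : ∀ i, Good (H i)) (m : ℕ) :
    Good (fun X x y => ∑ i ∈ Finset.range m, H i X x y) := by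
  induction m with
  | zero => simpa using Good.const (M := M) 0
  | succ m ih => simpa [Finset.sum_range_succ] using ih.add (h m)

lemma Good.prod {H : ℕ → Obs M} (h : ∀ i, Good (H i)) (m : ℕ) :
    Good (fun X x y => ∏ i ∈ Finset.range m, H i X x y) := by
  induction m with
  | zero => simpa using Good.const (M := M) 1
  | succ m ih => simpa [Finset.prod_range_succ] using ih.mul (h m)

lemma Good.lim {H : Obs M} (hm : ∀ X, Measurable (Function.uncurry (H X)))
    (h : ∀ ε > 0, ∃ G, Good G ∧ ∀ X x y, |H X x y - G X x y| ≤ ε) : Good H := by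
  refine ⟨hm, fun ε hε => ?_⟩
  obtain ⟨G, hG, h1⟩ := h (ε / 2) (by positivity)
  obtain ⟨g, hg, h2⟩ := hG.2 (ε / 2) (by positivity)
  refine ⟨g, hg, fun X x y => ?_⟩
  have : H X x y - g X x y = (H X x y - G X x y) + (G X x y - g X x y) := by ring
  rw [this]
  have := h1 X x y; have := h2 X x y
  exact (abs_add_le _ _).trans (by linarith)

lemma Good.comp {H : Obs M} (h : Good H) {φ : ℝ → ℝ} (hφ : Continuous φ) :
    Good (fun X x y => φ (H X x y)) := by
  refine Good.lim (fun X => hφ.measurable.comp (h.1 X)) fun ε hε => ?_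
  obtain ⟨B, hB⟩ := h.bm.2
  obtain ⟨q, hq⟩ := exists_polynomial_near_of_continuousOn (-B) B φ hφ.continuousOn ε hε
  refine ⟨fun X x y => q.eval (H X x y), ?_, fun X x y => ?_⟩
  · simp only [Polynomial.eval_eq_sum_range]
    exact Good.sum (fun i => (h.pow i).smul (q.coeff i)) _
  · rw [abs_sub_comm]
    exact (hq _ ⟨(abs_le.1 (hB X x y)).1, (abs_le.1 (hB X x y)).2⟩).le

lemma Good.app {H : Obs M} (h : Good H) : Good (app H) := by
  refine ⟨h.bm.app.1, fun ε hε => ?_⟩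
  obtain ⟨a, ha, h1⟩ := h.2 (ε / (|M| + 1)) (by positivity)
  refine ⟨Percolation.app a, app_span ha, fun X x y => ?_⟩
  have : Percolation.app H X x y - Percolation.app a X x y
      = ∫ u, X.K x u * (H X u y - a X u y) ∂X.μ := by
    unfold Percolation.app
    rw [← integral_sub (h.bm.sec X x y) ((BM_span ha).sec X x y)]
    congr 1; funext u; ring
  rw [this]
  have := norm_integral_le_of_norm_le_const (μ := X.μ) (f := fun u => X.K x u * (H X u y - a X u y)) (C := ε)
    (Eventually.of_forall fun u => by
      rw [norm_mul, Real.norm_of_nonneg (X.nonneg _ _)]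
      have e1 : X.K x u ≤ |M| + 1 := (X.le _ _).trans ((le_abs_self _).trans (by linarith))
      calc _ ≤ (|M| + 1) * (ε / (|M| + 1)) := mul_le_mul e1 (h1 _ _ _) (abs_nonneg _) (by positivity)
        _ = ε := by field_simp)
  simpa using this

lemma BM.int {H : Obs M} (h : BM H) (X : KSp M) :
    Integrable (fun q : X.Ω × X.Ω => H X q.1 q.2) (X.μ.prod X.μ) := by
  obtain ⟨m, B, hB⟩ := h
  exact Integrable.of_bound (C := B) (m X).aestronglyMeasurable (Eventually.of_forall fun u => hB _ _ _)

lemma two_RG : app (fun X x y => X.K x y : Obs M) ∈ RG M := app_RG K_RG'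

end Good

/-- all data of the theorem -/
structure Dat (M : ℝ) where
  β : ∀ n : ℕ, Fin n → Fin n → ℝ
  W : ℝ → ℝ → ℝ
  bsym : ∀ n i j, β n i j = β n j i
  bnn : ∀ n i j, 0 ≤ β n i j
  bdiag : ∀ n i, β n i i = 0
  bb : ∀ n i j, β n i j ≤ M
  Wm : Measurable (Function.uncurry W)
  Wnn : ∀ x y, 0 ≤ W x y
  Wsym : ∀ x y, W x y = W y x
  Wb : ∀ x y, W x y ≤ M
  conv : ConvergesTo β W
  M1 : 1 ≤ M

namespace Dat
variable {M : ℝ} (D : Dat M)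

def XN (n : ℕ) (hn : 0 < n) : KSp M where
  Ω := Fin n
  ms := ⊤
  μ := @HSMul.hSMul _ _ _ _ ((n : ENNReal)⁻¹) (@Measure.count (Fin n) ⊤)
  prob := by
    letI : MeasurableSpace (Fin n) := ⊤
    refine ⟨?_⟩
    rw [Measure.smul_apply, Measure.count_univ]
    simp only [smul_eq_mul, ENat.card_eq_coe_fintype_card, Fintype.card_fin]
    exact ENNReal.inv_mul_cancel (by simpa using hn.ne') (by simp)
  K := D.β n
  meas := by
    letI : MeasurableSpace (Fin n) := ⊤
    exact measurable_of_finite _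
  symm := D.bsym n
  nonneg := D.bnn n
  le := D.bb n

def XW : KSp M where
  Ω := ℝ
  ms := inferInstance
  μ := volume.restrict I01
  prob := ⟨by simp [I01]⟩
  K := D.W
  meas := D.Wm
  symm := D.Wsym
  nonneg := D.Wnn
  le := D.Wb

instance (n : ℕ) (hn : 0 < n) : Fintype (D.XN n hn).Ω := inferInstanceAs (Fintype (Fin n))
instance (n : ℕ) (hn : 0 < n) : MeasurableSingletonClass (D.XN n hn).Ω :=
  ⟨fun _ => MeasurableSpace.measurableSet_top⟩

lemma XN_single (n : ℕ) (hn : 0 < n) (i : (D.XN n hn).Ω) : (D.XN n hn).μ {i} = (n : ENNReal)⁻¹ := by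
  have : (D.XN n hn).μ = (n : ENNReal)⁻¹ • Measure.count := rfl
  rw [this, Measure.smul_apply, Measure.count_singleton]; simp

lemma XN_int (n : ℕ) (hn : 0 < n) (f : (D.XN n hn).Ω → ℝ) :
    ∫ x, f x ∂(D.XN n hn).μ = (∑ i, f i) / n := by
  rw [integral_fintype Integrable.of_finite]
  simp only [Measure.real, XN_single]
  simp [← Finset.mul_sum]; field_simp

lemma XN_II (n : ℕ) (hn : 0 < n) (H : Obs M) :
    II H (D.XN n hn) = (∑ i, ∑ j, H (D.XN n hn) i j) / (n:ℝ) ^ 2 := by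
  unfold II
  rw [integral_prod _ Integrable.of_finite]
  simp only [XN_int]
  rw [← Finset.sum_div, div_div, sq]

lemma XN_pi (n : ℕ) (hn : 0 < n) (k : ℕ) (f : (Fin k → (D.XN n hn).Ω) → ℝ) :
    ∫ x, f x ∂(Measure.pi fun _ => (D.XN n hn).μ) = (∑ a, f a) / (n:ℝ) ^ k := by
  rw [integral_fintype Integrable.of_finite]
  simp only [Measure.real, Measure.pi_singleton, XN_single]
  simp [← Finset.mul_sum]; field_simp

lemma edgeProd_int (X : KSp M) {I : Type} [Fintype I] {k : ℕ} (e : I ≃ Fin k) (E : Finset (Sym2 I))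
    (hE : ∀ a ∈ E, ¬ a.IsDiag) :
    ∫ a : Fin k → X.Ω, edgeProd (SimpleGraph.fromEdgeSet ((E.map e.toEmbedding.sym2Map : Finset (Sym2 (Fin _))) : Set (Sym2 (Fin _))))
        (fun i j => X.K (a i) (a j)) ∂(Measure.pi fun _ => X.μ)
      = ∫ a : I → X.Ω, ev X.K a E ∂(Measure.pi fun _ => X.μ) := by
  classical
  have h1 : ∀ a : Fin k → X.Ω, edgeProd (SimpleGraph.fromEdgeSet ((E.map e.toEmbedding.sym2Map : Finset (Sym2 (Fin _))) : Set (Sym2 (Fin _))))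
        (fun i j => X.K (a i) (a j)) = ev X.K (fun i => a (e i)) E := by
    intro a
    refine Eq.trans ?_ (ev_map X.K a E e.toEmbedding)
    unfold edgeProd ev
    refine Finset.prod_congr ?_ fun _ _ => rfl
    ext q
    refine (@Set.mem_toFinset _ _ (_) _).trans ?_
    rw [SimpleGraph.edgeSet_fromEdgeSet]
    constructor
    · intro h; exact_mod_cast h.1
    · intro h
      refine ⟨by exact_mod_cast h, ?_⟩
      obtain ⟨b, hb, rfl⟩ := Finset.mem_map.1 h
      intro hd
      exact hE b hb ((Sym2.isDiag_map e.injective).1 hd)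
  simp only [h1]
  have := (measurePreserving_piCongrLeft (fun _ : I => X.μ) e.symm).integral_comp' (fun a => ev X.K a E)
  rw [← this]
  congr 1; funext a
  congr 1; funext i
  have := MeasurableEquiv.piCongrLeft_apply_apply (β := fun _ : I => X.Ω) (e := e.symm) a (e i)
  simpa using this.symm

lemma conv_RG' {H : Obs M} (h : H ∈ RG' M) {ε : ℝ} (hε : 0 < ε) :
    ∀ᶠ n in atTop, ∀ hn : 0 < n, |II H (D.XN n hn) - II H D.XW| ≤ ε := by
  obtain ⟨V, _, E, hE, rfl⟩ := h
  let e := Fintype.equivFin (Fin 2 ⊕ V)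
  have hc := D.conv (Fintype.card (Fin 2 ⊕ V)) (SimpleGraph.fromEdgeSet ((E.map e.toEmbedding.sym2Map : Finset (Sym2 (Fin _))) : Set (Sym2 (Fin _))))
  have := (Metric.tendsto_atTop.1 hc) ε hε
  obtain ⟨N, hN⟩ := this
  filter_upwards [eventually_ge_atTop N] with n hnN hn
  have h1 := hN n hnN
  rw [Real.dist_eq] at h1
  rw [II_rg, II_rg, ← edgeProd_int _ e E hE, ← edgeProd_int _ e E hE, XN_pi]
  have h2 : homDensityW (k := Fintype.card (Fin 2 ⊕ V)) D.W (SimpleGraph.fromEdgeSet ((E.map e.toEmbedding.sym2Map : Finset (Sym2 (Fin _))) : Set (Sym2 (Fin _))))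
      = ∫ a, edgeProd (k := Fintype.card (Fin 2 ⊕ V)) (SimpleGraph.fromEdgeSet ((E.map e.toEmbedding.sym2Map : Finset (Sym2 (Fin _))) : Set (Sym2 (Fin _))))
        (fun i j => D.XW.K (a i) (a j)) ∂(Measure.pi fun _ => D.XW.μ) := by
    unfold homDensityW
    rw [volume_pi, Measure.restrict_pi_pi]; rfl
  rw [← h2]
  exact h1.le

lemma conv_good {H : Obs M} (h : Good H) {ε : ℝ} (hε : 0 < ε) :
    ∀ᶠ n in atTop, ∀ hn : 0 < n, |II H (D.XN n hn) - II H D.XW| ≤ ε := by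
  have key : ∀ a ∈ Submodule.span ℝ (RG M), ∀ ε > 0,
      ∀ᶠ n in atTop, ∀ hn : 0 < n, |II a (D.XN n hn) - II a D.XW| ≤ ε := by
    intro a ha
    induction ha using Submodule.span_induction with
    | mem x hx => intro ε hε; exact D.conv_RG' (RG_sub hx) hε
    | zero => intro ε hε; exact Eventually.of_forall fun n hn => by simpa [II] using hε.le
    | add a b ha hb iha ihb =>
      intro ε hε
      filter_upwards [iha (ε / 2) (by positivity), ihb (ε / 2) (by positivity)] with n h1 h2 hn
      have e : ∀ X, II (a + b) X = II a X + II b X := fun X =>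
        integral_add ((BM_span ha).int X) ((BM_span hb).int X)
      rw [e, e]
      have h1 := abs_le.1 (h1 hn); have h2 := abs_le.1 (h2 hn)
      rw [abs_le]; constructor <;> linarith
    | smul c a ha iha =>
      intro ε hε
      filter_upwards [iha (ε / (|c| + 1)) (by positivity)] with n h1 hn
      have e : ∀ X, II (c • a) X = c * II a X := fun X => integral_const_mul c _
      rw [e, e, ← mul_sub, abs_mul]
      calc |c| * |II a (D.XN n hn) - II a D.XW| ≤ (|c| + 1) * (ε / (|c| + 1)) :=
            mul_le_mul (by linarith) (h1 hn) (abs_nonneg _) (by positivity)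
        _ = ε := by field_simp
  obtain ⟨a, ha, h1⟩ := h.2 (ε / 3) (by positivity)
  have hX : ∀ X, |II H X - II a X| ≤ ε / 3 := by
    intro X
    unfold II
    rw [← integral_sub (h.bm.int X) ((BM_span ha).int X)]
    have := norm_integral_le_of_norm_le_const (μ := X.μ.prod X.μ)
      (f := fun q => H X q.1 q.2 - a X q.1 q.2) (C := ε / 3) (Eventually.of_forall fun q => h1 _ _ _)
    simpa using this
  filter_upwards [key a ha (ε / 3) (by positivity)] with n h2 hn
  have h2 := abs_le.1 (h2 hn)
  have h3 := abs_le.1 (hX (D.XN n hn))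
  have h4 := abs_le.1 (hX D.XW)
  rw [abs_le]; constructor <;> linarith

end Dat

end Percolation

namespace Percolation
set_option linter.all false
variable {M : ℝ}

def TT (X : KSp M) (f : X.Ω → ℝ) (x : X.Ω) : ℝ := ∫ u, X.K x u * f u ∂X.μ

def GG (X : KSp M) (t : ℝ) : ℕ → X.Ω → ℝ
  | 0 => fun _ => 1
  | r + 1 => fun x => 1 - Real.exp (-(t * TT X (GG X t r) x))

/-- measurable with values in the unit interval -/
def UF (X : KSp M) (f : X.Ω → ℝ) : Prop := Measurable f ∧ ∀ x, 0 ≤ f x ∧ f x ≤ 1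

section TT
variable (X : KSp M)

lemma KSp.Mnn (X : KSp M) : 0 ≤ M := by
  obtain ⟨x⟩ : Nonempty X.Ω := by
    by_contra h
    rw [not_nonempty_iff] at h
    have := measure_univ (μ := X.μ)
    simp [Set.eq_empty_of_isEmpty] at this
  exact (X.nonneg x x).trans (X.le x x)

lemma Ksec (x : X.Ω) : Measurable (X.K x) := X.meas.comp (measurable_const.prodMk measurable_id)

variable {X}

lemma UF.int {f : X.Ω → ℝ} (h : UF X f) : Integrable f X.μ :=
  Integrable.of_bound (C := 1) h.1.aestronglyMeasurable (Eventually.of_forall fun u => by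
    rw [Real.norm_of_nonneg (h.2 u).1]; exact (h.2 u).2)

lemma UF.intK {f : X.Ω → ℝ} (h : UF X f) (x : X.Ω) : Integrable (fun u => X.K x u * f u) X.μ :=
  h.int.bdd_mul (c := M) (Ksec X x).aestronglyMeasurable (Eventually.of_forall fun u => by
    rw [Real.norm_of_nonneg (X.nonneg x u)]; exact X.le x u)

lemma TT_nn {f : X.Ω → ℝ} (h : UF X f) (x : X.Ω) : 0 ≤ TT X f x :=
  integral_nonneg fun u => mul_nonneg (X.nonneg _ _) (h.2 u).1

lemma TT_le {f : X.Ω → ℝ} (h : UF X f) (x : X.Ω) : TT X f x ≤ M := by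
  have : TT X f x ≤ ∫ u, M ∂X.μ := integral_mono (h.intK x) (integrable_const _) fun u => by
    have := mul_le_mul (X.le x u) (h.2 u).2 (h.2 u).1 X.Mnn
    simpa using this
  simpa using this

lemma TT_mono {f g : X.Ω → ℝ} (h : UF X f) (h' : UF X g) (hfg : ∀ᵐ x ∂X.μ, f x ≤ g x) (x : X.Ω) :
    TT X f x ≤ TT X g x :=
  integral_mono_ae (h.intK x) (h'.intK x) (hfg.mono fun u hu =>
    mul_le_mul_of_nonneg_left hu (X.nonneg _ _))

lemma TT_meas {f : X.Ω → ℝ} (h : Measurable f) : Measurable (TT X f) := by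
  have hm : Measurable (fun q : X.Ω × X.Ω => X.K q.1 q.2 * f q.2) :=
    (X.meas : Measurable (fun q : X.Ω × X.Ω => X.K q.1 q.2)).mul (h.comp measurable_snd)
  exact (hm.stronglyMeasurable.integral_prod_right' (ν := X.μ)).measurable

lemma TT_lim {f : ℕ → X.Ω → ℝ} {g : X.Ω → ℝ} (h : ∀ n, UF X (f n))
    (hl : ∀ x, Tendsto (fun n => f n x) atTop (𝓝 (g x))) (x : X.Ω) :
    Tendsto (fun n => TT X (f n) x) atTop (𝓝 (TT X g x)) := by
  refine tendsto_integral_of_dominated_convergence (fun _ => M)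
    (fun n => ((h n).intK x).aestronglyMeasurable) (integrable_const _) (fun n =>
      Eventually.of_forall fun u => ?_) (Eventually.of_forall fun u => (hl u).const_mul _)
  rw [Real.norm_of_nonneg (mul_nonneg (X.nonneg _ _) ((h n).2 u).1)]
  have := mul_le_mul (X.le x u) ((h n).2 u).2 ((h n).2 u).1 X.Mnn
  simpa using this

lemma UF_lim {f : ℕ → X.Ω → ℝ} {g : X.Ω → ℝ} (h : ∀ n, UF X (f n))
    (hl : ∀ x, Tendsto (fun n => f n x) atTop (𝓝 (g x))) : UF X g :=
  ⟨measurable_of_tendsto_metrizable (fun n => (h n).1) (tendsto_pi_nhds.2 hl), fun x =>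
    ⟨ge_of_tendsto' (hl x) fun n => ((h n).2 x).1, le_of_tendsto' (hl x) fun n => ((h n).2 x).2⟩⟩

lemma int_lim {f : ℕ → X.Ω → ℝ} {g : X.Ω → ℝ} (h : ∀ n, UF X (f n))
    (hl : ∀ x, Tendsto (fun n => f n x) atTop (𝓝 (g x))) :
    Tendsto (fun n => ∫ x, f n x ∂X.μ) atTop (𝓝 (∫ x, g x ∂X.μ)) :=
  tendsto_integral_of_dominated_convergence (fun _ => 1)
    (fun n => (h n).1.aestronglyMeasurable) (integrable_const _) (fun n =>
      Eventually.of_forall fun u => by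
        rw [Real.norm_of_nonneg ((h n).2 u).1]; exact ((h n).2 u).2) (Eventually.of_forall hl)

lemma GG_UF {t : ℝ} (ht : 0 ≤ t) (r : ℕ) : UF X (GG X t r) := by
  induction r with
  | zero => exact ⟨measurable_const, fun x => by simp [GG]⟩
  | succ r ih =>
    refine ⟨?_, fun x => ?_⟩
    · exact measurable_const.sub (Real.measurable_exp.comp ((TT_meas ih.1).const_mul t).neg)
    · have h1 := mul_nonneg ht (TT_nn ih x)
      have h2 : Real.exp (-(t * TT X (GG X t r) x)) ≤ 1 := Real.exp_le_one_iff.2 (by linarith)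
      have h3 := Real.exp_pos (-(t * TT X (GG X t r) x))
      constructor <;> simp only [GG] <;> linarith

lemma GG_anti {t : ℝ} (ht : 0 ≤ t) (x : X.Ω) : Antitone (fun r => GG X t r x) := by
  refine antitone_nat_of_succ_le fun r => ?_
  induction r generalizing x with
  | zero => exact ((GG_UF ht 1).2 x).2
  | succ r ih =>
    have := TT_mono (GG_UF ht (r + 1)) (GG_UF ht r) (Eventually.of_forall ih) x
    have := mul_le_mul_of_nonneg_left this ht
    have : Real.exp (-(t * TT X (GG X t r) x)) ≤ Real.exp (-(t * TT X (GG X t (r + 1)) x)) :=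
      Real.exp_le_exp.2 (by linarith)
    show 1 - _ ≤ 1 - _
    linarith

lemma GG_mono {s t : ℝ} (hs : 0 ≤ s) (hst : s ≤ t) (r : ℕ) (x : X.Ω) : GG X s r x ≤ GG X t r x := by
  induction r generalizing x with
  | zero => exact le_rfl
  | succ r ih =>
    have ht := hs.trans hst
    have := TT_mono (GG_UF hs r) (GG_UF ht r) (Eventually.of_forall ih) x
    have := mul_le_mul hst this (TT_nn (GG_UF hs r) x) ht
    have : Real.exp (-(t * TT X (GG X t r) x)) ≤ Real.exp (-(s * TT X (GG X s r) x)) :=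
      Real.exp_le_exp.2 (by linarith)
    show 1 - _ ≤ 1 - _
    linarith

variable (X) in
def SS (t : ℝ) (x : X.Ω) : ℝ := ⨅ r, GG X t r x

lemma SS_lim {t : ℝ} (ht : 0 ≤ t) (x : X.Ω) : Tendsto (fun r => GG X t r x) atTop (𝓝 (SS X t x)) :=
  tendsto_atTop_ciInf (GG_anti ht x) ⟨0, by rintro _ ⟨r, rfl⟩; exact ((GG_UF ht r).2 x).1⟩

lemma SS_UF {t : ℝ} (ht : 0 ≤ t) : UF X (SS X t) := UF_lim (GG_UF ht) (SS_lim ht)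

lemma SS_le {t : ℝ} (ht : 0 ≤ t) (r : ℕ) (x : X.Ω) : SS X t x ≤ GG X t r x :=
  (GG_anti ht x).le_of_tendsto (SS_lim ht x) r

lemma SS_fix {t : ℝ} (ht : 0 ≤ t) (x : X.Ω) :
    SS X t x = 1 - Real.exp (-(t * TT X (SS X t) x)) := by
  refine tendsto_nhds_unique ((SS_lim ht x).comp (tendsto_add_atTop_nat 1)) ?_
  have := (TT_lim (GG_UF ht) (SS_lim ht) x).const_mul t
  exact ((Real.continuous_exp.tendsto _).comp this.neg).const_sub 1

lemma SS_mono {s t : ℝ} (hs : 0 ≤ s) (hst : s ≤ t) (x : X.Ω) : SS X s x ≤ SS X t x :=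
  le_of_tendsto_of_tendsto' (SS_lim hs x) (SS_lim (hs.trans hst) x) fun r => GG_mono hs hst r x

lemma SS_max {t : ℝ} (ht : 0 ≤ t) {f : X.Ω → ℝ} (hf : UF X f)
    (h : ∀ᵐ x ∂X.μ, f x = 1 - Real.exp (-(t * TT X f x))) : ∀ᵐ x ∂X.μ, f x ≤ SS X t x := by
  have key : ∀ r, ∀ᵐ x ∂X.μ, f x ≤ GG X t r x := by
    intro r
    induction r with
    | zero => exact Eventually.of_forall fun x => (hf.2 x).2
    | succ r ih =>
      filter_upwards [h] with x hx
      have := TT_mono hf (GG_UF ht r) ih x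
      have := mul_le_mul_of_nonneg_left this ht
      have : Real.exp (-(t * TT X (GG X t r) x)) ≤ Real.exp (-(t * TT X f x)) :=
        Real.exp_le_exp.2 (by linarith)
      rw [hx]
      show 1 - _ ≤ 1 - _
      linarith
  filter_upwards [ae_all_iff.2 key] with x hx
  exact ge_of_tendsto' (SS_lim ht x) hx

end TT

lemma Dat.surv (D : Dat M) {t : ℝ} (ht : 0 ≤ t) :
    survival (fun x y => t * D.W x y) = ∫ x, SS D.XW t x ∂D.XW.μ := by
  have hT : ∀ (f : ℝ → ℝ) x, ∫ y in I01, t * D.W x y * f y = t * TT D.XW f x := by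
    intro f x
    simp only [mul_assoc]
    exact integral_const_mul t _
  unfold survival
  refine IsGreatest.csSup_eq ⟨⟨SS D.XW t, (SS_UF (X := D.XW) ht).1, fun x => (SS_UF (X := D.XW) ht).2 x, ?_, rfl⟩, ?_⟩
  · refine Eventually.of_forall fun x => ?_
    exact (SS_fix (X := D.XW) ht x).trans
      (congrArg (fun z => 1 - Real.exp (-z)) (hT (SS D.XW t) x).symm)
  · rintro _ ⟨f, hm, hb, hfix, rfl⟩
    have hf : UF D.XW f := ⟨hm, hb⟩
    have := SS_max ht hf (hfix.mono fun x hx =>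
      hx.trans (congrArg (fun z => 1 - Real.exp (-z)) (hT f x)))
    exact integral_mono_ae hf.int (SS_UF ht).int this

end Percolation

namespace Percolation
set_option linter.all false
variable {M : ℝ}

def psi (b : ℝ) : ℝ := dslope (fun b : ℝ => 1 - Real.exp (-b)) 0 b

lemma psi_mul (b : ℝ) : b * psi b = 1 - Real.exp (-b) := by
  have := sub_smul_dslope (fun b : ℝ => 1 - Real.exp (-b)) 0 b
  simpa [psi] using this

lemma psi_hasDeriv : HasDerivAt (fun b : ℝ => 1 - Real.exp (-b)) 1 0 := by
  have := ((hasDerivAt_neg (0:ℝ)).exp).const_sub 1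
  simpa using this

lemma psi_zero : psi 0 = 1 := by
  rw [psi, dslope_same]; exact psi_hasDeriv.deriv

lemma psi_cont : Continuous psi := by
  rw [← continuousOn_univ]
  exact (continuousOn_dslope Filter.univ_mem).2 ⟨by fun_prop, psi_hasDeriv.differentiableAt⟩

lemma psi_anti {a b : ℝ} (ha : 0 ≤ a) (hab : a < b) : psi b < psi a := by
  have hb : 0 < b := ha.trans_lt hab
  have h1 := psi_mul b
  refine lt_of_mul_lt_mul_left ?_ hb.le
  rcases ha.eq_or_lt with rfl | ha
  · rw [h1, psi_zero]
    have := Real.add_one_lt_exp (x := -b) (by linarith)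
    linarith
  · have h2 := psi_mul a
    refine lt_of_mul_lt_mul_left ?_ ha.le
    have : a * (b * psi a) = b * (1 - Real.exp (-a)) := by rw [← h2]; ring
    rw [this, h1]
    have := strictConvexOn_exp.2 (Set.mem_univ (-b)) (Set.mem_univ 0) (by linarith : -b ≠ 0)
      (div_pos ha hb) (sub_pos.2 ((div_lt_one hb).2 hab)) (by ring)
    simp only [smul_eq_mul, mul_zero, add_zero, Real.exp_zero, mul_one] at this
    have e : a / b * -b = -a := by field_simp
    rw [e] at this
    have := mul_lt_mul_of_pos_left this hb
    have e2 : b * (a / b * Real.exp (-b) + (1 - a / b)) = a * Real.exp (-b) + (b - a) := by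
      field_simp
    rw [e2] at this
    linarith

lemma psi_pos {b : ℝ} (hb : 0 ≤ b) : 0 < psi b := by
  rcases hb.eq_or_lt with rfl | hb
  · rw [psi_zero]; exact one_pos
  · have h1 := psi_mul b
    have : Real.exp (-b) < 1 := Real.exp_lt_one_iff.2 (by linarith)
    by_contra h
    nlinarith

def phi (b : ℝ) : ℝ := (psi b)⁻¹

lemma phi_pos {b : ℝ} (hb : 0 ≤ b) : 0 < phi b := inv_pos.2 (psi_pos hb)

lemma phi_le {a b : ℝ} (ha : 0 ≤ a) (hab : a ≤ b) : phi a ≤ phi b := by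
  rcases hab.eq_or_lt with rfl | h
  · exact le_rfl
  · exact inv_anti₀ (psi_pos (ha.trans hab)) (psi_anti ha h).le

lemma phi_inj {a b : ℝ} (ha : 0 ≤ a) (hab : a ≤ b) (h : phi a = phi b) : a = b := by
  by_contra hne
  have := psi_anti ha (lt_of_le_of_ne hab hne)
  have h' : psi a = psi b := inv_injective h
  linarith

lemma phi_ev {b : ℝ} (hb : 0 ≤ b) : (1 - Real.exp (-b)) * phi b = b := by
  rw [← psi_mul, phi]; field_simp [(psi_pos hb).ne']

lemma phi_meas : Measurable phi := psi_cont.measurable.inv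

lemma phi_lim {a : ℕ → ℝ} {b : ℝ} (hb : 0 ≤ b) (h : Tendsto a atTop (𝓝 b)) :
    Tendsto (fun n => phi (a n)) atTop (𝓝 (phi b)) :=
  ((psi_cont.tendsto b).comp h).inv₀ (psi_pos hb).ne'

section
variable {X : KSp M}

lemma bil {a b : X.Ω → ℝ} (ha : Measurable a) {A : ℝ} (hA : ∀ x, |a x| ≤ A) (hb : UF X b) :
    Integrable (fun q : X.Ω × X.Ω => X.K q.1 q.2 * (a q.1 * b q.2)) (X.μ.prod X.μ) ∧
    ∫ q : X.Ω × X.Ω, X.K q.1 q.2 * (a q.1 * b q.2) ∂(X.μ.prod X.μ) = ∫ x, a x * TT X b x ∂X.μ := by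
  have hi : Integrable (fun q : X.Ω × X.Ω => X.K q.1 q.2 * (a q.1 * b q.2)) (X.μ.prod X.μ) := by
    refine Integrable.of_bound (C := M * (A * 1)) ?_ (Eventually.of_forall fun q => ?_)
    · exact ((X.meas : Measurable (fun q : X.Ω × X.Ω => X.K q.1 q.2)).mul
        ((ha.comp measurable_fst).mul (hb.1.comp measurable_snd))).aestronglyMeasurable
    · rw [norm_mul, norm_mul, Real.norm_of_nonneg (X.nonneg _ _), Real.norm_of_nonneg (hb.2 _).1]
      have h1 := hA q.1
      have h2 := (abs_nonneg _).trans h1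
      exact mul_le_mul (X.le _ _) (mul_le_mul h1 (hb.2 _).2 (hb.2 _).1 h2)
        (mul_nonneg (norm_nonneg _) (hb.2 _).1) X.Mnn
  refine ⟨hi, ?_⟩
  rw [integral_prod _ hi]
  congr 1; funext x
  unfold TT
  rw [← integral_const_mul]
  congr 1; funext y; ring

lemma picone {ρ g : X.Ω → ℝ} (hρ : UF X ρ) (hg : UF X g) {κ : ℝ} (hκ : 0 < κ)
    (h : ∀ x, κ * ρ x ≤ g x) :
    ∫ x, ρ x * TT X ρ x ∂X.μ ≤ ∫ x, ρ x ^ 2 / g x * TT X g x ∂X.μ := by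
  have hA : ∀ x, |ρ x ^ 2 / g x| ≤ 1 / κ := by
    intro x
    have h1 := hρ.2 x; have h2 := hg.2 x; have h3 := h x
    rw [abs_of_nonneg (div_nonneg (sq_nonneg _) h2.1)]
    rcases h2.1.eq_or_lt with h0 | h0
    · rw [← h0, div_zero]; positivity
    · rw [div_le_div_iff₀ h0 hκ]
      nlinarith [h1.1, h1.2]
  obtain ⟨i1, e1⟩ := bil hρ.1 (A := 1) (fun x => by
    rw [abs_of_nonneg (hρ.2 x).1]; exact (hρ.2 x).2) hρ
  obtain ⟨i2, e2⟩ := bil (a := fun x => ρ x ^ 2 / g x) ((hρ.1.pow_const 2).div hg.1) hA hg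
  rw [← e1, ← e2]
  have e3 := integral_prod_swap (μ := X.μ) (ν := X.μ)
    (fun q : X.Ω × X.Ω => X.K q.1 q.2 * (ρ q.1 ^ 2 / g q.1 * g q.2))
  have i3 : Integrable (fun q : X.Ω × X.Ω =>
    X.K q.swap.1 q.swap.2 * (ρ q.swap.1 ^ 2 / g q.swap.1 * g q.swap.2)) (X.μ.prod X.μ) := i2.swap
  have : ∫ q : X.Ω × X.Ω, X.K q.1 q.2 * (ρ q.1 * ρ q.2) ∂(X.μ.prod X.μ) ≤
      ∫ q : X.Ω × X.Ω, (X.K q.1 q.2 * (ρ q.1 ^ 2 / g q.1 * g q.2) +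
        X.K q.swap.1 q.swap.2 * (ρ q.swap.1 ^ 2 / g q.swap.1 * g q.swap.2)) / 2 ∂(X.μ.prod X.μ) := by
    refine integral_mono i1 ((i2.add i3).div_const 2) fun q => ?_
    obtain ⟨x, y⟩ := q
    simp only [Prod.swap]
    rw [X.symm y x, ← mul_add, mul_div_assoc]
    refine mul_le_mul_of_nonneg_left ?_ (X.nonneg _ _)
    have hx := hg.2 x; have hy := hg.2 y
    have z : ∀ x, 0 = g x → ρ x = 0 := fun x h0 => by
      have h1 := h x
      rw [← h0] at h1
      have h2 := (hρ.2 x).1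
      nlinarith
    rcases hx.1.eq_or_lt with h0 | h0
    · rw [z x h0, ← h0]; simp
    rcases hy.1.eq_or_lt with h0' | h0'
    · rw [z y h0', ← h0']; simp
    have : (ρ x ^ 2 / g x * g y + ρ y ^ 2 / g y * g x) / 2 - ρ x * ρ y
        = (ρ x * g y - ρ y * g x) ^ 2 / (2 * g x * g y) := by
      field_simp; ring
    have h4 : 0 ≤ (ρ x * g y - ρ y * g x) ^ 2 / (2 * g x * g y) := by positivity
    linarith
  rw [integral_div, integral_add i2 i3, e3] at this
  linarith

lemma GG_ge {t c : ℝ} (ht : 0 < t) (htc : t ≤ c) (r : ℕ) (x : X.Ω) :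
    (t / c) ^ r * SS X c x ≤ GG X t r x := by
  have hc : 0 < c := ht.trans_le htc
  have hS := SS_UF (X := X) hc.le
  have hq : 0 < t / c := div_pos ht hc
  have hq1 : t / c ≤ 1 := (div_le_one hc).2 htc
  induction r generalizing x with
  | zero => simpa [GG] using (hS.2 x).2
  | succ r ih =>
    have h1 : TT X (fun u => (t / c) ^ r * SS X c u) x ≤ TT X (GG X t r) x := by
      refine TT_mono ⟨hS.1.const_mul _, fun u => ⟨mul_nonneg (by positivity) (hS.2 u).1, ?_⟩⟩
        (GG_UF ht.le r) (Eventually.of_forall ih) x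
      exact mul_le_one₀ (pow_le_one₀ hq.le hq1) (hS.2 u).1 (hS.2 u).2
    have h2 : TT X (fun u => (t / c) ^ r * SS X c u) x = (t / c) ^ r * TT X (SS X c) x := by
      unfold TT
      rw [← integral_const_mul]; congr 1; funext u; ring
    rw [h2] at h1
    set q := (t / c) ^ (r + 1) with hqd
    have hqp : 0 ≤ q := by positivity
    have hqq : q ≤ 1 := pow_le_one₀ hq.le hq1
    have h3 : q * (c * TT X (SS X c) x) ≤ t * TT X (GG X t r) x := by
      have : q * (c * TT X (SS X c) x) = t * ((t / c) ^ r * TT X (SS X c) x) := by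
        rw [hqd, pow_succ]; field_simp
      rw [this]; exact mul_le_mul_of_nonneg_left h1 ht.le
    have h4 := convexOn_exp.2 (Set.mem_univ (-(c * TT X (SS X c) x))) (Set.mem_univ 0) hqp
      (sub_nonneg.2 hqq) (by ring)
    simp only [smul_eq_mul, mul_zero, add_zero, Real.exp_zero, mul_one] at h4
    have h5 : Real.exp (-(t * TT X (GG X t r) x)) ≤ Real.exp (q * -(c * TT X (SS X c) x)) :=
      Real.exp_le_exp.2 (by linarith)
    rw [SS_fix hc.le]
    show _ ≤ 1 - _
    linarith

lemma int_phi {ρ f : X.Ω → ℝ} (hρ : UF X ρ) (hf : UF X f) {t : ℝ} (ht : 0 ≤ t) :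
    Integrable (fun x => ρ x ^ 2 * phi (t * TT X f x)) X.μ := by
  refine Integrable.of_bound (C := 1 * phi (t * M)) ?_ (Eventually.of_forall fun x => ?_)
  · exact ((hρ.1.pow_const 2).mul (phi_meas.comp ((TT_meas hf.1).const_mul t))).aestronglyMeasurable
  · have h0 := mul_nonneg ht (TT_nn hf x)
    rw [norm_mul, Real.norm_of_nonneg (sq_nonneg _), Real.norm_of_nonneg (phi_pos h0).le]
    exact mul_le_mul (pow_le_one₀ (hρ.2 x).1 (hρ.2 x).2)
      (phi_le h0 (mul_le_mul_of_nonneg_left (TT_le hf x) ht)) (phi_pos h0).le one_pos.le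

lemma phi_step {t c : ℝ} (ht : 0 < t) (htc : t ≤ c) :
    ∫ x, SS X c x ^ 2 * phi (c * TT X (SS X c) x) ∂X.μ ≤
      c / t * ∫ x, SS X c x ^ 2 * phi (t * TT X (SS X t) x) ∂X.μ := by
  have hc : 0 < c := ht.trans_le htc
  have hS := SS_UF (X := X) hc.le
  have key : ∀ r, ∫ x, SS X c x ^ 2 * phi (c * TT X (SS X c) x) ∂X.μ ≤
      c / t * ∫ x, SS X c x ^ 2 * phi (t * TT X (GG X t r) x) ∂X.μ := by
    intro r
    have hG := GG_UF (X := X) ht.le r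
    have h1 := picone hS hG (pow_pos (div_pos ht hc) r) (GG_ge ht htc r)
    have h2 : ∫ x, SS X c x ^ 2 * phi (c * TT X (SS X c) x) ∂X.μ
        = c * ∫ x, SS X c x * TT X (SS X c) x ∂X.μ := by
      rw [← integral_const_mul]
      congr 1; funext x
      have := phi_ev (mul_nonneg hc.le (TT_nn hS x))
      rw [← SS_fix hc.le] at this
      calc _ = SS X c x * (SS X c x * phi (c * TT X (SS X c) x)) := by ring
        _ = _ := by rw [this]; ring
    rw [h2, div_eq_mul_inv, mul_assoc]
    refine mul_le_mul_of_nonneg_left (h1.trans ?_) hc.le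
    rw [← integral_const_mul]
    refine integral_mono_of_nonneg (Eventually.of_forall fun x => ?_)
      ((int_phi hS hG ht.le).const_mul _) (Eventually.of_forall fun x => ?_)
    · exact mul_nonneg (div_nonneg (sq_nonneg _) (hG.2 x).1) (TT_nn hG x)
    · have h0 := mul_nonneg ht.le (TT_nn hG x)
      have hp := phi_pos h0
      show SS X c x ^ 2 / GG X t r x * TT X (GG X t r) x ≤ t⁻¹ * (SS X c x ^ 2 * phi (t * TT X (GG X t r) x))
      rcases (hG.2 x).1.eq_or_lt with hz | hz
      · rw [← hz]; simp; positivity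
      · have h3 := phi_ev h0
        have h4 : 1 - Real.exp (-(t * TT X (GG X t r) x)) ≤ GG X t r x := GG_anti ht.le x (Nat.le_succ r)
        have h5 := mul_le_mul_of_nonneg_right h4 hp.le
        rw [h3] at h5
        have h6 : TT X (GG X t r) x ≤ t⁻¹ * (GG X t r x * phi (t * TT X (GG X t r) x)) := by
          rw [le_inv_mul_iff₀ ht]; exact h5
        calc _ ≤ SS X c x ^ 2 / GG X t r x * (t⁻¹ * (GG X t r x * phi (t * TT X (GG X t r) x))) :=
              mul_le_mul_of_nonneg_left h6 (by positivity)
          _ = _ := by field_simp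
  suffices hlim : Tendsto (fun r => ∫ x, SS X c x ^ 2 * phi (t * TT X (GG X t r) x) ∂X.μ) atTop
      (𝓝 (∫ x, SS X c x ^ 2 * phi (t * TT X (SS X t) x) ∂X.μ)) from
    ge_of_tendsto' (hlim.const_mul (c / t)) key
  refine tendsto_integral_of_dominated_convergence (fun _ => 1 * phi (t * M))
    (fun r => (int_phi hS (GG_UF ht.le r) ht.le).aestronglyMeasurable) (integrable_const _)
    (fun r => Eventually.of_forall fun x => ?_) (Eventually.of_forall fun x => ?_)
  · have hf := GG_UF (X := X) ht.le r
    have h0 := mul_nonneg ht.le (TT_nn hf x)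
    rw [norm_mul, Real.norm_of_nonneg (sq_nonneg _), Real.norm_of_nonneg (phi_pos h0).le]
    exact mul_le_mul (pow_le_one₀ (hS.2 x).1 (hS.2 x).2)
      (phi_le h0 (mul_le_mul_of_nonneg_left (TT_le hf x) ht.le)) (phi_pos h0).le one_pos.le
  · exact (phi_lim (mul_nonneg ht.le (TT_nn (SS_UF ht.le) x))
      ((TT_lim (GG_UF ht.le) (SS_lim ht.le) x).const_mul t)).const_mul _

lemma left_cont {c : ℝ} (hc : 0 < c) {ε : ℝ} (hε : 0 < ε) :
    ∃ t, 0 < t ∧ t < c ∧ ∫ x, SS X c x ∂X.μ - ε ≤ ∫ x, SS X t x ∂X.μ := by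
  set t : ℕ → ℝ := fun j => c * (1 - 1 / ((j:ℝ) + 2)) with htd
  have tb : ∀ j : ℕ, 0 < 1 / ((j:ℝ) + 2) ∧ 1 / ((j:ℝ) + 2) < 1 := fun j =>
    ⟨by positivity, by rw [div_lt_one (by positivity)]; linarith [(Nat.cast_nonneg j : (0:ℝ) ≤ j)]⟩
  have t0 : ∀ j, 0 < t j := fun j => mul_pos hc (by linarith [(tb j).2])
  have t1 : ∀ j, t j < c := fun j => by
    have := mul_pos hc (tb j).1
    simp only [htd]; linarith
  have tm : Monotone t := fun i j hij => by
    refine mul_le_mul_of_nonneg_left ?_ hc.le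
    have : 1 / ((j:ℝ) + 2) ≤ 1 / ((i:ℝ) + 2) :=
      one_div_le_one_div_of_le (by positivity) (by have : (i:ℝ) ≤ j := by exact_mod_cast hij
                                                   linarith)
    linarith
  have tl : Tendsto t atTop (𝓝 c) := by
    have h : Tendsto (fun j : ℕ => 1 / ((j:ℝ) + 2)) atTop (𝓝 0) := by
      have := (tendsto_const_div_atTop_nhds_zero_nat (1:ℝ)).comp (tendsto_add_atTop_nat 2)
      refine this.congr fun j => ?_
      simp
    have := (h.const_sub 1).const_mul c
    simpa [htd] using this
  set ρ := SS X c
  have hρ : UF X ρ := SS_UF hc.le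
  have hU : ∀ j, UF X (SS X (t j)) := fun j => SS_UF (t0 j).le
  set σ : X.Ω → ℝ := fun x => ⨆ j, SS X (t j) x
  have bdd : ∀ x, BddAbove (Set.range fun j => SS X (t j) x) := fun x =>
    ⟨1, by rintro _ ⟨j, rfl⟩; exact ((hU j).2 x).2⟩
  have hl : ∀ x, Tendsto (fun j => SS X (t j) x) atTop (𝓝 (σ x)) := fun x =>
    tendsto_atTop_ciSup (fun i j hij => SS_mono (t0 i).le (tm hij) x) (bdd x)
  have hσ : UF X σ := UF_lim hU hl
  have hle : ∀ j x, SS X (t j) x ≤ σ x := fun j x => le_ciSup (bdd x) j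
  have hσρ : ∀ x, σ x ≤ ρ x := fun x => ciSup_le fun j => SS_mono (t0 j).le (t1 j).le x
  have hfix : ∀ x, σ x = 1 - Real.exp (-(c * TT X σ x)) := by
    intro x
    refine tendsto_nhds_unique (hl x) ?_
    have h1 := (tl.mul (TT_lim hU hl x)).neg
    have h2 := ((Real.continuous_exp.tendsto _).comp h1).const_sub 1
    exact h2.congr fun j => (SS_fix (t0 j).le x).symm
  have hTm : ∀ x, TT X σ x ≤ TT X ρ x := TT_mono hσ hρ (Eventually.of_forall hσρ)
  have h1 : ∫ x, ρ x ^ 2 * phi (c * TT X ρ x) ∂X.μ ≤ ∫ x, ρ x ^ 2 * phi (c * TT X σ x) ∂X.μ := by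
    have : ∀ j, ∫ x, ρ x ^ 2 * phi (c * TT X ρ x) ∂X.μ ≤
        c / t j * ∫ x, ρ x ^ 2 * phi (c * TT X σ x) ∂X.μ := by
      intro j
      refine (phi_step (t0 j) (t1 j).le).trans ?_
      refine mul_le_mul_of_nonneg_left ?_ (div_nonneg hc.le (t0 j).le)
      refine integral_mono (int_phi hρ (hU j) (t0 j).le) (int_phi hρ hσ hc.le) fun x => ?_
      refine mul_le_mul_of_nonneg_left ?_ (sq_nonneg _)
      refine phi_le (mul_nonneg (t0 j).le (TT_nn (hU j) x)) ?_
      exact mul_le_mul (t1 j).le (TT_mono (hU j) hσ (Eventually.of_forall (hle j)) x)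
        (TT_nn (hU j) x) hc.le
    have hlim : Tendsto (fun j => c / t j * ∫ x, ρ x ^ 2 * phi (c * TT X σ x) ∂X.μ) atTop
        (𝓝 (c / c * ∫ x, ρ x ^ 2 * phi (c * TT X σ x) ∂X.μ)) :=
      (tendsto_const_nhds.div tl hc.ne').mul_const _
    rw [div_self hc.ne', one_mul] at hlim
    exact ge_of_tendsto' hlim this
  have hpt : ∀ x, ρ x ^ 2 * phi (c * TT X σ x) ≤ ρ x ^ 2 * phi (c * TT X ρ x) := fun x =>
    mul_le_mul_of_nonneg_left (phi_le (mul_nonneg hc.le (TT_nn hσ x))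
      (mul_le_mul_of_nonneg_left (hTm x) hc.le)) (sq_nonneg _)
  have hae : ∀ᵐ x ∂X.μ, ρ x ^ 2 * phi (c * TT X σ x) = ρ x ^ 2 * phi (c * TT X ρ x) := by
    have i1 := int_phi hρ hσ hc.le
    have i2 := int_phi hρ hρ hc.le
    exact (integral_eq_iff_of_ae_le i1 i2 (Eventually.of_forall hpt)).1
      (le_antisymm (integral_mono i1 i2 hpt) h1)
  have heq : ∀ᵐ x ∂X.μ, σ x = ρ x := by
    filter_upwards [hae] with x hx
    rcases (hρ.2 x).1.eq_or_lt with h0 | h0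
    · exact le_antisymm (hσρ x) (by rw [← h0]; exact (hσ.2 x).1)
    · have h2 := mul_left_cancel₀ (pow_pos h0 2).ne' hx
      have h3 := phi_inj (mul_nonneg hc.le (TT_nn hσ x)) (mul_le_mul_of_nonneg_left (hTm x) hc.le) h2
      rw [hfix, h3]; exact (SS_fix hc.le x).symm
  have hint : Tendsto (fun j => ∫ x, SS X (t j) x ∂X.μ) atTop (𝓝 (∫ x, ρ x ∂X.μ)) := by
    rw [← integral_congr_ae heq]; exact int_lim hU hl
  obtain ⟨j, hj⟩ := (hint.eventually (lt_mem_nhds (a := ∫ x, ρ x ∂X.μ - ε) (by linarith))).exists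
  exact ⟨t j, t0 j, t1 j, hj.le⟩

end

end Percolation

namespace Percolation
set_option linter.all false
variable {M : ℝ}

structure Irr (X : KSp M) : Prop where
  h1 : ∀ A : Set X.Ω, MeasurableSet A → (∀ x ∈ A, ∀ᵐ u ∂X.μ, u ∉ A → X.K x u = 0) →
    X.μ A = 0 ∨ X.μ Aᶜ = 0
  h2 : ¬ ∀ᵐ x ∂X.μ, ∀ᵐ u ∂X.μ, X.K x u = 0

lemma TT_one_zero {X : KSp M} {x : X.Ω} (h : TT X (fun _ => 1) x = 0) : ∀ᵐ u ∂X.μ, X.K x u = 0 := by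
  have hU : UF X (fun _ => 1) := ⟨measurable_const, fun x => by norm_num⟩
  have := (integral_eq_zero_iff_of_nonneg (fun u => mul_nonneg (X.nonneg x u) one_pos.le)
    (hU.intK x)).1 h
  filter_upwards [this] with u hu
  simpa using hu

lemma Dat.irr (D : Dat M) (h : Percolation.Irreducible D.W) : Irr D.XW := by
  have h1 : ∀ A : Set ℝ, MeasurableSet A → (∀ x ∈ A, ∀ᵐ u ∂(volume.restrict I01), u ∉ A → D.W x u = 0) →
    (volume.restrict I01) A = 0 ∨ (volume.restrict I01) Aᶜ = 0 := by
    intro A hA hz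
    by_contra hcon
    push Not at hcon
    have hI : MeasurableSet I01 := measurableSet_Icc
    haveI : IsProbabilityMeasure (volume.restrict I01) := ⟨by simp [I01]⟩
    apply h
    refine ⟨A ∩ I01, hA.inter hI, Set.inter_subset_right, ?_, ?_, ?_⟩
    · have := hcon.1
      rw [Measure.restrict_apply hA] at this
      exact pos_iff_ne_zero.2 this
    · rw [← Measure.restrict_apply hA]
      refine lt_of_le_of_ne prob_le_one fun h1 => hcon.2 ?_
      exact (prob_compl_eq_zero_iff hA).2 h1
    · have hm : MeasurableSet {p : ℝ × ℝ | p.1 ∈ A ∩ I01 → p.2 ∈ I01 \ (A ∩ I01) → D.W p.1 p.2 = 0} := by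
        refine MeasurableSet.imp (measurable_fst (hA.inter hI)) (MeasurableSet.imp
          (measurable_snd (hI.diff (hA.inter hI))) ?_)
        exact D.Wm (measurableSet_singleton 0)
      refine (Measure.ae_prod_iff_ae_ae hm).2 (Eventually.of_forall fun x => ?_)
      by_cases hx : x ∈ A ∩ I01
      · have := hz x hx.1
        rw [ae_restrict_iff' hI] at this
        filter_upwards [this] with u hu _ hu2
        exact hu hu2.1 fun h => hu2.2 ⟨h, hu2.1⟩
      · exact Eventually.of_forall fun u hx' => absurd hx' hx
  refine ⟨h1, fun hz => ?_⟩
  have hd : Measurable (TT D.XW fun _ => 1) := TT_meas measurable_const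
  set A : Set ℝ := {x | TT D.XW (fun _ => 1) x = 0} ∩ Set.Iic (1/2)
  have hA : MeasurableSet A := MeasurableSet.inter (hd (measurableSet_singleton 0)) measurableSet_Iic
  have hful : ∀ᵐ x ∂(volume.restrict I01), TT D.XW (fun _ => 1) x = 0 := by
    filter_upwards [hz] with x hx
    refine integral_eq_zero_of_ae ?_
    filter_upwards [hx] with u hu
    simpa using hu
  have e1 : (volume.restrict I01) A = (volume.restrict I01) (Set.Iic (1/2)) := by
    refine measure_congr ?_
    filter_upwards [hful] with x hx
    exact propext ⟨fun h => h.2, fun h => ⟨hx, h⟩⟩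
  have e2 : (volume.restrict I01) Aᶜ = (volume.restrict I01) (Set.Ioi (1/2)) := by
    refine measure_congr ?_
    filter_upwards [hful] with x hx
    refine propext ⟨fun h => ?_, fun h h' => ?_⟩
    · by_contra h'
      exact h ⟨hx, not_lt.1 h'⟩
    · exact absurd h'.2 (not_le.2 h)
  have i1 : (Set.Iic (1/2 : ℝ)) ∩ I01 = Set.Icc 0 (1/2) := by
    ext x; simp only [I01, Set.mem_inter_iff, Set.mem_Iic, Set.mem_Icc]
    constructor
    · rintro ⟨a, b, c⟩; exact ⟨b, a⟩
    · rintro ⟨a, b⟩; exact ⟨b, a, by linarith⟩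
  have i2 : (Set.Ioi (1/2 : ℝ)) ∩ I01 = Set.Ioc (1/2) 1 := by
    ext x; simp only [I01, Set.mem_inter_iff, Set.mem_Ioi, Set.mem_Icc, Set.mem_Ioc]
    constructor
    · rintro ⟨a, b, c⟩; exact ⟨a, c⟩
    · rintro ⟨a, b⟩; exact ⟨a, by linarith, b⟩
  rw [Measure.restrict_apply measurableSet_Iic, i1, Real.volume_Icc] at e1
  rw [Measure.restrict_apply measurableSet_Ioi, i2, Real.volume_Ioc] at e2
  rcases h1 A hA (fun x hx => (TT_one_zero hx.1).mono fun u hu _ => hu) with h0 | h0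
  · rw [h0] at e1; norm_num at e1
  · rw [h0] at e2; norm_num at e2

def ww : ℕ → Obs M
  | 0 => app (fun X x y => X.K x y)
  | j + 1 => app (ww j)

lemma ww_good (j : ℕ) : Good (ww j : Obs M) := by
  induction j with
  | zero => exact Good.of_RG two_RG
  | succ j ih => exact ih.app

lemma K_BM : BM (fun X x y => X.K x y : Obs M) :=
  ⟨fun X => X.meas, M, fun X x y => by rw [abs_of_nonneg (X.nonneg _ _)]; exact X.le _ _⟩

lemma ww_bd (j : ℕ) (X : KSp M) (x y : X.Ω) : 0 ≤ ww j X x y ∧ ww j X x y ≤ M ^ (j + 2) := by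
  have key : ∀ (H : Obs M) (B : ℝ), BM H → (∀ x y, 0 ≤ H X x y ∧ H X x y ≤ B) →
      ∀ x y, 0 ≤ app H X x y ∧ app H X x y ≤ M * B := by
    intro H B hH hB x y
    refine ⟨integral_nonneg fun u => mul_nonneg (X.nonneg _ _) (hB _ _).1, ?_⟩
    have : app H X x y ≤ ∫ u, M * B ∂X.μ := integral_mono (hH.sec X x y) (integrable_const _) fun u =>
      mul_le_mul (X.le _ _) (hB _ _).2 (hB _ _).1 X.Mnn
    simpa using this
  induction j generalizing x y with
  | zero =>
    have := key _ M K_BM (fun x y => ⟨X.nonneg x y, X.le x y⟩) x y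
    rw [← sq] at this; exact this
  | succ j ih =>
    have := key _ _ (ww_good j).bm ih x y
    rw [← pow_succ'] at this; exact this

lemma irr_pos {X : KSp M} (h : Irr X) : ∀ᵐ q ∂(X.μ.prod X.μ), ∃ j, 0 < ww j X q.1 q.2 := by
  have hU : UF X (fun _ => 1) := ⟨measurable_const, fun x => by norm_num⟩
  have hd : Measurable (TT X fun _ => 1) := TT_meas measurable_const
  have hdpos : ∀ᵐ y ∂X.μ, TT X (fun _ => 1) y ≠ 0 := by
    rcases h.h1 {x | TT X (fun _ => 1) x = 0} (hd (measurableSet_singleton 0))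
      (fun x hx => (TT_one_zero hx).mono fun u hu _ => hu) with h0 | h0
    · rw [ae_iff]; simpa using h0
    · exact absurd (Filter.Eventually.mono (p := fun x => TT X (fun _ => 1) x = 0) (f := ae X.μ) h0
        fun x hx => TT_one_zero hx) h.h2
  have hm : MeasurableSet {q : X.Ω × X.Ω | ∃ j, 0 < ww j X q.1 q.2} := by
    rw [Set.setOf_exists]
    exact MeasurableSet.iUnion fun j => ((ww_good j).1 X) measurableSet_Ioi
  refine (Measure.ae_prod_iff_ae_ae hm).2 ?_
  refine (Measure.ae_ae_comm (p := fun x y => ∃ j, 0 < ww j X x y) hm).2 ?_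
  filter_upwards [hdpos] with y hy
  set B : Set X.Ω := {x | ¬ ∃ j, 0 < ww j X x y}
  have hB : MeasurableSet B :=
    ((measurable_id.prodMk measurable_const : Measurable fun x : X.Ω => (x, y)) hm).compl
  have zero : ∀ x ∈ B, ∀ j, ww j X x y = 0 := fun x hx j =>
    le_antisymm (not_lt.1 fun h => hx ⟨j, h⟩) (ww_bd j X x y).1
  have hBz : ∀ x ∈ B, ∀ᵐ u ∂X.μ, u ∉ B → X.K x u = 0 := by
    intro x hx
    have : ∀ j, ∀ᵐ u ∂X.μ, X.K x u * ww j X u y = 0 := fun j =>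
      (integral_eq_zero_iff_of_nonneg (fun u => mul_nonneg (X.nonneg x u) (ww_bd j X u y).1)
        ((ww_good j).bm.sec X x y)).1 (zero x hx (j + 1))
    filter_upwards [ae_all_iff.2 this] with u hu huB
    obtain ⟨j, hj⟩ := not_not.1 huB
    exact (mul_eq_zero.1 (hu j)).resolve_right hj.ne'
  rcases h.h1 B hB hBz with h0 | h0
  · rw [ae_iff]; exact h0
  · exfalso
    have a1 : ∀ᵐ x ∂X.μ, ∀ᵐ u ∂X.μ, X.K x u * X.K u y = 0 := by
      filter_upwards [(h0 : ∀ᵐ x ∂X.μ, x ∈ B)] with x hx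
      exact (integral_eq_zero_iff_of_nonneg (fun u => mul_nonneg (X.nonneg x u) (X.nonneg u y))
        (K_BM.sec X x y)).1 (zero x hx 0)
    have mm : MeasurableSet {q : X.Ω × X.Ω | X.K q.1 q.2 * X.K q.2 y = 0} := by
      have : Measurable fun q : X.Ω × X.Ω => X.K q.1 q.2 * X.K q.2 y :=
        (X.meas : Measurable fun q : X.Ω × X.Ω => X.K q.1 q.2).mul
          (Measurable.comp (g := Function.uncurry X.K) X.meas (measurable_snd.prodMk measurable_const))
      exact this (measurableSet_singleton 0)
    rw [Measure.ae_ae_comm (p := fun x u => X.K x u * X.K u y = 0) mm] at a1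
    apply hy
    refine integral_eq_zero_of_ae ?_
    filter_upwards [a1, hdpos] with u hu hdu
    show X.K y u * 1 = 0
    by_contra hne
    apply hdu
    refine integral_eq_zero_of_ae ?_
    filter_upwards [hu] with x hx
    rw [mul_one, X.symm] at hne
    have := (mul_eq_zero.1 hx).resolve_right hne
    rw [X.symm] at this
    simpa using this

def zz (m : ℕ) : Obs M := fun X x y =>
  (∏ j ∈ Finset.range m, (1 + (-(M ^ (j + 2))⁻¹) * ww j X x y)) ^ m

lemma zz_good (m : ℕ) : Good (zz m : Obs M) := by
  unfold zz
  exact (Good.prod (H := fun j X x y => 1 + (-(M ^ (j + 2))⁻¹) * ww j X x y)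
    (fun j => (Good.const 1).add ((ww_good j).smul _)) m).pow m

lemma zf (hM : 1 ≤ M) (j : ℕ) (X : KSp M) (x y : X.Ω) : 0 ≤ 1 + (-(M ^ (j + 2))⁻¹) * ww j X x y ∧
    1 + (-(M ^ (j + 2))⁻¹) * ww j X x y ≤ 1 := by
  have h1 := ww_bd j X x y
  have hp : 0 < M ^ (j + 2) := by positivity
  have h2 : (M ^ (j + 2))⁻¹ * ww j X x y ≤ 1 := by rw [inv_mul_le_iff₀ hp]; linarith
  have h3 : 0 ≤ (M ^ (j + 2))⁻¹ * ww j X x y := mul_nonneg (by positivity) h1.1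
  constructor <;> linarith

lemma zp (hM : 1 ≤ M) (m : ℕ) (X : KSp M) (x y : X.Ω) :
    0 ≤ ∏ j ∈ Finset.range m, (1 + (-(M ^ (j + 2))⁻¹) * ww j X x y) ∧
    ∏ j ∈ Finset.range m, (1 + (-(M ^ (j + 2))⁻¹) * ww j X x y) ≤ 1 :=
  ⟨Finset.prod_nonneg fun j _ => (zf hM j X x y).1,
    Finset.prod_le_one (fun j _ => (zf hM j X x y).1) fun j _ => (zf hM j X x y).2⟩

lemma zz_bd (hM : 1 ≤ M) (m : ℕ) (X : KSp M) (x y : X.Ω) : 0 ≤ zz m X x y ∧ zz m X x y ≤ 1 :=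
  ⟨pow_nonneg (zp hM m X x y).1 m, pow_le_one₀ (zp hM m X x y).1 (zp hM m X x y).2⟩

lemma zz_cover (hM : 1 ≤ M) (m : ℕ) (X : KSp M) (x y : X.Ω) :
    1 ≤ m * ∑ j ∈ Finset.range m, ww j X x y + zz m X x y := by
  have h1 : 1 - ∑ j ∈ Finset.range m, ww j X x y ≤
      ∏ j ∈ Finset.range m, (1 + (-(M ^ (j + 2))⁻¹) * ww j X x y) := by
    induction m with
    | zero => simp
    | succ m ih =>
      rw [Finset.sum_range_succ, Finset.prod_range_succ]
      have h2 := zp hM m X x y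
      have h3 := ww_bd m X x y
      have h4 : (M ^ (m + 2))⁻¹ ≤ 1 := inv_le_one_of_one_le₀ (one_le_pow₀ hM)
      have h5 : (M ^ (m + 2))⁻¹ * ww m X x y ≤ ww m X x y := by nlinarith [h3.1]
      have h6 : 0 ≤ (M ^ (m + 2))⁻¹ * ww m X x y := mul_nonneg (by positivity) h3.1
      have h7 := mul_le_mul_of_nonneg_right h2.2 h6
      linarith
  have h2 := zp hM m X x y
  have h3 := one_add_mul_le_pow (a := ∏ j ∈ Finset.range m, (1 + (-(M ^ (j + 2))⁻¹) * ww j X x y) - 1)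
    (by linarith) m
  rw [add_sub_cancel] at h3
  have h4 := mul_le_mul_of_nonneg_left h1 (Nat.cast_nonneg (α := ℝ) m)
  unfold zz
  linarith

lemma zz_lim (hM : 1 ≤ M) {X : KSp M} (h : Irr X) : Tendsto (fun m => II (zz m) X) atTop (𝓝 0) := by
  have : Tendsto (fun m => II (zz m) X) atTop (𝓝 (∫ q : X.Ω × X.Ω, (0:ℝ) ∂(X.μ.prod X.μ))) := by
    refine tendsto_integral_of_dominated_convergence (fun _ => 1)
      (fun m => ((zz_good m).bm.int X).aestronglyMeasurable) (integrable_const _)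
      (fun m => Eventually.of_forall fun q => ?_) ?_
    · rw [Real.norm_of_nonneg (zz_bd hM m X _ _).1]; exact (zz_bd hM m X _ _).2
    · filter_upwards [irr_pos h] with q hq
      obtain ⟨j, hj⟩ := hq
      set a := 1 + (-(M ^ (j + 2))⁻¹) * ww j X q.1 q.2 with ha
      have h0 := zf hM j X q.1 q.2
      have h1 : a < 1 := by
        have : 0 < (M ^ (j + 2))⁻¹ * ww j X q.1 q.2 := mul_pos (by positivity) hj
        rw [ha]; linarith
      refine tendsto_of_tendsto_of_tendsto_of_le_of_le' tendsto_const_nhds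
        (tendsto_pow_atTop_nhds_zero_of_lt_one h0.1 h1)
        (Eventually.of_forall fun m => (zz_bd hM m X _ _).1) ?_
      filter_upwards [eventually_gt_atTop j] with m hm
      refine pow_le_pow_left₀ (zp hM m X _ _).1 ?_ m
      rw [← Finset.mul_prod_erase _ _ (Finset.mem_range.2 hm)]
      refine mul_le_of_le_one_right h0.1 ?_
      exact Finset.prod_le_one (fun j _ => (zf hM j X _ _).1) fun j _ => (zf hM j X _ _).2
  simpa using this

end Percolation

namespace Percolation
set_option linter.all false
variable {M : ℝ}

lemma GG_good (t : ℝ) (r : ℕ) : Good (fun X x _ => GG X t r x : Obs M) := by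
  induction r with
  | zero => exact Good.const 1
  | succ r ih =>
    exact (ih.app).comp (φ := fun z => 1 - Real.exp (-(t * z))) (by fun_prop)

lemma II_fst (f : ∀ X : KSp M, X.Ω → ℝ) (X : KSp M) : II (fun X x _ => f X x) X = ∫ x, f X x ∂X.μ := by
  unfold II
  have := integral_fun_fst (μ := X.μ) (ν := X.μ) (f X)
  rw [this]; simp

namespace Dat
variable (D : Dat M)

def aw (n : ℕ) (e : Sym2 (Fin n)) : ℝ := sym2Val (D.β n) e / n

def pt (n : ℕ) (t : ℝ) (e : Sym2 (Fin n)) : ℝ := t * D.aw n e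

lemma aw_mk (n : ℕ) (u v : Fin n) : D.aw n s(u, v) = D.β n u v / n := by
  unfold aw
  rw [sym2Val_mk, D.bsym n v u]; ring

lemma aw_nn (n : ℕ) (e : Sym2 (Fin n)) : 0 ≤ D.aw n e := by
  induction e using Sym2.ind with
  | _ u v => rw [aw_mk]; exact div_nonneg (D.bnn _ _ _) (Nat.cast_nonneg _)

lemma pt_sp {n : ℕ} (hn : 0 < n) {t c : ℝ} (ht : 0 ≤ t) (htc : t ≤ c) (hc : c * M ≤ n) :
    Sp (c * M) (D.pt n t) := by
  have hn' : (0:ℝ) < n := by exact_mod_cast hn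
  have hM := D.M1
  refine ⟨fun e => mul_nonneg ht (D.aw_nn n e), fun e => ?_, fun v => ?_, by nlinarith, by simpa using hc, by simpa using hn⟩
  · induction e using Sym2.ind with
    | _ u v =>
      unfold pt
      rw [aw_mk, Fintype.card_fin, ← mul_div_assoc]
      gcongr
      · exact D.bnn _ _ _
      · linarith
      · exact D.bb _ _ _
  · unfold pt; rw [aw_mk, D.bdiag]; simp

lemma Fi_eq (n : ℕ) (hn : 0 < n) (t : ℝ) (r : ℕ) (v : Fin n) :
    Fi (D.pt n t) r v = GG (D.XN n hn) t r v := by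
  induction r generalizing v with
  | zero => rfl
  | succ r ih =>
    show 1 - Real.exp (-∑ w, D.pt n t s(v, w) * Fi (D.pt n t) r w) =
      1 - Real.exp (-(t * TT (D.XN n hn) (GG (D.XN n hn) t r) v))
    have h : TT (D.XN n hn) (GG (D.XN n hn) t r) v = (∑ w, D.β n v w * Fi (D.pt n t) r w) / n := by
      unfold TT
      refine (D.XN_int n hn _).trans ?_
      congr 1
      exact Finset.sum_congr rfl fun w _ => congrArg _ (ih w).symm
    rw [h, Finset.sum_div, Finset.mul_sum]
    congr 3
    refine Finset.sum_congr rfl fun w _ => ?_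
    unfold pt; rw [aw_mk]; ring

lemma Fi_conv (t : ℝ) (r : ℕ) {ε : ℝ} (hε : 0 < ε) : ∀ᶠ n : ℕ in atTop,
    |(∑ v, Fi (D.pt n t) r v) / n - ∫ x, GG D.XW t r x ∂D.XW.μ| ≤ ε := by
  filter_upwards [D.conv_good (GG_good t r) hε, eventually_gt_atTop 0] with n h hn
  have h := h hn
  rw [II_fst (fun X => GG X t r), II_fst (fun X => GG X t r)] at h
  rw [XN_int] at h
  have e : ∑ v, Fi (D.pt n t) r v = ∑ i : (D.XN n hn).Ω, GG (D.XN n hn) t r i :=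
    Finset.sum_congr rfl fun v _ => D.Fi_eq n hn t r v
  rw [e]; exact h

lemma ev_n (c : ℝ) : ∀ᶠ n : ℕ in atTop, 0 < n ∧ c * M ≤ n :=
  (eventually_gt_atTop 0).and (tendsto_natCast_atTop_atTop.eventually_ge_atTop _)

/-- mean fraction in large components -/
def mY (n : ℕ) (k : ℕ) (t : ℝ) : ℝ := (∑ v, th k (D.pt n t) v) / n

lemma mY_lower {t : ℝ} (ht : 0 ≤ t) (r : ℕ) {ε : ℝ} (hε : 0 < ε) : ∀ᶠ n : ℕ in atTop,
    ∫ x, SS D.XW t x ∂D.XW.μ - ε ≤ D.mY n (r + 1) t := by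
  have h3 : ∀ᶠ n : ℕ in atTop, eL (t * M) n r ≤ ε / 2 :=
    ((eL_tendsto (t * M) r).comp tendsto_natCast_atTop_atTop).eventually_le_const (by positivity)
  filter_upwards [D.Fi_conv t r (half_pos hε), ev_n (M := M) t, h3] with n h1 h2 h3
  have hs := D.pt_sp h2.1 ht le_rfl h2.2
  have hn' : (0:ℝ) < n := by exact_mod_cast h2.1
  have h4 : ∫ x, SS D.XW t x ∂D.XW.μ ≤ ∫ x, GG D.XW t r x ∂D.XW.μ :=
    integral_mono (SS_UF ht).int (GG_UF ht r).int fun x => SS_le ht r x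
  have h5 : (∑ v, Fi (D.pt n t) r v) / n ≤ D.mY n (r + 1) t + ε / 2 := by
    unfold mY
    rw [div_le_iff₀ hn', add_mul, div_mul_cancel₀ _ hn'.ne']
    calc ∑ v, Fi (D.pt n t) r v ≤ ∑ v : Fin n, (th (r + 1) (D.pt n t) v + ε / 2) := by
          refine Finset.sum_le_sum fun v _ => ?_
          have := th_lower _ r hs v
          rw [Fintype.card_fin] at this
          linarith
      _ = _ := by rw [Finset.sum_add_distrib]; simp; ring
  have := (abs_le.1 h1).1
  linarith

lemma mY_upper {c : ℝ} (hc : 0 ≤ c) {ε : ℝ} (hε : 0 < ε) : ∃ K0 : ℕ, ∀ k ≥ K0, ∀ᶠ n : ℕ in atTop,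
    D.mY n k c ≤ ∫ x, SS D.XW c x ∂D.XW.μ + ε := by
  have hl := int_lim (X := D.XW) (GG_UF hc) (SS_lim hc)
  obtain ⟨r, hr⟩ := (hl.eventually_le_const (u := ∫ x, SS D.XW c x ∂D.XW.μ + ε / 4) (by linarith)).exists
  obtain ⟨s, hs1, hs2⟩ := (((eUl_tendsto (c * M) r).eventually_le_const (u := ε / 4) (by positivity)).and
    (eventually_ge_atTop 1)).exists
  refine ⟨kk s r, fun k hk => ?_⟩
  have h3 : ∀ᶠ n : ℕ in atTop, eU (c * M) s n r ≤ ε / 2 :=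
    ((eU_tendsto (c * M) s r).comp tendsto_natCast_atTop_atTop).eventually_le_const (by linarith)
  filter_upwards [D.Fi_conv c r (ε := ε / 4) (by positivity), ev_n (M := M) c, h3] with n h1 h2 h3
  have hs := D.pt_sp h2.1 hc le_rfl h2.2
  have hn' : (0:ℝ) < n := by exact_mod_cast h2.1
  have h5 : D.mY n k c ≤ (∑ v, Fi (D.pt n c) r v) / n + ε / 2 := by
    unfold mY
    rw [div_le_iff₀ hn', add_mul, div_mul_cancel₀ _ hn'.ne']
    calc ∑ v, th k (D.pt n c) v ≤ ∑ v : Fin n, (Fi (D.pt n c) r v + ε / 2) := by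
          refine Finset.sum_le_sum fun v _ => ?_
          have h6 := th_upper _ s hs2 r hs v
          rw [Fintype.card_fin] at h6
          have := th_anti hs hk v
          linarith
      _ = _ := by rw [Finset.sum_add_distrib]; simp; ring
  have := (abs_le.1 h1).2
  linarith

end Dat
end Percolation

namespace Percolation
set_option linter.all false

section Leaf
variable {V : Type*} [Fintype V] [DecidableEq V]

def eb (k : ℕ) (p : Sym2 V → ℝ) (u w : V) : ℝ := Ex p (fun ω => bd k ω u w)

lemma bd_comm (k : ℕ) (ω : Cfg V) (u w : V) : bd k ω u w = bd k ω w u := by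
  unfold bd
  have : Bd k ω u w = Bd k ω w u := propext ⟨Bd.symm, Bd.symm⟩
  split_ifs <;> simp_all

def lf (k : ℕ) (u w : V) (ω : Cfg V) (v : V) : ℝ :=
  (if ω s(u, v) then 1 else 0) * bd k (del u ω) v w *
    ∏ x ∈ (Finset.univ.erase u).erase v, (1 - (if ω s(u, x) then 1 else 0) * 1)

lemma lf_prod (u : V) (ω : Cfg V) (J : Finset V) :
    0 ≤ ∏ x ∈ J, (1 - (if ω s(u, x) then (1:ℝ) else 0) * 1) ∧
    ∏ x ∈ J, (1 - (if ω s(u, x) then (1:ℝ) else 0) * 1) ≤ 1 :=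
  ⟨Finset.prod_nonneg fun x _ => by split_ifs <;> norm_num,
    Finset.prod_le_one (fun x _ => by split_ifs <;> norm_num) fun x _ => by split_ifs <;> norm_num⟩

lemma lf_bd (k : ℕ) (u w : V) (ω : Cfg V) (v : V) : 0 ≤ lf k u w ω v ∧ lf k u w ω v ≤ 1 := by
  have h := lf_prod u ω ((Finset.univ.erase u).erase v)
  have h0 := bd_nonneg k (del u ω) v w
  have h1 := bd_le_one k (del u ω) v w
  have h2 : 0 ≤ (if ω s(u, v) then (1:ℝ) else 0) ∧ (if ω s(u, v) then (1:ℝ) else 0) ≤ 1 := by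
    split_ifs <;> norm_num
  unfold lf
  exact ⟨mul_nonneg (mul_nonneg h2.1 h0) h.1,
    mul_le_one₀ (mul_le_one₀ h2.2 h0 h1) h.1 h.2⟩

lemma lf_nz {k : ℕ} {u w v : V} {ω : Cfg V} (h : lf k u w ω v ≠ 0) (hv : v ≠ u) :
    Aj ω u v ∧ (∀ x, Aj ω u x → x = v) ∧ Bd k (del u ω) v w := by
  unfold lf at h
  have h1 := left_ne_zero_of_mul (left_ne_zero_of_mul h)
  have h2 := right_ne_zero_of_mul (left_ne_zero_of_mul h)
  have h3 := right_ne_zero_of_mul h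
  refine ⟨⟨hv.symm, by by_contra hc; simp [hc] at h1⟩, fun x hx => ?_, by
    by_contra hc; simp [bd, hc] at h2⟩
  by_contra hc
  rw [Finset.prod_ne_zero_iff] at h3
  have := h3 x (by simp [hc, hx.1.symm])
  simp [hx.2] at this

lemma lf_sum {k : ℕ} {u w : V} (hw : w ≠ u) (ω : Cfg V) :
    ∑ v ∈ Finset.univ.erase u, lf k u w ω v ≤ bd k ω u w := by
  by_cases h : ∃ v, v ≠ u ∧ lf k u w ω v ≠ 0
  · obtain ⟨v, hv, hl⟩ := h
    obtain ⟨h1, h2, h3⟩ := lf_nz hl hv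
    rw [Finset.sum_eq_single_of_mem v (by simp [hv])]
    · have : bd k ω u w = 1 := by simp [bd, Bd_leaf hw h1 h2 h3]
      rw [this]; exact (lf_bd k u w ω v).2
    · intro x hx hxv
      by_contra hc
      exact hxv (h2 x (lf_nz hc (Finset.ne_of_mem_erase hx)).1)
  · push Not at h
    rw [Finset.sum_eq_zero fun v hv => h v (Finset.ne_of_mem_erase hv)]
    exact bd_nonneg _ _ _ _

lemma one_sub_exp {x : ℝ} (h0 : 0 ≤ x) (h1 : x ≤ 1 / 2) : Real.exp (-(2 * x)) ≤ 1 - x := by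
  rw [Real.exp_neg]
  have h := Real.add_one_le_exp (2 * x)
  have h2 := Real.exp_pos (2 * x)
  rw [inv_le_iff_one_le_mul₀ h2]
  nlinarith [mul_le_mul_of_nonneg_left h (by linarith : 0 ≤ 1 - x)]

lemma lf_Ex {C : ℝ} {p : Sym2 V → ℝ} (h : Sp C p) (hC : 2 * C ≤ Fintype.card V) (k : ℕ) {u v w : V}
    (hv : v ≠ u) : Real.exp (-(2 * C)) * (p s(u, v) * Ex p (fun ω => bd k (del u ω) v w))
      ≤ Ex p (fun ω => lf k u w ω v) := by
  have hn : (0:ℝ) < Fintype.card V := by exact_mod_cast h.hn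
  have hdel : ∀ x b (ω : Cfg V), del u (up s(u, x) b ω) = del u ω := by
    intro x b ω; rw [del_up, if_pos (by simp)]
  have hinj : ∀ a b : V, s(u, a) = s(u, b) → a = b := by
    intro a b hab
    rcases Sym2.eq_iff.1 hab with h | h
    · exact h.2
    · rw [h.2, ← h.1]
  unfold lf
  rw [Ex_prod_indep p _ (fun x => s(u, x)) (fun a _ b _ hab => hinj a b hab) (fun _ _ => 1)
    (fun ω => (if ω s(u, v) then (1:ℝ) else 0) * bd k (del u ω) v w) (fun _ _ _ _ _ _ => rfl) ?_]
  · have hq : Real.exp (-(2 * C)) ≤ ∏ x ∈ (Finset.univ.erase u).erase v, (1 - p s(u, x) * 1) := by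
      calc Real.exp (-(2 * C)) ≤ Real.exp (∑ x ∈ (Finset.univ.erase u).erase v, -(2 * p s(u, x))) := by
            apply Real.exp_le_exp.2
            rw [Finset.sum_neg_distrib, ← Finset.mul_sum]
            have := (Finset.sum_le_sum_of_subset_of_nonneg
              (Finset.subset_univ ((Finset.univ.erase u).erase v))
              (fun x _ _ => h.nonneg s(u, x))).trans (h.row_le u)
            linarith
        _ = ∏ x ∈ (Finset.univ.erase u).erase v, Real.exp (-(2 * p s(u, x))) := Real.exp_sum _ _
        _ ≤ _ := by
            refine Finset.prod_le_prod (fun _ _ => (Real.exp_pos _).le) fun x _ => ?_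
            rw [mul_one]
            refine one_sub_exp (h.nonneg _) ((h.le _).trans ?_)
            rw [div_le_iff₀ hn]; linarith
    have e1 : p s(u, v) * Ex p (fun ω => bd k (del u ω) v w)
        = Ex p (fun ω => (if ω s(u, v) then (1:ℝ) else 0) * bd k (del u ω) v w) := by
      rw [Ex_split p s(u, v) (fun ω => (if ω s(u, v) then (1:ℝ) else 0) * bd k (del u ω) v w)]
      simp [up_self, hdel, Ex_const]
    rw [e1, ← Ex_mul]
    refine Ex_mono h.adm fun ω => ?_
    rw [mul_comm]
    refine mul_le_mul_of_nonneg_left hq (mul_nonneg ?_ (bd_nonneg _ _ _ _))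
    split_ifs <;> norm_num
  · intro x b ω hx
    have hne : s(u, v) ≠ s(u, x) := fun hab => (Finset.ne_of_mem_erase hx) (hinj _ _ hab).symm
    simp only [hdel]
    rw [show up s(u, x) b ω s(u, v) = ω s(u, v) from by simp [up, Function.update_of_ne, hne]]

lemma row_ineq {C : ℝ} {p : Sym2 V → ℝ} (h : Sp C p) (hC : 2 * C ≤ Fintype.card V) (k : ℕ) (u w : V) :
    ∑ v, p s(u, v) * eb k p v w ≤ (C + Real.exp (2 * C)) * eb k p u w + ∑ v, p s(u, v) * eb k p u v := by
  have hb : ∀ x y, 0 ≤ eb k p x y := fun x y => Ex_nonneg h.adm fun ω => bd_nonneg _ _ _ _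
  by_cases hw : w = u
  · subst hw
    have : ∀ v, eb k p v w = eb k p w v := fun v => by
      unfold eb; congr 1; funext ω; exact bd_comm _ _ _ _
    simp only [this]
    have := mul_nonneg (add_nonneg h.hC (Real.exp_pos (2 * C)).le) (hb w w)
    linarith
  · have h1 : ∀ v, eb k p v w ≤ eb k p u w + eb k p u v + Ex p (fun ω => bd k (del u ω) v w) := by
      intro v
      unfold eb
      rw [← Ex_add, ← Ex_add]
      exact Ex_mono h.adm fun ω => bd_tri k ω u v w
    have h2 : Real.exp (-(2 * C)) * ∑ v, p s(u, v) * Ex p (fun ω => bd k (del u ω) v w) ≤ eb k p u w := by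
      rw [← Finset.add_sum_erase _ _ (Finset.mem_univ u), h.diag, zero_mul, zero_add, Finset.mul_sum]
      refine (Finset.sum_le_sum fun v hv => lf_Ex h hC k (Finset.ne_of_mem_erase hv)).trans ?_
      rw [← Ex_sum]
      exact Ex_mono h.adm fun ω => lf_sum hw ω
    have h3 : ∑ v, p s(u, v) * Ex p (fun ω => bd k (del u ω) v w) ≤ Real.exp (2 * C) * eb k p u w := by
      rw [Real.exp_neg] at h2
      rwa [inv_mul_le_iff₀ (Real.exp_pos _)] at h2
    calc ∑ v, p s(u, v) * eb k p v w
        ≤ ∑ v, p s(u, v) * (eb k p u w + eb k p u v + Ex p (fun ω => bd k (del u ω) v w)) :=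
          Finset.sum_le_sum fun v _ => mul_le_mul_of_nonneg_left (h1 v) (h.nonneg _)
      _ = (∑ v, p s(u, v)) * eb k p u w + ∑ v, p s(u, v) * eb k p u v
          + ∑ v, p s(u, v) * Ex p (fun ω => bd k (del u ω) v w) := by
          rw [Finset.sum_mul, ← Finset.sum_add_distrib, ← Finset.sum_add_distrib]
          exact Finset.sum_congr rfl fun v _ => by ring
      _ ≤ _ := by nlinarith [mul_le_mul_of_nonneg_right (h.row_le u) (hb u w)]

lemma step_ineq {β h B : V → V → ℝ} {n C Q : ℝ} (hn : 0 < n) (hcard : (Fintype.card V : ℝ) = n)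
    (hs : ∀ x y, β x y = β y x) (hβ : ∀ x y, 0 ≤ β x y) (hB : ∀ x y, 0 ≤ B x y)
    (hh : ∀ x y, 0 ≤ h x y ∧ h x y ≤ Q)
    (H : ∀ u w, (∑ v, β u v * B v w) / n ≤ C * B u w + (∑ v, β u v * B u v) / n) :
    ∑ x, ∑ y, (∑ v, β x v * h v y) / n * B x y ≤ C * ∑ x, ∑ y, h x y * B x y
      + Q * ∑ x, ∑ y, β x y * B x y := by
  have e1 : ∑ x, ∑ y, (∑ v, β x v * h v y) / n * B x y
      = ∑ v, ∑ y, h v y * ((∑ x, β v x * B x y) / n) := by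
    simp only [Finset.sum_div, Finset.sum_mul, Finset.mul_sum]
    rw [Finset.sum_comm]
    rw [Finset.sum_comm (s := (Finset.univ : Finset V)) (t := Finset.univ)
      (f := fun v y => ∑ x, h v y * (β v x * B x y / n))]
    refine Finset.sum_congr rfl fun y _ => ?_
    rw [Finset.sum_comm]
    refine Finset.sum_congr rfl fun v _ => Finset.sum_congr rfl fun x _ => ?_
    rw [hs x v]; ring
  have e0 : ∀ v, 0 ≤ (∑ x, β v x * B v x) / n := fun v =>
    div_nonneg (Finset.sum_nonneg fun x _ => mul_nonneg (hβ _ _) (hB _ _)) hn.le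
  rw [e1]
  calc _ ≤ ∑ v, ∑ y, (C * (h v y * B v y) + Q * ((∑ x, β v x * B v x) / n)) := by
        refine Finset.sum_le_sum fun v _ => Finset.sum_le_sum fun y _ => ?_
        have h1 := mul_le_mul_of_nonneg_left (H v y) (hh v y).1
        have h2 := mul_le_mul_of_nonneg_right (hh v y).2 (e0 v)
        nlinarith
    _ = _ := by
        simp only [Finset.sum_add_distrib, ← Finset.mul_sum]
        congr 2
        simp only [Finset.sum_const, Finset.card_univ, nsmul_eq_mul, hcard]
        rw [← Finset.mul_sum, ← Finset.sum_div, mul_div_cancel₀ _ hn.ne']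

lemma sum_pairs {F : Sym2 V → ℝ} (hF : ∀ e, 0 ≤ F e) : ∑ u, ∑ v, F s(u, v) ≤ 2 * ∑ e, F e := by
  rw [← Fintype.sum_prod_type' (f := fun u v => F s(u, v)),
    ← Finset.sum_fiberwise (Finset.univ : Finset (V × V)) (fun q => s(q.1, q.2)), Finset.mul_sum]
  refine Finset.sum_le_sum fun e _ => ?_
  rw [Finset.sum_congr rfl (g := fun _ => F e) (fun q hq => by rw [← (Finset.mem_filter.1 hq).2]),
    Finset.sum_const, nsmul_eq_mul]
  refine mul_le_mul_of_nonneg_right ?_ (hF e)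
  induction e using Sym2.ind with
  | _ a b =>
    have : Finset.univ.filter (fun q : V × V => s(q.1, q.2) = s(a, b)) ⊆ {(a, b), (b, a)} := by
      intro q hq
      rcases Sym2.eq_iff.1 (Finset.mem_filter.1 hq).2 with h | h
      · simp [Prod.ext_iff, h.1, h.2]
      · simp [Prod.ext_iff, h.1, h.2]
    exact_mod_cast (Finset.card_le_card this).trans Finset.card_le_two

end Leaf
end Percolation

namespace Percolation
set_option linter.all false

def kap (C M : ℝ) : ℕ → ℝ
  | 0 => C + M
  | j + 1 => C * kap C M j + M ^ (j + 2)

lemma sum_aux (n m : ℕ) (f : ℕ → Fin n → Fin n → ℝ) (g : Fin n → Fin n → ℝ) :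
    ∑ x, ∑ y, ((∑ j ∈ Finset.range m, (m:ℝ) * f j x y) + g x y)
      = (∑ j ∈ Finset.range m, (m:ℝ) * ∑ x, ∑ y, f j x y) + ∑ x, ∑ y, g x y := by
  simp only [Finset.sum_add_distrib, Finset.mul_sum]
  congr 1
  rw [Finset.sum_comm (s := Finset.range m)]
  exact Finset.sum_congr rfl fun x _ => Finset.sum_comm

namespace Dat
variable {M : ℝ} (D : Dat M)

lemma app_XN (n : ℕ) (hn : 0 < n) (H : Obs M) (x y : Fin n) :
    app H (D.XN n hn) x y = (∑ v : Fin n, D.β n x v * H (D.XN n hn) v y) / n :=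
  D.XN_int n hn _

lemma ww_sum {n : ℕ} (hn : 0 < n) {B : Fin n → Fin n → ℝ} {C : ℝ} (hC : 0 ≤ C) (hB : ∀ x y, 0 ≤ B x y)
    (H : ∀ u w, (∑ v, D.β n u v * B v w) / n ≤ C * B u w + (∑ v, D.β n u v * B u v) / n) (j : ℕ) :
    ∑ x : Fin n, ∑ y : Fin n, ww j (D.XN n hn) x y * B x y ≤ kap C M j * ∑ x, ∑ y, D.β n x y * B x y := by
  have hn' : (0:ℝ) < n := by exact_mod_cast hn
  have st : ∀ (G : Obs M) (Q : ℝ), (∀ x y, 0 ≤ G (D.XN n hn) x y ∧ G (D.XN n hn) x y ≤ Q) →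
      ∑ x : Fin n, ∑ y : Fin n, app G (D.XN n hn) x y * B x y
        ≤ C * (∑ x : Fin n, ∑ y : Fin n, G (D.XN n hn) x y * B x y) + Q * ∑ x, ∑ y, D.β n x y * B x y := by
    intro G Q hG
    have := step_ineq (h := fun x y : Fin n => G (D.XN n hn) x y) hn' (by simp) (D.bsym n) (D.bnn n) hB hG H
    simp only [app_XN]
    exact this
  induction j with
  | zero =>
    have := st (fun X x y => X.K x y) M fun x y => ⟨D.bnn n x y, D.bb n x y⟩
    refine this.trans (le_of_eq ?_)
    show C * (∑ x : Fin n, ∑ y : Fin n, D.β n x y * B x y) + _ = (C + M) * _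
    ring
  | succ j ih =>
    refine (st (ww j) (M ^ (j + 2)) fun x y => ww_bd j _ x y).trans ?_
    have := mul_le_mul_of_nonneg_left ih hC
    simp only [kap]
    nlinarith

lemma cover_sum {n : ℕ} (hn : 0 < n) {B : Fin n → Fin n → ℝ} {C : ℝ} (hC : 0 ≤ C)
    (hB : ∀ x y, 0 ≤ B x y) (hB1 : ∀ x y, B x y ≤ 1)
    (H : ∀ u w, (∑ v, D.β n u v * B v w) / n ≤ C * B u w + (∑ v, D.β n u v * B u v) / n) (m : ℕ) :
    (∑ x, ∑ y, B x y) / (n:ℝ) ^ 2 ≤ (m * ∑ j ∈ Finset.range m, kap C M j) *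
      ((∑ x, ∑ y, D.β n x y * B x y) / (n:ℝ) ^ 2) + II (zz m) (D.XN n hn) := by
  have hn' : (0:ℝ) < n := by exact_mod_cast hn
  have e : II (zz m) (D.XN n hn) = (∑ x : Fin n, ∑ y : Fin n, zz m (D.XN n hn) x y) / (n:ℝ) ^ 2 :=
    D.XN_II n hn _
  rw [e, ← mul_div_assoc, ← add_div]
  refine div_le_div_of_nonneg_right ?_ (by positivity)
  calc ∑ x, ∑ y, B x y ≤ ∑ x : Fin n, ∑ y : Fin n, ((∑ j ∈ Finset.range m, m * (ww j (D.XN n hn) x y * B x y))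
        + zz m (D.XN n hn) x y) := by
        refine Finset.sum_le_sum fun x _ => Finset.sum_le_sum fun y _ => ?_
        have h1 := mul_le_mul_of_nonneg_right (zz_cover D.M1 m (D.XN n hn) x y) (hB x y)
        have h2 := mul_le_mul_of_nonneg_left (hB1 x y) (zz_bd D.M1 m (D.XN n hn) x y).1
        rw [← Finset.mul_sum, ← Finset.sum_mul]
        nlinarith
    _ = (∑ j ∈ Finset.range m, m * ∑ x : Fin n, ∑ y : Fin n, ww j (D.XN n hn) x y * B x y)
        + ∑ x : Fin n, ∑ y : Fin n, zz m (D.XN n hn) x y := by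
        exact sum_aux n m (fun j x y => ww j (D.XN n hn) x y * B x y) (fun x y => zz m (D.XN n hn) x y)
    _ ≤ _ := by
        gcongr
        rw [Finset.mul_sum (s := Finset.range m), Finset.sum_mul]
        refine Finset.sum_le_sum fun j _ => ?_
        rw [mul_assoc]
        exact mul_le_mul_of_nonneg_left (D.ww_sum hn hC hB H j) (Nat.cast_nonneg _)

lemma russo_t {n : ℕ} (hn : 0 < n) {t0 c : ℝ} (h0 : 0 < t0) (htc : t0 < c) (hc : c * M ≤ n) {k : ℕ} (hk : 0 < k) :
    ∃ t, t0 < t ∧ t < c ∧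
      (∑ x, ∑ y, D.β n x y * eb k (D.pt n t) x y) / (n:ℝ) ^ 2 ≤ 2 / (k * (c - t0)) := by
  have hn' : (0:ℝ) < n := by exact_mod_cast hn
  have hk' : (0:ℝ) < k := by exact_mod_cast hk
  have hct : 0 < c - t0 := by linarith
  set φ : ℝ → ℝ := fun t => Ex (fun e => t * D.aw n e) (Psi k)
  have hd := fun t => russo (D.aw n) (Psi k) t
  obtain ⟨t, ht, he⟩ := exists_hasDerivAt_eq_slope φ _ htc
    (fun t _ => (hd t).continuousAt.continuousWithinAt) (fun t _ => hd t)
  refine ⟨t, ht.1, ht.2, ?_⟩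
  have hsp := fun s (h : 0 ≤ s) (h' : s ≤ c) => D.pt_sp hn h h' hc
  have hs := hsp t (h0.trans ht.1).le ht.2.le
  have hφc : φ c ≤ n := by
    have := Ex_mono (hsp c (by linarith) le_rfl).adm (fun ω => (Psi_bounds k ω).2)
    rw [Ex_const, Fintype.card_fin] at this
    exact this
  have hφ0 : 0 ≤ φ t0 := Ex_nonneg (hsp t0 h0.le htc.le).adm fun ω => (Psi_bounds k ω).1
  have hF : ∀ e : Sym2 (Fin n), 0 ≤ D.aw n e * Ex (fun e => t * D.aw n e)
      (fun ω => Psi k (up e true ω) - Psi k (up e false ω)) := fun e =>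
    mul_nonneg (D.aw_nn n e) (Ex_nonneg hs.adm fun ω => sub_nonneg.2 (Psi_mono k (up_ft e ω)))
  have h1 := sum_pairs hF
  rw [he] at h1
  have h2 : (φ c - φ t0) / (c - t0) ≤ n / (c - t0) :=
    div_le_div_of_nonneg_right (by linarith) hct.le
  have h3 : ∑ x, ∑ y, D.β n x y * eb k (D.pt n t) x y * (k / n) ≤ 2 * (n / (c - t0)) := by
    refine le_trans (Finset.sum_le_sum fun x _ => Finset.sum_le_sum fun y _ => ?_)
      (h1.trans (mul_le_mul_of_nonneg_left h2 two_pos.le))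
    rw [aw_mk]
    have := Ex_mono hs.adm (fun ω => Psi_diff k x y ω)
    rw [Ex_mul] at this
    calc _ = D.β n x y / n * (k * eb k (D.pt n t) x y) := by ring
      _ ≤ _ := mul_le_mul_of_nonneg_left this (div_nonneg (D.bnn _ _ _) hn'.le)
  simp only [← Finset.sum_mul] at h3
  rw [div_le_div_iff₀ (by positivity) (by positivity)]
  have h4 := mul_le_mul_of_nonneg_right h3 (mul_nonneg hn'.le hct.le)
  calc _ = (∑ x, ∑ y, D.β n x y * eb k (D.pt n t) x y) * (k / n) * (n * (c - t0)) := by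
        field_simp
    _ ≤ _ := h4
    _ = _ := by field_simp

lemma merge (hirr : Irr D.XW) {t0 c : ℝ} (h0 : 0 < t0) (htc : t0 < c) {ε : ℝ} (hε : 0 < ε) :
    ∃ K0 : ℕ, ∀ k ≥ K0, ∀ᶠ n : ℕ in atTop, ∃ t, t0 < t ∧ t < c ∧
      (∑ x, ∑ y, eb k (D.pt n t) x y) / (n:ℝ) ^ 2 ≤ ε := by
  have hM := D.M1
  set C := (c * M + Real.exp (2 * (c * M))) / t0 with hCd
  have hcM : 0 < c * M := by have : 0 < c := h0.trans htc; positivity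
  have hC : 0 ≤ C := by positivity
  obtain ⟨m, hm⟩ := ((zz_lim D.M1 hirr).eventually_le_const (u := ε / 4) (by positivity)).exists
  set Q := (m:ℝ) * ∑ j ∈ Finset.range m, kap C M j
  have hkap : ∀ j, 0 ≤ kap C M j := by
    intro j
    induction j with
    | zero => simp only [kap]; linarith
    | succ j ih => simp only [kap]; positivity
  have hQ : 0 ≤ Q := mul_nonneg (Nat.cast_nonneg _) (Finset.sum_nonneg fun j _ => hkap j)
  have hct : 0 < c - t0 := by linarith
  obtain ⟨K0, hK0⟩ := exists_nat_gt (Q * 2 / (c - t0) / (ε / 2))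
  refine ⟨K0 + 1, fun k hk => ?_⟩
  have hk0 : 0 < k := by omega
  have hkr : (0:ℝ) < k := by exact_mod_cast hk0
  have hkk : Q * 2 / (c - t0) / (ε / 2) < k := hK0.trans_le (by exact_mod_cast (by omega : K0 ≤ k))
  filter_upwards [D.conv_good (zz_good m) (ε := ε / 4) (by positivity), ev_n (M := M) (2 * c)] with n h1 h2
  have hn' : (0:ℝ) < n := by exact_mod_cast h2.1
  obtain ⟨t, ht1, ht2, ht3⟩ := D.russo_t h2.1 h0 htc (by nlinarith [h2.2]) hk0
  refine ⟨t, ht1, ht2, ?_⟩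
  have ht0 : 0 < t := h0.trans ht1
  have hs := D.pt_sp h2.1 ht0.le ht2.le (by nlinarith [h2.2])
  have hB : ∀ x y, 0 ≤ eb k (D.pt n t) x y := fun x y => Ex_nonneg hs.adm fun ω => bd_nonneg _ _ _ _
  have hB1 : ∀ x y, eb k (D.pt n t) x y ≤ 1 := fun x y => by
    have := Ex_mono hs.adm fun ω => bd_le_one k ω x y
    rwa [Ex_const] at this
  have key := D.cover_sum h2.1 hC hB hB1 (fun u w => ?_) m
  · have e1 := (abs_le.1 (h1 h2.1)).2
    have e2 := mul_le_mul_of_nonneg_left ht3 hQ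
    have e3 : Q * (2 / (k * (c - t0))) ≤ ε / 2 := by
      rw [div_lt_iff₀ (by positivity), div_lt_iff₀ hct] at hkk
      rw [mul_div_assoc', div_le_iff₀ (by positivity)]
      nlinarith
    linarith
  · have h3 := row_ineq hs (by rw [Fintype.card_fin]; linarith [h2.2]) k u w
    have e : ∀ f : Fin n → ℝ, ∑ v, D.pt n t s(u, v) * f v = t * ((∑ v, D.β n u v * f v) / n) := by
      intro f
      rw [Finset.sum_div, Finset.mul_sum]
      refine Finset.sum_congr rfl fun v _ => ?_
      unfold pt; rw [aw_mk]; ring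
    rw [e, e (fun v => eb k (D.pt n t) u v)] at h3
    have h4 : c * M + Real.exp (2 * (c * M)) ≤ t * C := by
      rw [hCd, mul_div_assoc', le_div_iff₀ h0, mul_comm]
      exact mul_le_mul_of_nonneg_right ht1.le (by positivity)
    have h5 := mul_le_mul_of_nonneg_right h4 (hB u w)
    refine le_of_mul_le_mul_left ?_ ht0
    rw [mul_add]
    linarith

end Dat
end Percolation

namespace Percolation
set_option linter.all false

section Det
variable {V : Type*} [Fintype V] [DecidableEq V]

def Ys (k : ℕ) (ω : Cfg V) : ℝ := ∑ v, L k ω v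

lemma Ys_nn (k : ℕ) (ω : Cfg V) : 0 ≤ Ys k ω := Finset.sum_nonneg fun v _ => L_nonneg _ _ _

lemma cs_part (k : ℕ) (ω : Cfg V) (v : V) : (cs ω v : ℝ) ≤ k + ∑ x ∈ comp ω v, L k ω x := by
  by_cases h : k ≤ cs ω v
  · have : ∑ x ∈ comp ω v, L k ω x = cs ω v := by
      rw [Finset.sum_congr rfl (g := fun _ => (1:ℝ)), Finset.sum_const, nsmul_eq_mul, mul_one]; rfl
      intro x hx
      simp [L, ← cs_eq (mem_comp.1 hx), h]
    rw [this]; linarith [(Nat.cast_nonneg k : (0:ℝ) ≤ k)]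
  · have h1 : (cs ω v : ℝ) ≤ k := by exact_mod_cast (not_le.1 h).le
    have : 0 ≤ ∑ x ∈ comp ω v, L k ω x := Finset.sum_nonneg fun v _ => L_nonneg _ _ _
    linarith

lemma cs_one (k : ℕ) (ω : Cfg V) (v : V) : (cs ω v : ℝ) ≤ k + Ys k ω :=
  (cs_part k ω v).trans (add_le_add le_rfl (Finset.sum_le_sum_of_subset_of_nonneg
    (Finset.subset_univ _) fun x _ _ => L_nonneg _ _ _))

lemma cs_two (k : ℕ) {ω : Cfg V} {v w : V} (h : ¬ Rch ω v w) :
    (cs ω v : ℝ) + cs ω w ≤ 2 * k + Ys k ω := by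
  have hd : Disjoint (comp ω v) (comp ω w) := by
    rw [Finset.disjoint_left]
    intro x h1 h2
    exact h ((mem_comp.1 h1).trans (mem_comp.1 h2).symm)
  have h1 := cs_part k ω v
  have h2 := cs_part k ω w
  have h3 : ∑ x ∈ comp ω v ∪ comp ω w, L k ω x ≤ Ys k ω :=
    Finset.sum_le_sum_of_subset_of_nonneg (Finset.subset_univ _) fun x _ _ => L_nonneg _ _ _
  rw [Finset.sum_union hd] at h3
  linarith

def c1 (ω : Cfg V) : ℕ := C1 (graphOf ω)

lemma cs_le_c1 (ω : Cfg V) (v : V) : cs ω v ≤ c1 ω := by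
  unfold c1 C1; rw [← compSize_eq]
  exact Finset.le_sup (f := fun v => compSize (graphOf ω) v) (Finset.mem_univ v)

lemma c1_ex [Nonempty V] (ω : Cfg V) : ∃ v, c1 ω = cs ω v := by
  obtain ⟨v, _, hv⟩ := Finset.exists_mem_eq_sup (Finset.univ : Finset V) Finset.univ_nonempty
    (fun v => compSize (graphOf ω) v)
  exact ⟨v, by rw [← compSize_eq]; exact hv⟩

lemma c1_mono {ω ω' : Cfg V} (h : ∀ e, ω e = true → ω' e = true) : c1 ω ≤ c1 ω' := by
  refine Finset.sup_le fun v _ => ?_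
  rw [compSize_eq]
  exact (cs_mono h v).trans (cs_le_c1 _ _)

lemma c1_le [Nonempty V] (k : ℕ) (ω : Cfg V) : (c1 ω : ℝ) ≤ k + Ys k ω := by
  obtain ⟨v, hv⟩ := c1_ex ω
  rw [hv]; exact cs_one k ω v

lemma c12_le [Nonempty V] (k : ℕ) (ω : Cfg V) : (c1 ω : ℝ) + C2 (graphOf ω) ≤ 2 * k + Ys k ω := by
  set S := {m | ∃ v w : V, ¬(graphOf ω).Reachable v w ∧ m = min (compSize (graphOf ω) v) (compSize (graphOf ω) w)}
  have hC2 : C2 (graphOf ω) = sSup S := rfl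
  rcases S.eq_empty_or_nonempty with h | h
  · rw [hC2, h]; simp
    linarith [c1_le k ω, (Nat.cast_nonneg k : (0:ℝ) ≤ k)]
  · have hb : BddAbove S := by
      refine ⟨c1 ω, ?_⟩
      rintro m ⟨v, w, _, rfl⟩
      rw [compSize_eq]
      exact (min_le_left _ _).trans (cs_le_c1 _ _)
    obtain ⟨v, w, h1, h2⟩ := Nat.sSup_mem h hb
    rw [hC2, h2, compSize_eq, compSize_eq]
    obtain ⟨x, hx⟩ := c1_ex ω
    rw [hx]
    by_cases hxv : Rch ω x v
    · have := cs_two k (fun hr : Rch ω x w => h1 (hxv.symm.trans hr))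
      have h3 : ((min (cs ω v) (cs ω w) : ℕ) : ℝ) ≤ cs ω w := by exact_mod_cast min_le_right _ _
      linarith
    · have := cs_two k hxv
      have h3 : ((min (cs ω v) (cs ω w) : ℕ) : ℝ) ≤ cs ω v := by exact_mod_cast min_le_left _ _
      linarith

lemma c1_ge (k : ℕ) (ω : Cfg V) : Ys k ω ^ 2 - ∑ u, ∑ w, bd k ω u w ≤ c1 ω * Ys k ω := by
  classical
  have e : Ys k ω ^ 2 = ∑ u, ∑ w, L k ω u * L k ω w := by
    unfold Ys; rw [sq, Finset.sum_mul_sum]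
  rw [e, ← Finset.sum_sub_distrib]
  unfold Ys
  rw [Finset.mul_sum]
  refine Finset.sum_le_sum fun u _ => ?_
  rw [← Finset.sum_sub_distrib]
  calc _ ≤ ∑ w, L k ω u * (if w ∈ comp ω u then (1:ℝ) else 0) := by
        refine Finset.sum_le_sum fun w _ => ?_
        simp only [mem_comp, L, bd, Bd]
        by_cases h1 : k ≤ cs ω u <;> by_cases h2 : k ≤ cs ω w <;> by_cases h3 : Rch ω u w <;> simp [h1, h2, h3]
    _ = L k ω u * cs ω u := by rw [← Finset.mul_sum]; simp [cs]
    _ ≤ c1 ω * L k ω u := by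
        rw [mul_comm]
        exact mul_le_mul_of_nonneg_right (by exact_mod_cast cs_le_c1 ω u) (L_nonneg _ _ _)

open Classical in
def Pr (p : Sym2 V → ℝ) (A : Cfg V → Prop) : ℝ := Ex p (fun ω => if A ω then 1 else 0)

lemma Pr_nn {p : Sym2 V → ℝ} (hp : Adm p) (A : Cfg V → Prop) : 0 ≤ Pr p A :=
  Ex_nonneg hp fun ω => by split_ifs <;> norm_num

lemma Pr_or {p : Sym2 V → ℝ} (hp : Adm p) {A B D : Cfg V → Prop} (h : ∀ ω, D ω → A ω ∨ B ω) :
    Pr p D ≤ Pr p A + Pr p B := by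
  unfold Pr; rw [← Ex_add]
  refine Ex_mono hp fun ω => ?_
  have := h ω
  by_cases h1 : A ω <;> by_cases h2 : B ω <;> by_cases h3 : D ω <;> simp_all

lemma Pr_markov {p : Sym2 V → ℝ} (hp : Adm p) {f : Cfg V → ℝ} (hf : ∀ ω, 0 ≤ f ω) {a : ℝ} (ha : 0 < a)
    {A : Cfg V → Prop} (hA : ∀ ω, A ω → a ≤ f ω) : Pr p A ≤ Ex p f / a := by
  rw [le_div_iff₀ ha, mul_comm]; unfold Pr; rw [← Ex_mul]
  refine Ex_mono hp fun ω => ?_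
  by_cases h : A ω <;> simp [h, hA, hf]

lemma Pr_cheb {C : ℝ} {p : Sym2 V → ℝ} (h : Sp C p) (k : ℕ) {δ : ℝ} (hδ : 0 < δ) {A : Cfg V → Prop}
    (hA : ∀ ω, A ω → δ * Fintype.card V ≤ |Ys k ω - Ex p (Ys k)|) :
    Pr p A ≤ (2 * k) ^ 2 * C / δ ^ 2 / Fintype.card V := by
  have hn : (0:ℝ) < Fintype.card V := by exact_mod_cast h.hn
  have h1 := var_le h.adm (2 * k) (Ys k) (fun e ω => by
    have := sumL_diff k (fun _ => 1) 1 (fun _ => by norm_num) e ω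
    simp only [one_mul] at this
    unfold Ys
    rw [abs_of_nonneg this.1]; linarith [this.2])
  have h2 := Pr_markov h.adm (f := fun ω => (Ys k ω - Ex p (Ys k)) ^ 2) (fun ω => sq_nonneg _)
    (a := (δ * Fintype.card V) ^ 2) (by positivity) (A := A) (fun ω hω => by
      rw [← sq_abs (Ys k ω - _)]; exact pow_le_pow_left₀ (by positivity) (hA ω hω) 2)
  refine h2.trans ?_
  rw [div_div, div_le_div_iff₀ (by positivity) (by positivity)]
  have h3 := h1.trans (mul_le_mul_of_nonneg_left h.sum_le (sq_nonneg _))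
  have h4 := mul_le_mul_of_nonneg_right h3 (by positivity : 0 ≤ δ ^ 2 * (Fintype.card V : ℝ))
  refine h4.trans (le_of_eq ?_); ring

lemma Ex_Ys (p : Sym2 V → ℝ) (k : ℕ) : Ex p (Ys k) = ∑ v, th k p v := Ex_sum p _ _

end Det

lemma bern_single (p : ℝ) (b : Bool) : bern p {b} = ENNReal.ofReal (if b then p else 1 - p) := by
  unfold bern
  cases b <;> simp

instance (p : ℝ) : IsFiniteMeasure (bern p) := by
  unfold bern
  constructor
  simp [ENNReal.add_lt_top]

namespace Dat
variable {M : ℝ} (D : Dat M)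

lemma perc_le {n : ℕ} (hn : 0 < n) {c : ℝ} (hc : 0 ≤ c) (hcn : c * M ≤ n) (A : Cfg (Fin n) → Prop) :
    percMeasure (D.β n) (c / n) {ω | A ω} ≤ ENNReal.ofReal (Pr (D.pt n c) A) := by
  classical
  have hs := D.pt_sp hn hc le_rfl hcn
  have e : percMeasure (D.β n) (c / n) = Measure.pi fun e => bern (D.pt n c e) := by
    unfold percMeasure
    congr 1; funext e
    have : c / n * sym2Val (D.β n) e = D.pt n c e := by unfold pt aw; ring
    rw [this, min_eq_left (hs.adm e).2]
  rw [e]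
  have hA : {ω | A ω} = ⋃ ω ∈ Finset.univ.filter A, {ω} := by ext ω; simp
  rw [hA]
  refine (measure_biUnion_finset_le _ _).trans (le_of_eq ?_)
  have h1 : ∀ ω : Cfg (Fin n), (Measure.pi fun e => bern (D.pt n c e)) {ω} = ENNReal.ofReal (wt (D.pt n c) ω) := by
    intro ω
    rw [Measure.pi_singleton]
    simp only [bern_single]
    rw [← ENNReal.ofReal_prod_of_nonneg]; rfl
    intro e _
    have := hs.adm e
    split_ifs <;> linarith
  simp only [h1]
  rw [← ENNReal.ofReal_sum_of_nonneg fun ω _ => wt_nonneg hs.adm ω]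
  congr 1
  unfold Pr Ex
  rw [Finset.sum_filter]
  refine Finset.sum_congr rfl fun ω _ => ?_
  by_cases h : A ω <;> simp [h]

lemma perc_tendsto {c : ℝ} (hc : 0 ≤ c) (A : ∀ n, Cfg (Fin n) → Prop)
    (h : ∀ ε > 0, ∀ᶠ n in atTop, Pr (D.pt n c) (A n) ≤ ε) :
    Tendsto (fun n : ℕ => percMeasure (D.β n) (c / n) {ω | A n ω}) atTop (𝓝 0) := by
  have h1 : Tendsto (fun n => Pr (D.pt n c) (A n)) atTop (𝓝 0) := by
    rw [Metric.tendsto_nhds]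
    intro ε hε
    filter_upwards [h (ε / 2) (by positivity), ev_n (M := M) c] with n h1 h2
    have := Pr_nn (D.pt_sp h2.1 hc le_rfl h2.2).adm (A n)
    rw [Real.dist_eq, sub_zero, abs_of_nonneg this]; linarith
  have h2 := ENNReal.tendsto_ofReal h1
  rw [ENNReal.ofReal_zero] at h2
  refine tendsto_of_tendsto_of_tendsto_of_le_of_le' tendsto_const_nhds h2
    (Eventually.of_forall fun _ => bot_le) ?_
  filter_upwards [ev_n (M := M) c] with n h3
  exact D.perc_le h3.1 hc h3.2 _

lemma cheb_ev (C : ℝ) (k : ℕ) {δ ε : ℝ} (hδ : 0 < δ) (hε : 0 < ε) :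
    ∀ᶠ n : ℕ in atTop, (2 * (k:ℝ)) ^ 2 * C / δ ^ 2 / n ≤ ε :=
  (tendsto_const_div_atTop_nhds_zero_nat _).eventually_le_const hε

/-- upper bound on the number of vertices in large components -/
lemma up_ev {c : ℝ} (hc : 0 ≤ c) {δ : ℝ} (hδ : 0 < δ) : ∃ k : ℕ, ∀ ε > 0, ∀ᶠ n : ℕ in atTop,
    Pr (D.pt n c) (fun ω => (∫ x, SS D.XW c x ∂D.XW.μ + δ) * n ≤ Ys k ω) ≤ ε := by
  obtain ⟨k, hk⟩ := D.mY_upper hc (half_pos hδ)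
  refine ⟨k, fun ε hε => ?_⟩
  filter_upwards [hk k le_rfl, ev_n (M := M) c, cheb_ev (c * M) k (half_pos hδ) hε] with n h1 h2 h3
  have hn' : (0:ℝ) < n := by exact_mod_cast h2.1
  refine (Pr_cheb (D.pt_sp h2.1 hc le_rfl h2.2) k (half_pos hδ) fun ω hω => ?_).trans
    (by rw [Fintype.card_fin]; exact h3)
  rw [Fintype.card_fin, Ex_Ys]
  unfold mY at h1
  rw [div_le_iff₀ hn'] at h1
  refine le_trans ?_ (le_abs_self _)
  linarith

lemma low_ev (hirr : Irr D.XW) {c : ℝ} (hc : 0 < c) {δ ε : ℝ} (hδ : 0 < δ) (hε : 0 < ε) : ∀ᶠ n : ℕ in atTop,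
    Pr (D.pt n c) (fun ω => (c1 ω : ℝ) ≤ (∫ x, SS D.XW c x ∂D.XW.μ - δ) * n) ≤ ε := by
  set ρ := ∫ x, SS D.XW c x ∂D.XW.μ with hρ
  obtain ⟨t0, h0, htc, hl⟩ := left_cont (X := D.XW) hc (ε := δ / 4) (by positivity)
  obtain ⟨k, hk⟩ := D.merge hirr h0 htc (ε := δ ^ 2 / 32 * (ε / 2)) (by positivity)
  have hk' := hk (k + 1) (by omega)
  filter_upwards [hk', D.mY_lower h0.le k (ε := δ / 4) (by positivity), ev_n (M := M) c,
    cheb_ev (c * M) (k + 1) (δ := δ / 4) (by positivity) (half_pos hε)] with n h1 h2 h3 h4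
  obtain ⟨t, ht1, ht2, hb⟩ := h1
  have hn' : (0:ℝ) < n := by exact_mod_cast h3.1
  haveI : Nonempty (Fin n) := ⟨⟨0, h3.1⟩⟩
  have ht0 : 0 < t := h0.trans ht1
  have hs := D.pt_sp h3.1 ht0.le ht2.le h3.2
  have hsc := D.pt_sp h3.1 hc.le le_rfl h3.2
  have mono : Pr (D.pt n c) (fun ω => (c1 ω : ℝ) ≤ (ρ - δ) * n) ≤ Pr (D.pt n t) (fun ω => (c1 ω : ℝ) ≤ (ρ - δ) * n) := by
    classical
    have := Ex_mono_t (D.aw_nn n) ht0.le ht2.le (fun e => (hsc.adm e).2)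
      (f := fun ω => -1 * (if (c1 ω : ℝ) ≤ (ρ - δ) * n then (1:ℝ) else 0)) (fun e ω => by
        have hm : (c1 (up e false ω) : ℝ) ≤ c1 (up e true ω) := by exact_mod_cast c1_mono (up_ft e ω)
        split_ifs with ha hb
        · exact le_rfl
        · norm_num
        · exact absurd (hm.trans (by assumption)) ha
        · exact le_rfl)
    rw [Ex_mul, Ex_mul] at this
    have h' : Ex (fun e => c * D.aw n e) (fun ω => if (c1 ω : ℝ) ≤ (ρ - δ) * n then (1:ℝ) else 0) ≤
      Ex (fun e => t * D.aw n e) (fun ω => if (c1 ω : ℝ) ≤ (ρ - δ) * n then (1:ℝ) else 0) := by linarith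
    unfold Pr
    convert h' using 3 <;> rfl
  refine mono.trans ?_
  have hmean : (ρ - δ / 2) * n ≤ Ex (D.pt n t) (Ys (k + 1)) := by
    have h5 : Ex (D.pt n t0) (Ys (k + 1)) ≤ Ex (D.pt n t) (Ys (k + 1)) :=
      Ex_mono_t (D.aw_nn n) h0.le ht1.le (fun e => (hs.adm e).2) fun e ω =>
        Finset.sum_le_sum fun v _ => L_mono (up_ft e ω) v
    unfold mY at h2
    rw [← Ex_Ys, le_div_iff₀ hn'] at h2
    refine le_trans (mul_le_mul_of_nonneg_right ?_ hn'.le) (h2.trans h5)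
    linarith
  have hE : Ex (D.pt n t) (fun ω => ∑ u, ∑ w, bd (k + 1) ω u w) ≤ δ ^ 2 / 32 * (ε / 2) * (n:ℝ) ^ 2 := by
    rw [div_le_iff₀ (by positivity)] at hb
    refine le_trans (le_of_eq ?_) hb
    rw [Ex_sum]
    exact Finset.sum_congr rfl fun u _ => Ex_sum _ _ _
  have p1 := Pr_cheb hs (k + 1) (δ := δ / 4) (by positivity)
    (A := fun ω => Ys (k + 1) ω ≤ (ρ - 3 * δ / 4) * n) (fun ω hω => by
      rw [Fintype.card_fin, abs_sub_comm]
      refine le_trans ?_ (le_abs_self _)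
      linarith)
  have p2 := Pr_markov hs.adm (f := fun ω => ∑ u, ∑ w, bd (k + 1) ω u w)
    (fun ω => Finset.sum_nonneg fun u _ => Finset.sum_nonneg fun w _ => bd_nonneg _ _ _ _)
    (a := δ ^ 2 / 32 * (n:ℝ) ^ 2) (by positivity)
    (A := fun ω => δ ^ 2 / 32 * (n:ℝ) ^ 2 ≤ ∑ u, ∑ w, bd (k + 1) ω u w) (fun ω h => h)
  have p3 : Ex (D.pt n t) (fun ω => ∑ u, ∑ w, bd (k + 1) ω u w) / (δ ^ 2 / 32 * (n:ℝ) ^ 2) ≤ ε / 2 := by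
    rw [div_le_iff₀ (by positivity)]; linarith
  rw [Fintype.card_fin] at p1
  refine (Pr_or hs.adm (A := fun ω => Ys (k + 1) ω ≤ (ρ - 3 * δ / 4) * n)
    (B := fun ω => δ ^ 2 / 32 * (n:ℝ) ^ 2 ≤ ∑ u, ∑ w, bd (k + 1) ω u w) fun ω hω => ?_).trans
    (by linarith)
  by_contra hcon
  push Not at hcon
  obtain ⟨q1, q2⟩ := hcon
  have q3 := c1_ge (k + 1) ω
  have hc0 : (0:ℝ) ≤ c1 ω := Nat.cast_nonneg _
  have hρδ : 0 ≤ ρ - δ := by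
    by_contra hneg
    have := mul_neg_of_neg_of_pos (not_le.1 hneg) hn'
    linarith
  have y1 : δ / 4 * n < Ys (k + 1) ω := by
    refine lt_of_le_of_lt ?_ q1
    gcongr; linarith
  have y0 : 0 < Ys (k + 1) ω := lt_trans (by positivity) y1
  have r1 : (c1 ω : ℝ) ≤ Ys (k + 1) ω - δ / 4 * n := by linarith
  have r2 := mul_le_mul_of_nonneg_right r1 y0.le
  have r3 := mul_lt_mul_of_pos_left y1 (by positivity : 0 < δ / 4 * n)
  nlinarith [sq_nonneg (δ * n)]

end Dat
end Percolation

namespace Percolation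
set_option linter.all false
namespace Dat
variable {M : ℝ} (D : Dat M)

lemma big_n (k : ℕ) {δ : ℝ} (hδ : 0 < δ) : ∀ᶠ n : ℕ in atTop, (2 * k : ℝ) < δ * n :=
  (tendsto_natCast_atTop_atTop.const_mul_atTop hδ).eventually_gt_atTop _

lemma final (h : Percolation.Irreducible D.W) {c : ℝ} (hc : 0 < c) :
    (∀ ε > 0, Tendsto (fun n : ℕ => percMeasure (D.β n) (c / n)
          {ω | ε ≤ |(C1 (graphOf ω) : ℝ) / n - survival fun x y => c * D.W x y|}) atTop (𝓝 0)) ∧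
    (∀ ε > 0, Tendsto
        (fun n : ℕ => percMeasure (D.β n) (c / n) {ω | ε * n ≤ (C2 (graphOf ω) : ℝ)}) atTop (𝓝 0)) := by
  have hirr := D.irr h
  rw [D.surv hc.le]
  set ρ := ∫ x, SS D.XW c x ∂D.XW.μ with hρ
  constructor
  · intro δ hδ
    refine D.perc_tendsto hc.le (fun n ω => δ ≤ |(C1 (graphOf ω) : ℝ) / n - ρ|) fun ε hε => ?_
    obtain ⟨k, hk⟩ := D.up_ev hc.le (half_pos hδ)
    filter_upwards [hk (ε / 2) (half_pos hε), D.low_ev hirr hc hδ (half_pos hε), ev_n (M := M) c,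
      big_n k (half_pos hδ)] with n h1 h2 h3 h4
    have hn' : (0:ℝ) < n := by exact_mod_cast h3.1
    haveI : Nonempty (Fin n) := ⟨⟨0, h3.1⟩⟩
    refine (Pr_or (D.pt_sp h3.1 hc.le le_rfl h3.2).adm fun ω hω => ?_).trans
      ((add_le_add h2 h1).trans (by linarith))
    have hk0 : (0:ℝ) ≤ k := Nat.cast_nonneg k
    have hc1 := c1_le k ω
    rcases le_abs.1 hω with h | h
    · right
      have h' : ρ + δ ≤ (c1 ω : ℝ) / n := by unfold c1; linarith
      rw [le_div_iff₀ hn'] at h'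
      linarith
    · left
      have h' : (c1 ω : ℝ) / n ≤ ρ - δ := by unfold c1; linarith
      rwa [div_le_iff₀ hn'] at h'
  · intro δ hδ
    refine D.perc_tendsto hc.le (fun n ω => δ * n ≤ (C2 (graphOf ω) : ℝ)) fun ε hε => ?_
    obtain ⟨k, hk⟩ := D.up_ev hc.le (δ := δ / 4) (by positivity)
    filter_upwards [hk (ε / 2) (half_pos hε), D.low_ev hirr hc (δ := δ / 4) (by positivity) (half_pos hε),
      ev_n (M := M) c, big_n k (half_pos hδ)] with n h1 h2 h3 h4
    haveI : Nonempty (Fin n) := ⟨⟨0, h3.1⟩⟩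
    refine (Pr_or (D.pt_sp h3.1 hc.le le_rfl h3.2).adm fun ω hω => ?_).trans
      ((add_le_add h2 h1).trans (by linarith))
    by_contra hcon
    push Not at hcon
    have := c12_le k ω
    linarith [hcon.1, hcon.2]

end Dat
end Percolation

open Percolation MeasureTheory Filter Topology in
/-- If `(G_n)` converges to an irreducible graphon `W` and `c > 0`,
then `C₁/n → ρ(cW)` in probability and `C₂ = o_p(n)` for the random graph `G_n(c/n)`. -/
theorem irreducible_giant_component
    (β : ∀ n : ℕ, Fin n → Fin n → ℝ) (βmax : ℝ)
    (hsym : ∀ n i j, β n i j = β n j i)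
    (hnonneg : ∀ n i j, 0 ≤ β n i j)
    (hdiag : ∀ n i, β n i i = 0)
    (hbound : ∀ n i j, β n i j ≤ βmax)
    (W : ℝ → ℝ → ℝ) (hW : IsGraphon W) (hconv : ConvergesTo β W)
    (hirr : Percolation.Irreducible W)
    (c : ℝ) (hc : 0 < c) :
    (∀ ε > 0, Tendsto
        (fun n : ℕ => percMeasure (β n) (c / n)
          {ω | ε ≤ |(C1 (graphOf ω) : ℝ) / n - survival fun x y => c * W x y|})
        atTop (nhds 0)) ∧
    (∀ ε > 0, Tendsto
        (fun n : ℕ => percMeasure (β n) (c / n) {ω | ε * n ≤ (C2 (graphOf ω) : ℝ)})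
        atTop (nhds 0)) := by
  obtain ⟨Wm, Wnn, Wsym, M0, hM0⟩ := hW
  exact Dat.final (M := max 1 (max βmax M0)) ⟨β, W, hsym, hnonneg, hdiag,
    fun n i j => (hbound n i j).trans ((le_max_left _ _).trans (le_max_right _ _)), Wm, Wnn, Wsym,
    fun x y => (hM0 x y).trans ((le_max_right _ _).trans (le_max_right _ _)), hconv, le_max_left _ _⟩ hirr hc
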